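/- Let d ≥ 2, λ ∈ ℂ, let X ⊆ ℝ^d be an open set homeomorphic to ℝ^d, and let w : X → ℂ and ψ : X → X be smooth functions such that the weighted composition operator C_{w,ψ} : f ↦ w·(f∘ψ) is well-defined on E_λ(X) = {f : X → ℂ smooth : Δf = λf on X}, i.e. maps E_λ(X) into itself. Equip E_λ(X) with the compact-open topology. Then the following are equivalent: (i) C_{w,ψ} is topologically weakly mixing on E_λ(X); (ii) w has no zeros, ψ is injective, ψ is run-away, and the derivative of ψ at every point x ∈ X is an invertible linear map (det Jψ(x) ≠ 0). If moreover |w(x)| ≤ 1 for all x ∈ X, then (i) and (ii) are further equivalent to: (iii) C_{w,ψ} is hypercyclic on E_λ(X). -/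

import Mathlib

/-- Topological weak mixing. -/
def TopWeaklyMixing {E : Type*} [TopologicalSpace E] (T : E → E) : Prop :=
  ∀ U₁ U₂ V₁ V₂ : Set E, IsOpen U₁ → IsOpen U₂ → IsOpen V₁ → IsOpen V₂ →
    U₁.Nonempty → U₂.Nonempty → V₁.Nonempty → V₂.Nonempty →
    ∃ m : ℕ, 1 ≤ m ∧ ((T^[m] '' U₁) ∩ V₁).Nonempty ∧ ((T^[m] '' U₂) ∩ V₂).Nonempty

/-- Hypercyclicity: some orbit is dense. -/
def Hypercyclic {E : Type*} [TopologicalSpace E] (T : E → E) : Prop :=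
  ∃ x : E, Dense (Set.range fun m : ℕ => T^[m] x)

/-- The run-away property. -/
def RunAway {X : Type*} [TopologicalSpace X] (ψ : X → X) : Prop :=
  ∀ K : Set X, IsCompact K → ∃ m : ℕ, 1 ≤ m ∧ (ψ^[m] '' K) ∩ K = ∅

/-- The `j`-th partial derivative of a function on `ℝ^d`. -/
noncomputable def pd {d : ℕ} {F : Type*} [NormedAddCommGroup F] [NormedSpace ℝ F]
    (j : Fin d) (f : EuclideanSpace ℝ (Fin d) → F) : EuclideanSpace ℝ (Fin d) → F :=
  fun x => fderiv ℝ f x (EuclideanSpace.single j 1)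

/-- The Laplacian `Δf = ∑ⱼ ∂ⱼ²f` of a function on `ℝ^d`. -/
noncomputable def lap {d : ℕ} {F : Type*} [NormedAddCommGroup F] [NormedSpace ℝ F]
    (f : EuclideanSpace ℝ (Fin d) → F) : EuclideanSpace ℝ (Fin d) → F :=
  fun x => ∑ j, pd j (pd j f) x

/-- The eigenspace `E_λ(X) = {f : X → ℂ smooth, Δf = λf}`, realized as the set of those
continuous functions on `X` (an open subset of `ℝ^d`) which agree on `X` with a function that
is smooth on `X` and satisfies `Δg = λg` there. -/
def Eig (d : ℕ) (lam : ℂ) (X : Set (EuclideanSpace ℝ (Fin d))) : Set C(↥X, ℂ) :=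
  {f | ∃ g : EuclideanSpace ℝ (Fin d) → ℂ, ContDiffOn ℝ (⊤ : ℕ∞) g X ∧
    (∀ x ∈ X, lap g x = lam * g x) ∧ ∀ z : ↥X, f z = g ↑z}

/-- The weighted composition operator `C_{w,ψ} f = w·(f∘ψ)` on `C(X, ℂ)`. -/
noncomputable def wcomp {d : ℕ} (X : Set (EuclideanSpace ℝ (Fin d)))
    (w : EuclideanSpace ℝ (Fin d) → ℂ)
    (ψ : EuclideanSpace ℝ (Fin d) → EuclideanSpace ℝ (Fin d))
    (hw : ContinuousOn w X) (hψ : ContinuousOn ψ X) (hm : Set.MapsTo ψ X X) :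
    C(↥X, ℂ) → C(↥X, ℂ) :=
  fun f => ⟨fun x => w ↑x * f ⟨ψ ↑x, hm x.2⟩, by
    exact (hw.restrict).mul (f.continuous.comp ((hψ.restrict).subtype_mk fun x => hm x.2))⟩

section Helpers

open Set Filter Topology MeasureTheory
open scoped ContDiff Convolution Manifold

section Calculus

variable {d : ℕ}

theorem pd_congr {F : Type*} [NormedAddCommGroup F] [NormedSpace ℝ F]
    {f g : EuclideanSpace ℝ (Fin d) → F} {x : EuclideanSpace ℝ (Fin d)} (j : Fin d)
    (h : f =ᶠ[𝓝 x] g) : pd j f =ᶠ[𝓝 x] pd j g := by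
  filter_upwards [h.eventuallyEq_nhds] with y hy
  simp only [pd, hy.fderiv_eq]

theorem lap_congr {F : Type*} [NormedAddCommGroup F] [NormedSpace ℝ F]
    {f g : EuclideanSpace ℝ (Fin d) → F} {x : EuclideanSpace ℝ (Fin d)}
    (h : f =ᶠ[𝓝 x] g) : lap f x = lap g x := by
  simp only [lap]
  exact Finset.sum_congr rfl fun j _ => (pd_congr j (pd_congr j h)).eq_of_nhds

theorem ContDiffAt.pd {F : Type*} [NormedAddCommGroup F] [NormedSpace ℝ F]
    {f : EuclideanSpace ℝ (Fin d) → F} {x : EuclideanSpace ℝ (Fin d)} (j : Fin d)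
    (h : ContDiffAt ℝ ∞ f x) : ContDiffAt ℝ ∞ (pd j f) x :=
  (h.fderiv_right (m := ∞) (by simp)).clm_apply contDiffAt_const

theorem ContDiffAt.lap {F : Type*} [NormedAddCommGroup F] [NormedSpace ℝ F]
    {f : EuclideanSpace ℝ (Fin d) → F} {x : EuclideanSpace ℝ (Fin d)}
    (h : ContDiffAt ℝ ∞ f x) : ContDiffAt ℝ ∞ (lap f) x :=
  ContDiffAt.sum fun j _ => (h.pd j).pd j

theorem ContDiff.pd {F : Type*} [NormedAddCommGroup F] [NormedSpace ℝ F]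
    {f : EuclideanSpace ℝ (Fin d) → F} (j : Fin d)
    (h : ContDiff ℝ ∞ f) : ContDiff ℝ ∞ (pd j f) :=
  contDiff_iff_contDiffAt.2 fun _ => h.contDiffAt.pd j

theorem ContDiff.lap {F : Type*} [NormedAddCommGroup F] [NormedSpace ℝ F]
    {f : EuclideanSpace ℝ (Fin d) → F}
    (h : ContDiff ℝ ∞ f) : ContDiff ℝ ∞ (lap f) :=
  contDiff_iff_contDiffAt.2 fun _ => h.contDiffAt.lap

theorem ContDiffAt.eventually_contDiffAt {F : Type*} [NormedAddCommGroup F] [NormedSpace ℝ F]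
    {f : EuclideanSpace ℝ (Fin d) → F} {x : EuclideanSpace ℝ (Fin d)}
    {X : Set (EuclideanSpace ℝ (Fin d))} (hX : IsOpen X) (hx : x ∈ X)
    (h : ContDiffOn ℝ ∞ f X) : ∀ᶠ y in 𝓝 x, ContDiffAt ℝ ∞ f y := by
  filter_upwards [hX.mem_nhds hx] with y hy using h.contDiffAt (hX.mem_nhds hy)

theorem pd_add {F : Type*} [NormedAddCommGroup F] [NormedSpace ℝ F]
    {f g : EuclideanSpace ℝ (Fin d) → F} {x : EuclideanSpace ℝ (Fin d)} (j : Fin d)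
    (hf : DifferentiableAt ℝ f x) (hg : DifferentiableAt ℝ g x) :
    pd j (fun y => f y + g y) x = pd j f x + pd j g x := by
  simp only [pd]; rw [fderiv_fun_add hf hg]; rfl

theorem pd_mul {f g : EuclideanSpace ℝ (Fin d) → ℂ} {x : EuclideanSpace ℝ (Fin d)} (j : Fin d)
    (hf : DifferentiableAt ℝ f x) (hg : DifferentiableAt ℝ g x) :
    pd j (fun y => f y * g y) x = pd j f x * g x + f x * pd j g x := by
  simp only [pd]; rw [fderiv_fun_mul hf hg]; simp; ring

theorem pd_sum {F : Type*} [NormedAddCommGroup F] [NormedSpace ℝ F] {ι : Type*} {s : Finset ι}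
    {f : ι → EuclideanSpace ℝ (Fin d) → F} {x : EuclideanSpace ℝ (Fin d)} (j : Fin d)
    (hf : ∀ i ∈ s, DifferentiableAt ℝ (f i) x) :
    pd j (fun y => ∑ i ∈ s, f i y) x = ∑ i ∈ s, pd j (f i) x := by
  simp only [pd]; rw [fderiv_fun_sum hf]; simp

theorem pd_const {F : Type*} [NormedAddCommGroup F] [NormedSpace ℝ F] (c : F)
    (x : EuclideanSpace ℝ (Fin d)) (j : Fin d) : pd j (fun _ => c) x = 0 := by
  simp [pd]

theorem pd_const_mul {f : EuclideanSpace ℝ (Fin d) → ℂ} {x : EuclideanSpace ℝ (Fin d)} (j : Fin d)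
    (c : ℂ) (hf : DifferentiableAt ℝ f x) :
    pd j (fun y => c * f y) x = c * pd j f x := by
  rw [pd_mul j (differentiableAt_const c) hf, pd_const]; simp

theorem lap_add {f g : EuclideanSpace ℝ (Fin d) → ℂ} {x : EuclideanSpace ℝ (Fin d)}
    (hf : ∀ᶠ y in 𝓝 x, ContDiffAt ℝ ∞ f y) (hg : ∀ᶠ y in 𝓝 x, ContDiffAt ℝ ∞ g y) :
    lap (fun y => f y + g y) x = lap f x + lap g x := by
  simp only [lap, ← Finset.sum_add_distrib]
  refine Finset.sum_congr rfl fun j _ => ?_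
  have : pd j (fun y => f y + g y) =ᶠ[𝓝 x] fun y => pd j f y + pd j g y := by
    filter_upwards [hf, hg] with y h1 h2
    exact pd_add j (h1.differentiableAt (by simp)) (h2.differentiableAt (by simp))
  rw [(pd_congr j this).eq_of_nhds, pd_add j]
  · exact (hf.self_of_nhds.pd j).differentiableAt (by simp)
  · exact (hg.self_of_nhds.pd j).differentiableAt (by simp)

theorem lap_const_mul {f : EuclideanSpace ℝ (Fin d) → ℂ} {x : EuclideanSpace ℝ (Fin d)} (c : ℂ)
    (hf : ∀ᶠ y in 𝓝 x, ContDiffAt ℝ ∞ f y) :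
    lap (fun y => c * f y) x = c * lap f x := by
  simp only [lap, Finset.mul_sum]
  refine Finset.sum_congr rfl fun j _ => ?_
  have : pd j (fun y => c * f y) =ᶠ[𝓝 x] fun y => c * pd j f y := by
    filter_upwards [hf] with y h1
    exact pd_const_mul j c (h1.differentiableAt (by simp))
  rw [(pd_congr j this).eq_of_nhds, pd_const_mul j]
  exact (hf.self_of_nhds.pd j).differentiableAt (by simp)

theorem pd_comp_sub {F : Type*} [NormedAddCommGroup F] [NormedSpace ℝ F]
    (f : EuclideanSpace ℝ (Fin d) → F) (a : EuclideanSpace ℝ (Fin d)) (j : Fin d) :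
    pd j (fun y => f (y - a)) = fun y => pd j f (y - a) := by
  funext y
  simp only [pd, fderiv_comp_sub]

theorem lap_comp_sub {F : Type*} [NormedAddCommGroup F] [NormedSpace ℝ F]
    (f : EuclideanSpace ℝ (Fin d) → F) (a : EuclideanSpace ℝ (Fin d)) :
    lap (fun y => f (y - a)) = fun y => lap f (y - a) := by
  funext y
  simp only [lap, pd_comp_sub]

/-- The Laplacian of a radial function. -/
theorem lap_radial {g g1 g2 : ℂ → ℂ} {Ω : Set ℂ} (hΩ : IsOpen Ω)
    (h1 : ∀ s ∈ Ω, HasDerivAt g (g1 s) s) (h2 : ∀ s ∈ Ω, HasDerivAt g1 (g2 s) s)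
    {x : EuclideanSpace ℝ (Fin d)} (hx : ((‖x‖ ^ 2 : ℝ) : ℂ) ∈ Ω) :
    lap (fun y : EuclideanSpace ℝ (Fin d) => g ((‖y‖ ^ 2 : ℝ) : ℂ)) x =
      4 * ((‖x‖ ^ 2 : ℝ) : ℂ) * g2 ((‖x‖ ^ 2 : ℝ) : ℂ)
        + 2 * (d : ℂ) * g1 ((‖x‖ ^ 2 : ℝ) : ℂ) := by
  have key : ∀ (k k1 : ℂ → ℂ), (∀ s ∈ Ω, HasDerivAt k (k1 s) s) →
      ∀ y : EuclideanSpace ℝ (Fin d), ((‖y‖ ^ 2 : ℝ) : ℂ) ∈ Ω →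
      HasFDerivAt (fun y : EuclideanSpace ℝ (Fin d) => k ((‖y‖ ^ 2 : ℝ) : ℂ))
        (((2 : ℝ) • innerSL ℝ y).smulRight (k1 ((‖y‖ ^ 2 : ℝ) : ℂ))) y := by
    intro k k1 hk y hy
    have A : HasFDerivAt (fun y : EuclideanSpace ℝ (Fin d) => ‖y‖ ^ 2) ((2 : ℝ) • innerSL ℝ y) y := by
      have := (hasStrictFDerivAt_norm_sq y).hasFDerivAt
      rwa [← Nat.cast_smul_eq_nsmul ℝ, Nat.cast_ofNat] at this
    refine (HasFDerivAt.comp y ((hk _ hy).comp_ofReal).hasFDerivAt A).congr_fderiv ?_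
    ext v
    simp
    ring
  have hop : ∀ᶠ y in 𝓝 x, ((‖y‖ ^ 2 : ℝ) : ℂ) ∈ Ω :=
    ContinuousAt.preimage_mem_nhds (f := fun y : EuclideanSpace ℝ (Fin d) => ((‖y‖ ^ 2 : ℝ) : ℂ))
      (by fun_prop) (hΩ.mem_nhds hx)
  have hpd : ∀ j : Fin d, pd j (fun y : EuclideanSpace ℝ (Fin d) => g ((‖y‖ ^ 2 : ℝ) : ℂ)) =ᶠ[𝓝 x]
      fun y => (2 * (y j : ℂ)) * g1 ((‖y‖ ^ 2 : ℝ) : ℂ) := by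
    intro j
    filter_upwards [hop] with y hy
    simp only [pd]
    rw [(key g g1 h1 y hy).fderiv]
    simp [EuclideanSpace.inner_single_right]
  have hpd2 : ∀ j : Fin d, pd j (fun y : EuclideanSpace ℝ (Fin d) =>
        (2 * (y j : ℂ)) * g1 ((‖y‖ ^ 2 : ℝ) : ℂ)) x =
      2 * g1 ((‖x‖ ^ 2 : ℝ) : ℂ) + 4 * ((x j ^ 2 : ℝ) : ℂ) * g2 ((‖x‖ ^ 2 : ℝ) : ℂ) := by
    intro j
    have hl : HasFDerivAt (fun y : EuclideanSpace ℝ (Fin d) => (2 * (y j : ℂ)))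
        ((2 : ℂ) • (Complex.ofRealCLM.comp (EuclideanSpace.proj j))) x := by
      have : HasFDerivAt (fun y : EuclideanSpace ℝ (Fin d) => ((y j : ℝ) : ℂ))
          (Complex.ofRealCLM.comp (EuclideanSpace.proj (𝕜 := ℝ) j)) x :=
        (Complex.ofRealCLM.comp (EuclideanSpace.proj (𝕜 := ℝ) j)).hasFDerivAt
      exact this.const_mul 2
    simp only [pd]
    rw [(hl.fun_mul (key g1 g2 h2 x hx)).fderiv]
    simp [EuclideanSpace.inner_single_right]
    ring
  simp only [lap]
  rw [Finset.sum_congr rfl fun j _ => ((pd_congr j (hpd j)).eq_of_nhds.trans (hpd2 j))]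
  rw [Finset.sum_add_distrib, ← Finset.sum_mul, ← Finset.sum_mul, ← Finset.mul_sum,
    ← Complex.ofReal_sum, ← EuclideanSpace.real_norm_sq_eq]
  simp
  ring

end Calculus

section RadialProfile

/-- The density of the Gaussian mixture in the parametrix of `Δ - λ`. -/
noncomputable def mixDensity (d : ℕ) (lam : ℂ) (k : ℕ) (r : ℝ) : ℂ :=
  2 * (r : ℂ) ^ (d + 2 * k) / (r : ℂ) ^ 3 * Complex.exp (-lam / (4 * (r : ℂ) ^ 2))

/-- The radial profile of a parametrix of `Δ - λ` and its derivatives (up to sign). -/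
noncomputable def mixProfile (d : ℕ) (lam : ℂ) (k : ℕ) (s : ℂ) : ℂ :=
  ∫ r in Ioi (1 : ℝ), mixDensity d lam k r * Complex.exp (-(s * (r : ℂ) ^ 2))

theorem norm_cexp_div_le (lam : ℂ) {r : ℝ} (hr : 1 ≤ r) :
    ‖Complex.exp (-lam / (4 * (r : ℂ) ^ 2))‖ ≤ Real.exp ‖lam‖ := by
  rw [Complex.norm_exp]
  refine Real.exp_le_exp.2 ((Complex.re_le_norm _).trans ?_)
  rw [norm_div, norm_neg]
  refine div_le_self (norm_nonneg _) ?_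
  simp only [norm_mul, norm_pow, Complex.norm_real, Real.norm_eq_abs, sq_abs]
  norm_num
  nlinarith

theorem norm_mixDensity_le (d : ℕ) (lam : ℂ) (k : ℕ) {r : ℝ} (hr : 1 ≤ r) :
    ‖mixDensity d lam k r‖ ≤ 2 * Real.exp ‖lam‖ * r ^ (d + 2 * k) := by
  have h0 : 0 ≤ r := by linarith
  rw [mixDensity, norm_mul, norm_div, norm_mul, norm_pow, norm_pow, Complex.norm_real,
    Real.norm_of_nonneg h0]
  have h1 := norm_cexp_div_le lam hr
  have h2 : ‖(2 : ℂ)‖ * r ^ (d + 2 * k) / r ^ 3 ≤ 2 * r ^ (d + 2 * k) := by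
    rw [Complex.norm_ofNat]
    exact div_le_self (by positivity) (one_le_pow₀ hr)
  calc _ ≤ (2 * r ^ (d + 2 * k)) * Real.exp ‖lam‖ := by gcongr
    _ = _ := by ring

theorem norm_cexp_neg_mul_sq_le {s : ℂ} {b : ℝ} (hb : b ≤ s.re) (r : ℝ) :
    ‖Complex.exp (-(s * (r : ℂ) ^ 2))‖ ≤ Real.exp (-b * r ^ 2) := by
  rw [Complex.norm_exp, ← Complex.ofReal_pow]
  simp only [Complex.neg_re, Complex.mul_re, Complex.ofReal_re, Complex.ofReal_im]
  apply Real.exp_le_exp.2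
  nlinarith [sq_nonneg r]

theorem integrableOn_pow_mul_exp (n : ℕ) {b : ℝ} (hb : 0 < b) (C : ℝ) :
    IntegrableOn (fun r : ℝ => C * r ^ n * Real.exp (-b * r ^ 2)) (Ioi 1) := by
  have := (integrable_rpow_mul_exp_neg_mul_sq hb (s := n) (by
    have : (0 : ℝ) ≤ n := by positivity
    linarith)).integrableOn (s := Ioi 1)
  simpa [mul_assoc, IntegrableOn] using this.const_mul C

theorem continuousOn_mixDensity (d : ℕ) (lam : ℂ) (k : ℕ) :
    ContinuousOn (mixDensity d lam k) (Ioi 1) := by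
  have h : ∀ r ∈ Ioi (1 : ℝ), (r : ℂ) ≠ 0 := fun r (hr : 1 < r) => by
    exact_mod_cast (by linarith : r ≠ 0)
  unfold mixDensity
  refine ContinuousOn.mul (ContinuousOn.div (by fun_prop) (by fun_prop) fun r hr =>
    pow_ne_zero _ (h r hr)) (ContinuousOn.cexp (ContinuousOn.div (by fun_prop) (by fun_prop)
      fun r hr => mul_ne_zero (by norm_num) (pow_ne_zero _ (h r hr))))

theorem norm_mixIntegrand_le (d : ℕ) (lam : ℂ) (k : ℕ) {s : ℂ} {b : ℝ} (hb : b ≤ s.re) {r : ℝ}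
    (hr : 1 ≤ r) : ‖mixDensity d lam k r * Complex.exp (-(s * (r : ℂ) ^ 2))‖ ≤
      2 * Real.exp ‖lam‖ * r ^ (d + 2 * k) * Real.exp (-b * r ^ 2) := by
  rw [norm_mul]
  exact mul_le_mul (norm_mixDensity_le d lam k hr) (norm_cexp_neg_mul_sq_le hb r)
    (norm_nonneg _) (by positivity)

theorem integrableOn_mix (d : ℕ) (lam : ℂ) (k : ℕ) {s : ℂ} (hs : 0 < s.re) :
    IntegrableOn (fun r : ℝ => mixDensity d lam k r * Complex.exp (-(s * (r : ℂ) ^ 2)))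
      (Ioi 1) := by
  refine Integrable.mono' (integrableOn_pow_mul_exp (d + 2 * k) hs (2 * Real.exp ‖lam‖))
    (ContinuousOn.aestronglyMeasurable
      ((continuousOn_mixDensity d lam k).mul (by fun_prop)) measurableSet_Ioi) ?_
  refine (ae_restrict_iff' measurableSet_Ioi).2 (Eventually.of_forall fun r hr => ?_)
  exact norm_mixIntegrand_le d lam k le_rfl (le_of_lt hr)

theorem mixDensity_mul_sq (d : ℕ) (lam : ℂ) (k : ℕ) (r : ℝ) :
    mixDensity d lam k r * (r : ℂ) ^ 2 = mixDensity d lam (k + 1) r := by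
  unfold mixDensity; ring

theorem hasDerivAt_mixProfile (d : ℕ) (lam : ℂ) (k : ℕ) {s : ℂ} (hs : 0 < s.re) :
    HasDerivAt (mixProfile d lam k) (-mixProfile d lam (k + 1) s) s := by
  have hU : {z : ℂ | s.re / 2 < z.re} ∈ 𝓝 s :=
    (isOpen_lt continuous_const Complex.continuous_re).mem_nhds (by
      change s.re / 2 < s.re
      linarith)
  have hU0 : {z : ℂ | 0 < z.re} ∈ 𝓝 s :=
    (isOpen_lt continuous_const Complex.continuous_re).mem_nhds hs
  have := (hasDerivAt_integral_of_dominated_loc_of_deriv_le (μ := volume.restrict (Ioi (1 : ℝ)))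
    (F := fun (s : ℂ) (r : ℝ) => mixDensity d lam k r * Complex.exp (-(s * (r : ℂ) ^ 2)))
    (F' := fun (s : ℂ) (r : ℝ) => -(mixDensity d lam (k + 1) r * Complex.exp (-(s * (r : ℂ) ^ 2))))
    (bound := fun r : ℝ => 2 * Real.exp ‖lam‖ * r ^ (d + 2 * (k + 1)) *
      Real.exp (-(s.re / 2) * r ^ 2)) hU
    (by filter_upwards [hU0] with z hz using (integrableOn_mix d lam k hz).aestronglyMeasurable)
    (integrableOn_mix d lam k hs)
    (integrableOn_mix d lam (k + 1) hs).neg.aestronglyMeasurable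
    ?_ (integrableOn_pow_mul_exp _ (by linarith) _) ?_).2
  · rw [integral_neg] at this
    exact this
  · refine (ae_restrict_iff' measurableSet_Ioi).2 (Eventually.of_forall fun r hr z hz => ?_)
    rw [norm_neg]
    exact norm_mixIntegrand_le d lam (k + 1) (le_of_lt hz) (le_of_lt hr)
  · refine (Eventually.of_forall fun r z _ => ?_)
    have h := (((hasDerivAt_id z).mul_const ((r : ℂ) ^ 2)).neg.cexp).const_mul (mixDensity d lam k r)
    refine h.congr_deriv ?_
    rw [← mixDensity_mul_sq]
    simp
    ring

/-- The antiderivative in the mixture parameter that computes `Δ - λ` of the parametrix. -/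
theorem hasDerivAt_mix (d : ℕ) (lam s : ℂ) {r : ℝ} (hr : 0 < r) :
    HasDerivAt (fun r : ℝ => -4 * (r : ℂ) ^ d * Complex.exp (-lam / (4 * (r : ℂ) ^ 2)) *
        Complex.exp (-(s * (r : ℂ) ^ 2)))
      ((4 * s * mixDensity d lam 2 r - 2 * d * mixDensity d lam 1 r - lam * mixDensity d lam 0 r) *
        Complex.exp (-(s * (r : ℂ) ^ 2))) r := by
  have hr0 : (r : ℂ) ≠ 0 := by exact_mod_cast hr.ne'
  have hid : HasDerivAt (fun r : ℝ => (r : ℂ)) 1 r := Complex.ofRealCLM.hasDerivAt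
  have h1 : HasDerivAt (fun r : ℝ => -4 * (r : ℂ) ^ d) (-4 * (d * (r : ℂ) ^ (d - 1) * 1)) r :=
    (hid.fun_pow d).const_mul _
  have h2 : HasDerivAt (fun r : ℝ => Complex.exp (-lam / (4 * (r : ℂ) ^ 2)))
      (Complex.exp (-lam / (4 * (r : ℂ) ^ 2)) * (lam / (2 * (r : ℂ) ^ 3))) r := by
    have := ((hasDerivAt_const r (-lam)).fun_div ((hid.fun_pow 2).const_mul 4)
      (mul_ne_zero (by norm_num) (pow_ne_zero _ hr0))).cexp
    refine this.congr_deriv ?_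
    congr 1
    field_simp
    ring
  have h3 : HasDerivAt (fun r : ℝ => Complex.exp (-(s * (r : ℂ) ^ 2)))
      (Complex.exp (-(s * (r : ℂ) ^ 2)) * (-(s * (2 * r)))) r := by
    have := ((hid.fun_pow 2).const_mul s).fun_neg.cexp
    refine this.congr_deriv ?_
    simp
  refine ((h1.fun_mul h2).fun_mul h3).congr_deriv ?_
  unfold mixDensity
  have hd : (d : ℂ) * (r : ℂ) ^ (d - 1) = d * (r : ℂ) ^ d / r := by
    rcases Nat.eq_zero_or_pos d with h | h
    · simp [h]
    · obtain ⟨n, rfl⟩ : ∃ n, d = n + 1 := ⟨d - 1, by omega⟩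
      rw [Nat.add_sub_cancel]
      field_simp
      ring
  rw [hd]
  field_simp
  ring

theorem tendsto_pow_mul_exp_neg_mul_sq (n : ℕ) {b : ℝ} (hb : 0 < b) :
    Tendsto (fun r : ℝ => r ^ n * Real.exp (-b * r ^ 2)) atTop (𝓝 0) := by
  have h1 : Tendsto (fun r : ℝ => b * r ^ 2) atTop atTop :=
    (tendsto_pow_atTop (by norm_num)).const_mul_atTop hb
  have h2 := ((Real.tendsto_pow_mul_exp_neg_atTop_nhds_zero n).comp h1).const_mul ((b ^ n)⁻¹)
  rw [mul_zero] at h2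
  refine squeeze_zero' ?_ ?_ h2
  · filter_upwards [eventually_ge_atTop 0] with r hr
    positivity
  · filter_upwards [eventually_ge_atTop 1] with r hr
    have hbn : b ^ n ≠ 0 := by positivity
    simp only [Function.comp, mul_pow, neg_mul]
    rw [show (b ^ n)⁻¹ * (b ^ n * (r ^ 2) ^ n * Real.exp (-(b * r ^ 2))) =
      (r ^ 2) ^ n * Real.exp (-(b * r ^ 2)) by field_simp]
    gcongr
    nlinarith

theorem tendsto_mix (d : ℕ) (lam : ℂ) {s : ℂ} (hs : 0 < s.re) :
    Tendsto (fun r : ℝ => -4 * (r : ℂ) ^ d * Complex.exp (-lam / (4 * (r : ℂ) ^ 2)) *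
        Complex.exp (-(s * (r : ℂ) ^ 2))) atTop (𝓝 0) := by
  have h := (tendsto_pow_mul_exp_neg_mul_sq d hs).const_mul (4 * Real.exp ‖lam‖)
  rw [mul_zero] at h
  refine squeeze_zero_norm' ?_ h
  filter_upwards [eventually_ge_atTop 1] with r hr
  rw [norm_mul, norm_mul, norm_mul, norm_pow, Complex.norm_real,
    Real.norm_of_nonneg (by linarith : 0 ≤ r), norm_neg, Complex.norm_ofNat]
  calc 4 * r ^ d * ‖Complex.exp (-lam / (4 * (r : ℂ) ^ 2))‖ * ‖Complex.exp (-(s * (r : ℂ) ^ 2))‖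
      ≤ 4 * r ^ d * Real.exp ‖lam‖ * Real.exp (-s.re * r ^ 2) := by
        gcongr
        · exact norm_cexp_div_le lam hr
        · exact norm_cexp_neg_mul_sq_le le_rfl r
    _ = _ := by ring

theorem mixProfile_ode (d : ℕ) (lam : ℂ) {s : ℂ} (hs : 0 < s.re) :
    4 * s * mixProfile d lam 2 s - 2 * d * mixProfile d lam 1 s - lam * mixProfile d lam 0 s =
      4 * Complex.exp (-lam / 4) * Complex.exp (-s) := by
  have h2 := (integrableOn_mix d lam 2 hs).const_mul (4 * s)
  have h1 := (integrableOn_mix d lam 1 hs).const_mul (2 * d)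
  have h0 := (integrableOn_mix d lam 0 hs).const_mul lam
  have key := integral_Ioi_of_hasDerivAt_of_tendsto' (a := (1 : ℝ))
    (fun r hr => hasDerivAt_mix d lam s (r := r) (zero_lt_one.trans_le hr)) (by
      refine ((h2.sub h1).sub h0).congr (Eventually.of_forall fun r => ?_)
      simp only [Pi.sub_apply]
      ring) (tendsto_mix d lam hs)
  have e : ∀ r : ℝ, (4 * s * mixDensity d lam 2 r - 2 * d * mixDensity d lam 1 r -
      lam * mixDensity d lam 0 r) * Complex.exp (-(s * (r : ℂ) ^ 2)) =
      4 * s * (mixDensity d lam 2 r * Complex.exp (-(s * (r : ℂ) ^ 2))) -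
      2 * d * (mixDensity d lam 1 r * Complex.exp (-(s * (r : ℂ) ^ 2))) -
      lam * (mixDensity d lam 0 r * Complex.exp (-(s * (r : ℂ) ^ 2))) := fun r => by ring
  simp only [e] at key
  have h21 : IntegrableOn (fun r : ℝ =>
      4 * s * (mixDensity d lam 2 r * Complex.exp (-(s * (r : ℂ) ^ 2))) -
      2 * d * (mixDensity d lam 1 r * Complex.exp (-(s * (r : ℂ) ^ 2)))) (Ioi 1) := h2.sub h1
  rw [integral_sub h21 h0, integral_sub h2 h1, integral_const_mul, integral_const_mul,
    integral_const_mul] at key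
  simp only [mixProfile]
  rw [key]
  simp

end RadialProfile

section Correction

/-- The exponential generating function of a sequence. -/
noncomputable def expGen (b : ℕ → ℂ) (s : ℂ) : ℂ :=
  ∑' n : ℕ, b n * s ^ n / (n.factorial : ℂ)

theorem summable_expGen {b : ℕ → ℂ} {A B : ℝ} (hb : ∀ n, ‖b n‖ ≤ A * B ^ n) {R : ℝ} :
    Summable fun n : ℕ => ‖b n‖ * R ^ n / (n.factorial : ℝ) := by
  have h := (Real.summable_pow_div_factorial (B * |R|)).mul_left A
  refine Summable.of_norm_bounded h fun n => ?_
  rw [norm_div, norm_mul, norm_norm, norm_pow, Real.norm_eq_abs R, Real.norm_natCast]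
  calc ‖b n‖ * |R| ^ n / (n.factorial : ℝ) ≤ A * B ^ n * |R| ^ n / (n.factorial : ℝ) := by
        gcongr; exact hb n
    _ = _ := by ring

theorem summable_expGen_complex {b : ℕ → ℂ} {A B : ℝ} (hb : ∀ n, ‖b n‖ ≤ A * B ^ n) (s : ℂ) :
    Summable fun n : ℕ => b n * s ^ n / (n.factorial : ℂ) := by
  refine Summable.of_norm_bounded (summable_expGen hb (R := ‖s‖)) fun n => ?_
  rw [norm_div, norm_mul, norm_pow, Complex.norm_natCast]

theorem norm_shift_le {b : ℕ → ℂ} {A B : ℝ} (hb : ∀ n, ‖b n‖ ≤ A * B ^ n) (n : ℕ) :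
    ‖b (n + 1)‖ ≤ A * B * B ^ n := (hb (n + 1)).trans_eq (by ring)

theorem hasDerivAt_expGen {b : ℕ → ℂ} {A B : ℝ} (hb : ∀ n, ‖b n‖ ≤ A * B ^ n) (s : ℂ) :
    HasDerivAt (expGen b) (expGen (fun n => b (n + 1)) s) s := by
  set R : ℝ := ‖s‖ + 1
  have hterm : ∀ (n : ℕ) (t : ℂ), b (n + 1) * (((n + 1 : ℕ) : ℂ) * t ^ n) /
      ((n + 1).factorial : ℂ) = b (n + 1) * t ^ n / (n.factorial : ℂ) := by
    intro n t
    have h1 : ((n + 1 : ℕ) : ℂ) ≠ 0 := by exact_mod_cast Nat.succ_ne_zero n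
    have h2 : (n.factorial : ℂ) ≠ 0 := by exact_mod_cast n.factorial_ne_zero
    rw [Nat.factorial_succ, Nat.cast_mul]
    field_simp
  have hu : Summable fun n : ℕ => ‖b n‖ * (n * R ^ (n - 1)) / (n.factorial : ℝ) := by
    rw [← summable_nat_add_iff 1]
    refine (summable_expGen (norm_shift_le hb) (R := R)).congr fun n => ?_
    have h1 : ((n + 1 : ℕ) : ℝ) ≠ 0 := by exact_mod_cast Nat.succ_ne_zero n
    have h2 : (n.factorial : ℝ) ≠ 0 := by exact_mod_cast n.factorial_ne_zero
    rw [Nat.factorial_succ, Nat.cast_mul, Nat.add_sub_cancel]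
    field_simp
  have key := hasDerivAt_tsum_of_isPreconnected (t := Metric.ball (0 : ℂ) R) (y₀ := s) (y := s)
    (g := fun (n : ℕ) (t : ℂ) => b n * t ^ n / (n.factorial : ℂ))
    (g' := fun (n : ℕ) (t : ℂ) => b n * (n * t ^ (n - 1)) / (n.factorial : ℂ))
    hu Metric.isOpen_ball (convex_ball _ _).isPreconnected
    (fun n t _ => ((hasDerivAt_pow n t).const_mul (b n)).div_const _) ?_ (by simp [R])
    (summable_expGen_complex hb s) (by simp [R])
  · refine key.congr_deriv ?_
    rw [Summable.tsum_eq_zero_add]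
    · simp only [Nat.cast_zero, zero_mul, mul_zero, zero_div, zero_add, expGen]
      exact tsum_congr fun n => hterm n s
    · rw [← summable_nat_add_iff 1]
      exact (summable_expGen_complex (norm_shift_le hb) s).congr fun n => (hterm n s).symm
  · intro n t ht
    have : ‖t‖ ≤ R := by simpa using (Metric.mem_ball.1 ht).le
    rw [norm_div, norm_mul, norm_mul, norm_pow, Complex.norm_natCast, Complex.norm_natCast]
    gcongr

/-- Taylor coefficients (times factorials) of the entire correction. -/
noncomputable def corrCoeff (d : ℕ) (lam c : ℂ) : ℕ → ℂ
  | 0 => 0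
  | n + 1 => (lam * corrCoeff d lam c n + c * (-1) ^ n) / (4 * n + 2 * d)

theorem norm_corrCoeff_le {d : ℕ} (hd : 1 ≤ d) (lam c : ℂ) (n : ℕ) :
    ‖corrCoeff d lam c n‖ ≤ ‖c‖ * (‖lam‖ + 1) ^ n := by
  induction n with
  | zero => simp [corrCoeff]
  | succ n ih =>
    rw [corrCoeff, norm_div]
    have h1 : (1 : ℝ) ≤ ‖(4 * n + 2 * d : ℂ)‖ := by
      rw [show (4 * n + 2 * d : ℂ) = ((4 * n + 2 * d : ℕ) : ℂ) by push_cast; ring,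
        Complex.norm_natCast]
      exact_mod_cast (by omega)
    refine (div_le_self (norm_nonneg _) h1).trans ((norm_add_le _ _).trans ?_)
    rw [norm_mul, norm_mul, norm_pow, norm_neg, norm_one, one_pow, mul_one]
    have h2 : (1 : ℝ) ≤ (‖lam‖ + 1) ^ n := one_le_pow₀ (by linarith [norm_nonneg lam])
    calc ‖lam‖ * ‖corrCoeff d lam c n‖ + ‖c‖ ≤ ‖lam‖ * (‖c‖ * (‖lam‖ + 1) ^ n) +
          ‖c‖ * (‖lam‖ + 1) ^ n := by
            gcongr
            exact le_mul_of_one_le_right (norm_nonneg _) h2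
      _ = _ := by ring

theorem corrCoeff_ode {d : ℕ} (hd : 1 ≤ d) (lam c s : ℂ) :
    4 * s * expGen (fun n => corrCoeff d lam c (n + 2)) s +
      2 * d * expGen (fun n => corrCoeff d lam c (n + 1)) s - lam * expGen (corrCoeff d lam c) s =
      c * Complex.exp (-s) := by
  set b := corrCoeff d lam c
  have hb := norm_corrCoeff_le hd lam c
  have hb1 := norm_shift_le hb
  have hb2 := norm_shift_le hb1
  have s0 := (summable_expGen_complex hb s).hasSum
  have s1 := (summable_expGen_complex hb1 s).hasSum
  have s2 := (summable_expGen_complex hb2 s).hasSum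
  have s2' : HasSum (fun n : ℕ => (n : ℂ) * b (n + 1) * s ^ n / (n.factorial : ℂ))
      (s * expGen (fun n => b (n + 2)) s) := by
    rw [← hasSum_nat_add_iff' 1]
    simp only [Finset.range_one, Finset.sum_singleton, Nat.cast_zero, zero_mul, zero_div, sub_zero]
    refine (s2.mul_left s).congr_fun fun n => ?_
    have h1 : ((n + 1 : ℕ) : ℂ) ≠ 0 := by exact_mod_cast Nat.succ_ne_zero n
    have h2 : (n.factorial : ℂ) ≠ 0 := by exact_mod_cast n.factorial_ne_zero
    rw [Nat.factorial_succ, Nat.cast_mul]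
    field_simp
    simp only [b]
    ring
  have hexp : HasSum (fun n : ℕ => (-s) ^ n / (n.factorial : ℂ)) (Complex.exp (-s)) := by
    rw [Complex.exp_eq_exp_ℂ]
    exact NormedSpace.expSeries_div_hasSum_exp (-s)
  have h := ((s2'.mul_left 4).add (s1.mul_left (2 * (d : ℂ)))).sub (s0.mul_left lam)
  have h' := hexp.mul_left c
  rw [mul_assoc]
  refine h.unique (h'.congr_fun fun n => ?_)
  have h3 : (4 * n + 2 * d : ℂ) ≠ 0 := by
    rw [show (4 * n + 2 * d : ℂ) = ((4 * n + 2 * d : ℕ) : ℂ) by push_cast; ring]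
    exact_mod_cast (by omega)
  have h4 : (4 * n + 2 * d : ℂ) * b (n + 1) = lam * b n + c * (-1) ^ n := by
    simp only [b]
    rw [corrCoeff]
    field_simp
  have h5 : (4 * (n : ℂ) * b (n + 1) + 2 * d * b (n + 1) - lam * b n) = c * (-1) ^ n := by
    linear_combination h4
  rw [neg_pow]
  have h2 : (n.factorial : ℂ) ≠ 0 := by exact_mod_cast n.factorial_ne_zero
  field_simp
  linear_combination (s ^ n) * h5

/-- The radial profile of a fundamental solution of `Δ - λ`. -/
noncomputable def fundProfile (d : ℕ) (lam s : ℂ) : ℂ :=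
  mixProfile d lam 0 s + expGen (corrCoeff d lam (-4 * Complex.exp (-lam / 4))) s

theorem exists_fundProfile_ode {d : ℕ} (hd : 1 ≤ d) (lam : ℂ) :
    ∃ g1 g2 : ℂ → ℂ, (∀ s : ℂ, 0 < s.re → HasDerivAt (fundProfile d lam) (g1 s) s) ∧
      (∀ s : ℂ, 0 < s.re → HasDerivAt g1 (g2 s) s) ∧
      ∀ s : ℂ, 0 < s.re → 4 * s * g2 s + 2 * d * g1 s = lam * fundProfile d lam s := by
  set c := -4 * Complex.exp (-lam / 4) with hc
  have hb := norm_corrCoeff_le hd lam c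
  have hb1 := norm_shift_le hb
  refine ⟨fun s => -mixProfile d lam 1 s + expGen (fun n => corrCoeff d lam c (n + 1)) s,
    fun s => mixProfile d lam 2 s + expGen (fun n => corrCoeff d lam c (n + 2)) s,
    fun s hs => (hasDerivAt_mixProfile d lam 0 hs).add (hasDerivAt_expGen hb s),
    fun s hs => ?_, fun s hs => ?_⟩
  · have := (hasDerivAt_mixProfile d lam 1 hs).neg.add (hasDerivAt_expGen hb1 s)
    rw [neg_neg] at this
    exact this
  · have h1 := mixProfile_ode d lam hs
    have h2 := corrCoeff_ode hd lam c s
    simp only [fundProfile, ← hc]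
    rw [hc] at h2 ⊢
    linear_combination h1 + h2

end Correction

section Representation

variable {d : ℕ}

theorem HasCompactSupport.pd {f : EuclideanSpace ℝ (Fin d) → ℂ} (h : HasCompactSupport f)
    (j : Fin d) : HasCompactSupport (pd j f) :=
  h.fderiv_apply (𝕜 := ℝ) _

theorem tsupport_pd_subset (f : EuclideanSpace ℝ (Fin d) → ℂ) (j : Fin d) :
    tsupport (pd j f) ⊆ tsupport f :=
  tsupport_fderiv_apply_subset ℝ _

theorem HasCompactSupport.lap {f : EuclideanSpace ℝ (Fin d) → ℂ} (h : HasCompactSupport f) :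
    HasCompactSupport (lap f) := by
  refine h.mono' fun x hx => ?_
  by_contra hx'
  refine hx ?_
  simp only [_root_.lap]
  refine Finset.sum_eq_zero fun j _ => image_eq_zero_of_notMem_tsupport fun hxj => hx' ?_
  exact tsupport_pd_subset f j (tsupport_pd_subset _ j hxj)

theorem integral_mul_pd {f φ : EuclideanSpace ℝ (Fin d) → ℂ} (hf : ContDiff ℝ ∞ f)
    (hφ : ContDiff ℝ ∞ φ) (hc : HasCompactSupport φ) (j : Fin d) :
    ∫ y, f y * pd j φ y = -∫ y, pd j f y * φ y := by
  refine integral_mul_fderiv_eq_neg_fderiv_mul_of_integrable ?_ ?_ ?_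
    (fun x _ => hf.differentiable (by simp) x) (fun x _ => hφ.differentiable (by simp) x)
  · exact ((hf.pd j).continuous.mul hφ.continuous).integrable_of_hasCompactSupport hc.mul_left
  · exact (hf.continuous.mul (hφ.pd j).continuous).integrable_of_hasCompactSupport
      (hc.pd j).mul_left
  · exact (hf.continuous.mul hφ.continuous).integrable_of_hasCompactSupport hc.mul_left

theorem integral_mul_lap {f φ : EuclideanSpace ℝ (Fin d) → ℂ} (hf : ContDiff ℝ ∞ f)
    (hφ : ContDiff ℝ ∞ φ) (hc : HasCompactSupport φ) :
    ∫ y, f y * lap φ y = ∫ y, lap f y * φ y := by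
  simp only [lap, Finset.mul_sum, Finset.sum_mul]
  rw [integral_finsetSum, integral_finsetSum]
  · refine Finset.sum_congr rfl fun j _ => ?_
    rw [integral_mul_pd hf (hφ.pd j) (hc.pd j), integral_mul_pd (hf.pd j) hφ hc, neg_neg]
  · exact fun j _ => (((hf.pd j).pd j).continuous.mul hφ.continuous).integrable_of_hasCompactSupport
      hc.mul_left
  · exact fun j _ => (hf.continuous.mul ((hφ.pd j).pd j).continuous).integrable_of_hasCompactSupport
      ((hc.pd j).pd j).mul_left

theorem contDiff_radial_sub {h : ℂ → ℂ} (hh : ContDiff ℂ ∞ h) (x : EuclideanSpace ℝ (Fin d)) :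
    ContDiff ℝ ∞ fun y : EuclideanSpace ℝ (Fin d) => h ((‖y - x‖ ^ 2 : ℝ) : ℂ) :=
  (hh.restrict_scalars ℝ).comp
    (Complex.ofRealCLM.contDiff.comp ((contDiff_id.sub contDiff_const).norm_sq ℝ))

theorem lap_radial_sub {g g1 g2 : ℂ → ℂ} {Ω : Set ℂ} (hΩ : IsOpen Ω)
    (h1 : ∀ s ∈ Ω, HasDerivAt g (g1 s) s) (h2 : ∀ s ∈ Ω, HasDerivAt g1 (g2 s) s)
    {x y : EuclideanSpace ℝ (Fin d)} (hx : ((‖y - x‖ ^ 2 : ℝ) : ℂ) ∈ Ω) :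
    lap (fun y : EuclideanSpace ℝ (Fin d) => g ((‖y - x‖ ^ 2 : ℝ) : ℂ)) y =
      4 * ((‖y - x‖ ^ 2 : ℝ) : ℂ) * g2 ((‖y - x‖ ^ 2 : ℝ) : ℂ)
        + 2 * (d : ℂ) * g1 ((‖y - x‖ ^ 2 : ℝ) : ℂ) := by
  have := congrFun (lap_comp_sub
    (fun y : EuclideanSpace ℝ (Fin d) => g ((‖y‖ ^ 2 : ℝ) : ℂ)) x) y
  rw [this, lap_radial hΩ h1 h2 hx]

/-- The Gaussian average of `φ` around `x`, with a power of the squared distance as a weight. -/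
noncomputable def gaussAvg (φ : EuclideanSpace ℝ (Fin d) → ℂ) (x : EuclideanSpace ℝ (Fin d))
    (k : ℕ) (r : ℝ) : ℂ :=
  ∫ y, ((‖y - x‖ ^ 2 : ℝ) : ℂ) ^ k *
    Complex.exp (-(((‖y - x‖ ^ 2 : ℝ) : ℂ) * (r : ℂ) ^ 2)) * φ y

theorem integrable_gauss {φ : EuclideanSpace ℝ (Fin d) → ℂ} (hφ : Continuous φ)
    (hc : HasCompactSupport φ) (x : EuclideanSpace ℝ (Fin d)) (k : ℕ) (r : ℝ) :
    Integrable fun y => ((‖y - x‖ ^ 2 : ℝ) : ℂ) ^ k *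
      Complex.exp (-(((‖y - x‖ ^ 2 : ℝ) : ℂ) * (r : ℂ) ^ 2)) * φ y :=
  Continuous.integrable_of_hasCompactSupport (by fun_prop) hc.mul_left

theorem hasDerivAt_gaussAvg {φ : EuclideanSpace ℝ (Fin d) → ℂ} (hφ : Continuous φ)
    (hc : HasCompactSupport φ) (x : EuclideanSpace ℝ (Fin d)) (r : ℝ) :
    HasDerivAt (gaussAvg φ x 0) (-(2 * r) * gaussAvg φ x 1 r) r := by
  have := (hasDerivAt_integral_of_dominated_loc_of_deriv_le (μ := volume)
    (F := fun (r : ℝ) (y : EuclideanSpace ℝ (Fin d)) => ((‖y - x‖ ^ 2 : ℝ) : ℂ) ^ 0 *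
      Complex.exp (-(((‖y - x‖ ^ 2 : ℝ) : ℂ) * (r : ℂ) ^ 2)) * φ y)
    (F' := fun (r : ℝ) (y : EuclideanSpace ℝ (Fin d)) =>
      -(2 * r) * (((‖y - x‖ ^ 2 : ℝ) : ℂ) ^ 1 *
      Complex.exp (-(((‖y - x‖ ^ 2 : ℝ) : ℂ) * (r : ℂ) ^ 2)) * φ y))
    (bound := fun y => 2 * (|r| + 1) * (‖y - x‖ ^ 2 * ‖φ y‖)) (Metric.ball_mem_nhds r one_pos)
    (Eventually.of_forall fun t => (integrable_gauss hφ hc x 0 t).aestronglyMeasurable)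
    (integrable_gauss hφ hc x 0 r)
    ((integrable_gauss hφ hc x 1 r).const_mul _).aestronglyMeasurable ?_ ?_ ?_).2
  · rw [integral_const_mul] at this
    exact this
  · refine Eventually.of_forall fun y t ht => ?_
    have h1 : |t| ≤ |r| + 1 := by
      have : |t - r| < 1 := ht
      have := abs_sub_abs_le_abs_sub t r
      linarith
    have h2 : ‖Complex.exp (-(((‖y - x‖ ^ 2 : ℝ) : ℂ) * (t : ℂ) ^ 2))‖ ≤ 1 := by
      refine (norm_cexp_neg_mul_sq_le (b := 0) (by
        rw [Complex.ofReal_re]; positivity) t).trans (by simp)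
    rw [norm_mul, norm_mul, norm_mul, norm_neg, norm_mul, pow_one, Complex.norm_real,
      Complex.norm_real, Complex.norm_ofNat, Real.norm_eq_abs, Real.norm_of_nonneg (sq_nonneg _)]
    calc 2 * |t| * (‖y - x‖ ^ 2 * _ * ‖φ y‖) ≤ 2 * (|r| + 1) * (‖y - x‖ ^ 2 * 1 * ‖φ y‖) := by
          gcongr
      _ = _ := by ring
  · refine Integrable.const_mul (Continuous.integrable_of_hasCompactSupport (by fun_prop) ?_) _
    exact hc.norm.mul_left
  · refine Eventually.of_forall fun y t _ => ?_
    have hid : HasDerivAt (fun r : ℝ => (r : ℂ)) 1 t := Complex.ofRealCLM.hasDerivAt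
    have := ((((hid.fun_pow 2).const_mul ((‖y - x‖ ^ 2 : ℝ) : ℂ)).fun_neg.cexp).const_mul
      (((‖y - x‖ ^ 2 : ℝ) : ℂ) ^ 0)).mul_const (φ y)
    refine this.congr_deriv ?_
    simp
    ring

theorem contDiff_gauss (r : ℝ) : ContDiff ℂ ∞ fun s : ℂ => Complex.exp (-(s * (r : ℂ) ^ 2)) :=
  ((contDiff_id.mul contDiff_const).neg).cexp

theorem integral_gauss_mul_lap_sub {φ : EuclideanSpace ℝ (Fin d) → ℂ} (hφ : ContDiff ℝ ∞ φ)
    (hc : HasCompactSupport φ) (lam : ℂ) (x : EuclideanSpace ℝ (Fin d)) (r : ℝ) :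
    ∫ y, Complex.exp (-(((‖y - x‖ ^ 2 : ℝ) : ℂ) * (r : ℂ) ^ 2)) * (lap φ y - lam * φ y) =
      4 * (r : ℂ) ^ 4 * gaussAvg φ x 1 r - 2 * d * (r : ℂ) ^ 2 * gaussAvg φ x 0 r
        - lam * gaussAvg φ x 0 r := by
  have h1 : ∀ s ∈ (univ : Set ℂ), HasDerivAt (fun s : ℂ => Complex.exp (-(s * (r : ℂ) ^ 2)))
      (-(r : ℂ) ^ 2 * Complex.exp (-(s * (r : ℂ) ^ 2))) s := fun s _ => by
    refine (((hasDerivAt_id s).mul_const ((r : ℂ) ^ 2)).neg.cexp).congr_deriv ?_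
    simp
    ring
  have h2 : ∀ s ∈ (univ : Set ℂ),
      HasDerivAt (fun s => -(r : ℂ) ^ 2 * Complex.exp (-(s * (r : ℂ) ^ 2)))
      (-(r : ℂ) ^ 2 * (-(r : ℂ) ^ 2 * Complex.exp (-(s * (r : ℂ) ^ 2)))) s := fun s hs =>
    (h1 s hs).const_mul _
  have hE := contDiff_radial_sub (contDiff_gauss r) x
  have i0 := integrable_gauss hφ.continuous hc x 0 r
  have i1 := integrable_gauss hφ.continuous hc x 1 r
  have iL : Integrable fun y => Complex.exp (-(((‖y - x‖ ^ 2 : ℝ) : ℂ) * (r : ℂ) ^ 2)) * lap φ y :=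
    (hE.continuous.mul hφ.lap.continuous).integrable_of_hasCompactSupport hc.lap.mul_left
  calc _ = ∫ y, (Complex.exp (-(((‖y - x‖ ^ 2 : ℝ) : ℂ) * (r : ℂ) ^ 2)) * lap φ y -
      lam * (((‖y - x‖ ^ 2 : ℝ) : ℂ) ^ 0 *
        Complex.exp (-(((‖y - x‖ ^ 2 : ℝ) : ℂ) * (r : ℂ) ^ 2)) * φ y)) := by
        congr 1; ext y; ring
    _ = _ := by
      rw [integral_sub iL (i0.const_mul lam), integral_const_mul, integral_mul_lap hE hφ hc]
      congr 1
      have i0' := i0.const_mul (2 * d * (r : ℂ) ^ 2)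
      have i1' := i1.const_mul (4 * (r : ℂ) ^ 4)
      rw [gaussAvg, gaussAvg, ← integral_const_mul, ← integral_const_mul, ← integral_sub i1' i0']
      congr 1
      ext y
      rw [lap_radial_sub isOpen_univ h1 h2 (mem_univ _)]
      ring

/-- The scale-dependent quantity whose derivative is the mixture of Gaussian averages. -/
noncomputable def scaleAvg (lam : ℂ) (φ : EuclideanSpace ℝ (Fin d) → ℂ)
    (x : EuclideanSpace ℝ (Fin d)) (r : ℝ) : ℂ :=
  -4 * (r : ℂ) ^ d * Complex.exp (-lam / (4 * (r : ℂ) ^ 2)) * gaussAvg φ x 0 r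

theorem hasDerivAt_scaleAvg {φ : EuclideanSpace ℝ (Fin d) → ℂ} (hφ : ContDiff ℝ ∞ φ)
    (hc : HasCompactSupport φ) (lam : ℂ) (x : EuclideanSpace ℝ (Fin d)) {r : ℝ} (hr : 0 < r) :
    HasDerivAt (scaleAvg lam φ x) (mixDensity d lam 0 r *
      ∫ y, Complex.exp (-(((‖y - x‖ ^ 2 : ℝ) : ℂ) * (r : ℂ) ^ 2)) * (lap φ y - lam * φ y)) r := by
  have h := hasDerivAt_mix d lam 0 hr
  simp only [zero_mul, neg_zero, Complex.exp_zero, mul_one, mul_zero, zero_sub] at h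
  refine (h.fun_mul (hasDerivAt_gaussAvg hφ.continuous hc x r)).congr_deriv ?_
  rw [integral_gauss_mul_lap_sub hφ hc]
  have hr0 : (r : ℂ) ≠ 0 := by exact_mod_cast hr.ne'
  unfold mixDensity
  field_simp
  ring

theorem tendsto_gaussAvg {φ : EuclideanSpace ℝ (Fin d) → ℂ} (hφ : Continuous φ)
    (hc : HasCompactSupport φ) (x : EuclideanSpace ℝ (Fin d)) :
    Tendsto (fun r : ℝ => (r : ℂ) ^ d * gaussAvg φ x 0 r) atTop
      (𝓝 (((∫ v : EuclideanSpace ℝ (Fin d), Real.exp (-1 * ‖v‖ ^ 2) : ℝ) : ℂ) * φ x)) := by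
  set C : ℝ := ∫ v : EuclideanSpace ℝ (Fin d), Real.exp (-1 * ‖v‖ ^ 2) with hC
  have hC0 : 0 < C := by
    rw [hC, GaussianFourier.integral_rexp_neg_mul_sq_norm one_pos]
    positivity
  have key := tendsto_integral_comp_smul_smul_of_integrable' (μ := volume)
    (φ := fun v : EuclideanSpace ℝ (Fin d) => C⁻¹ * Real.exp (-1 * ‖v‖ ^ 2))
    (fun v => by positivity) (by
      rw [integral_const_mul, ← hC, inv_mul_cancel₀ hC0.ne']) (by
      have h := ((tendsto_pow_mul_exp_neg_mul_sq d one_pos).comp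
        (tendsto_norm_cobounded_atTop (E := EuclideanSpace ℝ (Fin d)))).const_mul C⁻¹
      rw [mul_zero] at h
      refine h.congr fun v => ?_
      simp only [finrank_euclideanSpace, Fintype.card_fin, Function.comp]
      ring) (hφ.integrable_of_hasCompactSupport hc) (x₀ := x) hφ.continuousAt
  have key2 := key.const_mul (C : ℂ)
  refine key2.congr fun r => ?_
  rw [gaussAvg, ← integral_const_mul, ← integral_const_mul]
  congr 1
  ext y
  have hC1 : (C : ℂ) ≠ 0 := by exact_mod_cast hC0.ne'
  rw [Complex.real_smul, finrank_euclideanSpace, Fintype.card_fin, norm_smul, norm_sub_rev,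
    mul_pow, Real.norm_eq_abs, sq_abs]
  push_cast
  field_simp

theorem tendsto_scaleAvg {φ : EuclideanSpace ℝ (Fin d) → ℂ} (hφ : Continuous φ)
    (hc : HasCompactSupport φ) (lam : ℂ) (x : EuclideanSpace ℝ (Fin d)) :
    Tendsto (scaleAvg lam φ x) atTop
      (𝓝 (-4 * (((∫ v : EuclideanSpace ℝ (Fin d), Real.exp (-1 * ‖v‖ ^ 2) : ℝ) : ℂ) * φ x))) := by
  have h1 : Tendsto (fun r : ℝ => Complex.exp (-lam / (4 * (r : ℂ) ^ 2))) atTop (𝓝 1) := by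
    have h2 : Tendsto (fun r : ℝ => ((r ^ 2)⁻¹ : ℝ)) atTop (𝓝 0) :=
      (tendsto_pow_atTop (by norm_num)).inv_tendsto_atTop
    have h3 := ((Complex.continuous_ofReal.tendsto 0).comp h2).const_mul (-lam / 4)
    rw [Complex.ofReal_zero, mul_zero] at h3
    have h4 := (Complex.continuous_exp.tendsto 0).comp h3
    rw [Complex.exp_zero] at h4
    refine h4.congr fun r => ?_
    simp only [Function.comp]
    push_cast
    congr 1
    rw [← div_eq_mul_inv, div_div]
  have := ((h1.mul (tendsto_gaussAvg hφ hc x)).const_mul (-4))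
  rw [one_mul] at this
  refine this.congr fun r => ?_
  rw [scaleAvg]
  ring

end Representation

section Fundamental

variable {d : ℕ}

/-- A fundamental solution (up to normalization) of `Δ - λ`. -/
noncomputable def fund (d : ℕ) (lam : ℂ) (z : EuclideanSpace ℝ (Fin d)) : ℂ :=
  fundProfile d lam ((‖z‖ ^ 2 : ℝ) : ℂ)

theorem integrable_mix_prod {h : EuclideanSpace ℝ (Fin d) → ℂ} (hh : Continuous h)
    (hc : HasCompactSupport h) (lam : ℂ) {x : EuclideanSpace ℝ (Fin d)} {δ : ℝ} (hδ : 0 < δ)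
    (h0 : ∀ y ∈ Metric.ball x δ, h y = 0) :
    Integrable (Function.uncurry fun (r : ℝ) (y : EuclideanSpace ℝ (Fin d)) =>
      mixDensity d lam 0 r * (Complex.exp (-(((‖y - x‖ ^ 2 : ℝ) : ℂ) * (r : ℂ) ^ 2)) * h y))
      ((volume.restrict (Ioi (1 : ℝ))).prod volume) := by
  have hint : Integrable (fun r : ℝ => 2 * Real.exp ‖lam‖ * r ^ (d + 2 * 0) *
      Real.exp (-(δ ^ 2) * r ^ 2)) (volume.restrict (Ioi 1)) :=
    integrableOn_pow_mul_exp (d + 2 * 0) (sq_pos_of_pos hδ) _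
  refine Integrable.mono' (hint.mul_prod (hh.integrable_of_hasCompactSupport hc).norm) ?_ ?_
  · have hm : AEStronglyMeasurable (mixDensity d lam 0) (volume.restrict (Ioi (1 : ℝ))) :=
      (continuousOn_mixDensity d lam 0).aestronglyMeasurable measurableSet_Ioi
    refine hm.comp_fst.mul (Continuous.aestronglyMeasurable ?_)
    fun_prop
  · have hmem : ∀ᵐ z ∂((volume.restrict (Ioi (1 : ℝ))).prod
        (volume : Measure (EuclideanSpace ℝ (Fin d)))), z.1 ∈ Ioi (1 : ℝ) := by
      have : (volume.restrict (Ioi (1 : ℝ))).prod (volume : Measure (EuclideanSpace ℝ (Fin d))) =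
          ((volume : Measure ℝ).prod volume).restrict (Ioi (1 : ℝ) ×ˢ univ) := by
        rw [← Measure.prod_restrict, Measure.restrict_univ]
      rw [this]
      filter_upwards [ae_restrict_mem (measurableSet_Ioi.prod MeasurableSet.univ)] with z hz
        using hz.1
    filter_upwards [hmem] with z hz
    simp only [Function.uncurry]
    by_cases hy : h z.2 = 0
    · simp [hy]
    have hdist : δ ≤ ‖z.2 - x‖ := by
      by_contra hlt
      exact hy (h0 _ (by rw [Metric.mem_ball, dist_eq_norm]; exact not_le.1 hlt))
    rw [← mul_assoc, norm_mul]
    refine mul_le_mul_of_nonneg_right (norm_mixIntegrand_le d lam 0 ?_ (le_of_lt hz)) (norm_nonneg _)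
    rw [Complex.ofReal_re]
    gcongr

theorem contDiff_expGen {b : ℕ → ℂ} {A B : ℝ} (hb : ∀ n, ‖b n‖ ≤ A * B ^ n) :
    ContDiff ℂ ∞ (expGen b) := by
  have : Differentiable ℂ (expGen b) := fun s => (hasDerivAt_expGen hb s).differentiableAt
  exact this.contDiff

theorem integral_fund_mul {φ : EuclideanSpace ℝ (Fin d) → ℂ} (hd : 1 ≤ d) (hφ : ContDiff ℝ ∞ φ)
    (hc : HasCompactSupport φ) (lam : ℂ) {x : EuclideanSpace ℝ (Fin d)} {δ : ℝ} (hδ : 0 < δ)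
    (h0 : ∀ y ∈ Metric.ball x δ, lap φ y = lam * φ y) :
    ∫ y, fund d lam (y - x) * (lap φ y - lam * φ y) =
      -4 * (((∫ v : EuclideanSpace ℝ (Fin d), Real.exp (-1 * ‖v‖ ^ 2) : ℝ) : ℂ) * φ x) := by
  set h : EuclideanSpace ℝ (Fin d) → ℂ := fun y => lap φ y - lam * φ y with hh
  have hhc : Continuous h := hφ.lap.continuous.sub (continuous_const.mul hφ.continuous)
  have hhs : HasCompactSupport h := hc.lap.sub hc.mul_left
  have hF := integrable_mix_prod (x := x) hhc hhs lam hδ fun y hy => by simp [hh, h0 y hy]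
  have hswap := integral_integral_swap hF
  have hleft : ∫ r in Ioi (1 : ℝ), ∫ y, mixDensity d lam 0 r *
      (Complex.exp (-(((‖y - x‖ ^ 2 : ℝ) : ℂ) * (r : ℂ) ^ 2)) * h y) =
      -4 * (((∫ v : EuclideanSpace ℝ (Fin d), Real.exp (-1 * ‖v‖ ^ 2) : ℝ) : ℂ) * φ x)
        - scaleAvg lam φ x 1 := by
    have hint := hF.integral_prod_left
    simp only [Function.uncurry, integral_const_mul] at hint
    simp only [integral_const_mul]
    exact integral_Ioi_of_hasDerivAt_of_tendsto'
      (fun r hr => hasDerivAt_scaleAvg hφ hc lam x (zero_lt_one.trans_le hr)) hint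
      (tendsto_scaleAvg hφ.continuous hc lam x)
  have hpt : ∀ y, ∫ r in Ioi (1 : ℝ), mixDensity d lam 0 r *
      (Complex.exp (-(((‖y - x‖ ^ 2 : ℝ) : ℂ) * (r : ℂ) ^ 2)) * h y) =
      mixProfile d lam 0 ((‖y - x‖ ^ 2 : ℝ) : ℂ) * h y := fun y => by
    simp only [← mul_assoc]
    rw [integral_mul_const]
    rfl
  have hmix := hF.integral_prod_right
  simp only [Function.uncurry, hpt] at hmix
  rw [hleft] at hswap
  simp only [hpt] at hswap
  set c := -4 * Complex.exp (-lam / 4) with hcdef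
  have hb := norm_corrCoeff_le hd lam c
  have hb1 := norm_shift_le hb
  have hS := contDiff_radial_sub (contDiff_expGen hb) x
  have i1 : Integrable fun y => expGen (corrCoeff d lam c) ((‖y - x‖ ^ 2 : ℝ) : ℂ) * lap φ y :=
    (hS.continuous.mul hφ.lap.continuous).integrable_of_hasCompactSupport hc.lap.mul_left
  have i2 : Integrable fun y => expGen (corrCoeff d lam c) ((‖y - x‖ ^ 2 : ℝ) : ℂ) * φ y :=
    (hS.continuous.mul hφ.continuous).integrable_of_hasCompactSupport hc.mul_left
  have i3 : Integrable fun y =>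
      lap (fun y => expGen (corrCoeff d lam c) ((‖y - x‖ ^ 2 : ℝ) : ℂ)) y * φ y :=
    (hS.lap.continuous.mul hφ.continuous).integrable_of_hasCompactSupport hc.mul_left
  have hcorr : ∫ y, expGen (corrCoeff d lam c) ((‖y - x‖ ^ 2 : ℝ) : ℂ) * h y =
      scaleAvg lam φ x 1 := by
    have e1 : (fun y => expGen (corrCoeff d lam c) ((‖y - x‖ ^ 2 : ℝ) : ℂ) * h y) = fun y =>
        expGen (corrCoeff d lam c) ((‖y - x‖ ^ 2 : ℝ) : ℂ) * lap φ y -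
          lam * (expGen (corrCoeff d lam c) ((‖y - x‖ ^ 2 : ℝ) : ℂ) * φ y) := by
      ext y; simp only [hh]; ring
    rw [e1, integral_sub i1 (i2.const_mul lam), integral_const_mul, integral_mul_lap hS hφ hc,
      ← integral_const_mul, ← integral_sub i3 (i2.const_mul lam), scaleAvg, gaussAvg,
      ← integral_const_mul]
    congr 1
    ext y
    rw [lap_radial_sub isOpen_univ (fun s _ => hasDerivAt_expGen hb s)
      (fun s _ => hasDerivAt_expGen hb1 s) (mem_univ _)]
    have ode := corrCoeff_ode hd lam c ((‖y - x‖ ^ 2 : ℝ) : ℂ)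
    simp only [Complex.ofReal_one, one_pow, mul_one, pow_zero, one_mul]
    rw [← hcdef]
    linear_combination (φ y) * ode
  have i4 : Integrable fun y => expGen (corrCoeff d lam c) ((‖y - x‖ ^ 2 : ℝ) : ℂ) * h y :=
    (hS.continuous.mul hhc).integrable_of_hasCompactSupport hhs.mul_left
  calc _ = ∫ y, (mixProfile d lam 0 ((‖y - x‖ ^ 2 : ℝ) : ℂ) * h y +
        expGen (corrCoeff d lam c) ((‖y - x‖ ^ 2 : ℝ) : ℂ) * h y) := by
        congr 1; ext y; simp only [fund, fundProfile, hh]; ring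
    _ = _ := by
      rw [integral_add hmix i4, ← hswap, hcorr]
      ring

/-- The normalizing constant of `fund`. -/
noncomputable def fundConst (d : ℕ) : ℂ :=
  (-4 * ((∫ v : EuclideanSpace ℝ (Fin d), Real.exp (-1 * ‖v‖ ^ 2) : ℝ) : ℂ))⁻¹

theorem eq_integral_fund {φ : EuclideanSpace ℝ (Fin d) → ℂ} (hd : 1 ≤ d) (hφ : ContDiff ℝ ∞ φ)
    (hc : HasCompactSupport φ) (lam : ℂ) {x : EuclideanSpace ℝ (Fin d)} {δ : ℝ} (hδ : 0 < δ)
    (h0 : ∀ y ∈ Metric.ball x δ, lap φ y = lam * φ y) :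
    φ x = fundConst d * ∫ y, fund d lam (y - x) * (lap φ y - lam * φ y) := by
  have hC : ((∫ v : EuclideanSpace ℝ (Fin d), Real.exp (-1 * ‖v‖ ^ 2) : ℝ) : ℂ) ≠ 0 := by
    rw [GaussianFourier.integral_rexp_neg_mul_sq_norm one_pos]
    exact_mod_cast (by positivity : (0 : ℝ) <
      (Real.pi / 1) ^ (Module.finrank ℝ (EuclideanSpace ℝ (Fin d)) / 2 : ℝ)).ne'
  rw [integral_fund_mul hd hφ hc lam hδ h0, fundConst, ← mul_assoc (-4 : ℂ),
    inv_mul_cancel_left₀ (mul_ne_zero (by norm_num) hC)]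

theorem re_normSq_pos {z : EuclideanSpace ℝ (Fin d)} (hz : z ≠ 0) :
    0 < (((‖z‖ ^ 2 : ℝ) : ℂ)).re := by
  rw [Complex.ofReal_re]
  have := norm_pos_iff.2 hz
  positivity

theorem contDiffAt_fund (hd : 1 ≤ d) (lam : ℂ) {z : EuclideanSpace ℝ (Fin d)} (hz : z ≠ 0) :
    ContDiffAt ℝ ∞ (fund d lam) z := by
  obtain ⟨g1, g2, h1, -, -⟩ := exists_fundProfile_ode hd lam
  have hΩ : IsOpen {s : ℂ | 0 < s.re} := isOpen_lt continuous_const Complex.continuous_re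
  have : DifferentiableOn ℂ (fundProfile d lam) {s : ℂ | 0 < s.re} := fun s hs =>
    (h1 s hs).differentiableAt.differentiableWithinAt
  have h2 : ContDiffAt ℂ ∞ (fundProfile d lam) ((‖z‖ ^ 2 : ℝ) : ℂ) :=
    (this.contDiffOn hΩ).contDiffAt (hΩ.mem_nhds (re_normSq_pos hz))
  exact (h2.restrict_scalars ℝ).comp z
    (Complex.ofRealCLM.contDiff.comp (contDiff_norm_sq ℝ)).contDiffAt

theorem lap_fund (hd : 1 ≤ d) (lam : ℂ) {z : EuclideanSpace ℝ (Fin d)} (hz : z ≠ 0) :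
    lap (fund d lam) z = lam * fund d lam z := by
  obtain ⟨g1, g2, h1, h2, h3⟩ := exists_fundProfile_ode hd lam
  have hΩ : IsOpen {s : ℂ | 0 < s.re} := isOpen_lt continuous_const Complex.continuous_re
  have := lap_radial hΩ h1 h2 (re_normSq_pos hz)
  rw [h3 _ (re_normSq_pos hz)] at this
  exact this

end Fundamental

section Weyl

variable {d : ℕ}

theorem exists_smooth_cutoff {K U : Set (EuclideanSpace ℝ (Fin d))} (hK : IsCompact K)
    (hU : IsOpen U) (hKU : K ⊆ U) :
    ∃ χ : EuclideanSpace ℝ (Fin d) → ℂ, ContDiff ℝ ∞ χ ∧ HasCompactSupport χ ∧ tsupport χ ⊆ U ∧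
      (∀ᶠ x in 𝓝ˢ K, χ x = 1) ∧ ∀ x, ‖χ x‖ ≤ 1 := by
  obtain ⟨K', hK', hKK', hK'U⟩ := exists_compact_between hK hU hKU
  obtain ⟨f, hf1, hf0, hf⟩ := exists_contMDiffMap_one_nhds_of_subset_interior
    𝓘(ℝ, EuclideanSpace ℝ (Fin d)) (n := ⊤) hK.isClosed hKK'
  have hsub : tsupport (fun x => ((f x : ℝ) : ℂ)) ⊆ K' := by
    refine closure_minimal (fun x hx => ?_) hK'.isClosed
    by_contra hx'
    exact hx (by simp [hf0 x hx'])
  refine ⟨fun x => ((f x : ℝ) : ℂ), Complex.ofRealCLM.contDiff.comp f.contMDiff.contDiff,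
    hK'.of_isClosed_subset (isClosed_tsupport _) hsub, hsub.trans hK'U, ?_, fun x => ?_⟩
  · filter_upwards [hf1] with x hx
    simp [hx]
  · rw [Complex.norm_real, Real.norm_of_nonneg (hf x).1]
    exact (hf x).2

theorem ContDiffOn.cutoff_mul {U : Set (EuclideanSpace ℝ (Fin d))} (hU : IsOpen U)
    {χ u : EuclideanSpace ℝ (Fin d) → ℂ} (hχ : ContDiff ℝ ∞ χ) (hs : tsupport χ ⊆ U)
    (hu : ContDiffOn ℝ ∞ u U) : ContDiff ℝ ∞ fun x => χ x * u x := by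
  refine contDiff_iff_contDiffAt.2 fun x => ?_
  by_cases hx : x ∈ tsupport χ
  · exact hχ.contDiffAt.mul (hu.contDiffAt (hU.mem_nhds (hs hx)))
  · have : (fun x => χ x * u x) =ᶠ[𝓝 x] fun _ => 0 := by
      filter_upwards [notMem_tsupport_iff_eventuallyEq.1 hx] with y hy
      simp [hy]
    exact contDiffAt_const.congr_of_eventuallyEq this

/-- Being a smooth solution of `Δg = λg` on `X`. -/
def IsSol (lam : ℂ) (X : Set (EuclideanSpace ℝ (Fin d))) (g : EuclideanSpace ℝ (Fin d) → ℂ) :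
    Prop :=
  ContDiffOn ℝ ∞ g X ∧ ∀ x ∈ X, lap g x = lam * g x

theorem IsSol.mono {lam : ℂ} {X Y : Set (EuclideanSpace ℝ (Fin d))}
    {g : EuclideanSpace ℝ (Fin d) → ℂ} (h : IsSol lam X g) (hY : Y ⊆ X) : IsSol lam Y g :=
  ⟨h.1.mono hY, fun x hx => h.2 x (hY hx)⟩

theorem IsSol.congr {lam : ℂ} {X : Set (EuclideanSpace ℝ (Fin d))} (hX : IsOpen X)
    {f g : EuclideanSpace ℝ (Fin d) → ℂ} (h : IsSol lam X g) (hfg : EqOn f g X) :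
    IsSol lam X f :=
  ⟨h.1.congr hfg, fun x hx => by
    rw [lap_congr (hfg.eventuallyEq_of_mem (hX.mem_nhds hx)), h.2 x hx, hfg hx]⟩

theorem IsSol.add {lam : ℂ} {X : Set (EuclideanSpace ℝ (Fin d))} (hX : IsOpen X)
    {f g : EuclideanSpace ℝ (Fin d) → ℂ} (hf : IsSol lam X f) (hg : IsSol lam X g) :
    IsSol lam X fun x => f x + g x :=
  ⟨hf.1.add hg.1, fun x hx => by
    rw [lap_add (ContDiffAt.eventually_contDiffAt hX hx hf.1) (ContDiffAt.eventually_contDiffAt hX hx hg.1),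
      hf.2 x hx, hg.2 x hx, mul_add]⟩

theorem IsSol.const_mul {lam : ℂ} {X : Set (EuclideanSpace ℝ (Fin d))} (hX : IsOpen X)
    {f : EuclideanSpace ℝ (Fin d) → ℂ} (hf : IsSol lam X f) (c : ℂ) :
    IsSol lam X fun x => c * f x :=
  ⟨contDiffOn_const.mul hf.1, fun x hx => by
    rw [lap_const_mul c (ContDiffAt.eventually_contDiffAt hX hx hf.1), hf.2 x hx]
    ring⟩

/-- Smooth compactly supported functions solving the equation near a closed ball are reproduced
there by a compactly supported kernel. -/
theorem exists_reproducing_kernel (hd : 1 ≤ d) (lam : ℂ) {ρ : ℝ} (hρ : 0 < ρ) :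
    ∃ κ : EuclideanSpace ℝ (Fin d) → ℂ, ContDiff ℝ ∞ κ ∧ HasCompactSupport κ ∧
      ∀ (x : EuclideanSpace ℝ (Fin d)) (φ : EuclideanSpace ℝ (Fin d) → ℂ), ContDiff ℝ ∞ φ →
        HasCompactSupport φ → (∀ y ∈ Metric.ball x ρ, lap φ y = lam * φ y) →
        φ x = (φ ⋆[ContinuousLinearMap.mul ℝ ℂ, volume] κ) x := by
  obtain ⟨η, hη, hηc, hηs, hη1, -⟩ := exists_smooth_cutoff
    (K := {(0 : EuclideanSpace ℝ (Fin d))}) isCompact_singleton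
    (Metric.isOpen_ball (x := (0 : EuclideanSpace ℝ (Fin d))) (ε := ρ)) (by simpa using hρ)
  rw [nhdsSet_singleton] at hη1
  set G : EuclideanSpace ℝ (Fin d) → ℂ := fun z => (1 - η z) * fund d lam z with hG
  have hGs : ContDiff ℝ ∞ G := contDiff_iff_contDiffAt.2 fun z => by
    by_cases hz : z = 0
    · subst hz
      have : G =ᶠ[𝓝 0] fun _ => 0 := by
        filter_upwards [hη1] with y hy
        simp [hG, hy]
      exact contDiffAt_const.congr_of_eventuallyEq this
    · exact (contDiffAt_const.sub hη.contDiffAt).mul (contDiffAt_fund hd lam hz)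
  have hGe : ∀ z ∉ tsupport η, G =ᶠ[𝓝 z] fund d lam := fun z hz => by
    filter_upwards [notMem_tsupport_iff_eventuallyEq.1 hz] with y hy
    simp [hG, hy]
  set κ : EuclideanSpace ℝ (Fin d) → ℂ :=
    fun z => fundConst d * (lap G (-z) - lam * G (-z)) with hκ
  have hκ0 : ∀ z ∉ tsupport η, lap G z - lam * G z = 0 := fun z hz => by
    have hz0 : z ≠ 0 := by
      rintro rfl
      exact hz (subset_tsupport _ (by simp [hη1.self_of_nhds]))
    rw [lap_congr (hGe z hz), (hGe z hz).eq_of_nhds, lap_fund hd lam hz0, sub_self]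
  refine ⟨κ, contDiff_const.mul (((hGs.lap).comp contDiff_neg).sub
    (contDiff_const.mul (hGs.comp contDiff_neg))), ?_, fun x φ hφ hc h0 => ?_⟩
  · have hcomp : HasCompactSupport fun z => lap G z - lam * G z :=
      hηc.mono' fun z hz => by
        by_contra hz'
        exact hz (hκ0 z hz')
    exact (hcomp.comp_homeomorph (Homeomorph.neg _)).mul_left
  · have e1 : ∀ y, fund d lam (y - x) * (lap φ y - lam * φ y) =
        G (y - x) * lap φ y - lam * (G (y - x) * φ y) := fun y => by
      by_cases hy : y ∈ Metric.ball x ρ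
      · rw [h0 y hy]; ring
      · have : η (y - x) = 0 := image_eq_zero_of_notMem_tsupport fun hmem => hy (by
          simpa [dist_eq_norm] using hηs hmem)
        simp only [hG, this]
        ring
    have hGx : ContDiff ℝ ∞ fun y => G (y - x) := hGs.comp (contDiff_id.sub contDiff_const)
    have i1 : Integrable fun y => G (y - x) * lap φ y :=
      (hGx.continuous.mul hφ.lap.continuous).integrable_of_hasCompactSupport hc.lap.mul_left
    have i2 : Integrable fun y => G (y - x) * φ y :=
      (hGx.continuous.mul hφ.continuous).integrable_of_hasCompactSupport hc.mul_left
    have i3 : Integrable fun y => lap (fun y => G (y - x)) y * φ y :=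
      (hGx.lap.continuous.mul hφ.continuous).integrable_of_hasCompactSupport hc.mul_left
    rw [eq_integral_fund hd hφ hc lam hρ h0]
    simp only [e1]
    rw [integral_sub i1 (i2.const_mul lam), integral_const_mul, integral_mul_lap hGx hφ hc,
      ← integral_const_mul, ← integral_sub i3 (i2.const_mul lam), ← integral_const_mul,
      convolution_def]
    congr 1
    ext y
    rw [lap_comp_sub, ContinuousLinearMap.mul_apply', hκ]
    simp only [neg_sub]
    ring

theorem pd_convolution {φ κ : EuclideanSpace ℝ (Fin d) → ℂ} (hφ : Continuous φ)
    (hκ : ContDiff ℝ ∞ κ) (hc : HasCompactSupport κ) (j : Fin d) :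
    pd j (φ ⋆[ContinuousLinearMap.mul ℝ ℂ, volume] κ) =
      φ ⋆[ContinuousLinearMap.mul ℝ ℂ, volume] (pd j κ) := by
  ext x
  rw [pd, (hc.hasFDerivAt_convolution_right (ContinuousLinearMap.mul ℝ ℂ) hφ.locallyIntegrable
    (hκ.of_le (by exact_mod_cast le_top)) x).fderiv, convolution_precompR_apply]
  · rfl
  · exact hφ.locallyIntegrable
  · exact hc.fderiv (𝕜 := ℝ)
  · exact hκ.continuous_fderiv (by simp)

theorem tendsto_convolution {ι : Type*} {l : Filter ι} {F : ι → EuclideanSpace ℝ (Fin d) → ℂ}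
    {φ κ : EuclideanSpace ℝ (Fin d) → ℂ} (hF : ∀ i, Continuous (F i)) (hφ : Continuous φ)
    (hκ : Continuous κ) (hc : HasCompactSupport κ) (h : TendstoUniformly F φ l)
    (x : EuclideanSpace ℝ (Fin d)) :
    Tendsto (fun i => (F i ⋆[ContinuousLinearMap.mul ℝ ℂ, volume] κ) x) l
      (𝓝 ((φ ⋆[ContinuousLinearMap.mul ℝ ℂ, volume] κ) x)) := by
  have hx : HasCompactSupport fun t => κ (x - t) :=
    hc.comp_homeomorph (Homeomorph.subLeft x)
  have hint : ∀ f : EuclideanSpace ℝ (Fin d) → ℂ, Continuous f →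
      Integrable fun t => f t * κ (x - t) := fun f hf =>
    (hf.mul (by fun_prop)).integrable_of_hasCompactSupport hx.mul_left
  have hκi : Integrable fun t => κ (x - t) :=
    Continuous.integrable_of_hasCompactSupport (by fun_prop) hx
  set M : ℝ := ∫ t, ‖κ (x - t)‖ with hM
  have hM0 : 0 ≤ M := integral_nonneg fun t => norm_nonneg _
  rw [Metric.tendsto_nhds]
  intro ε hε
  rw [Metric.tendstoUniformly_iff] at h
  filter_upwards [h (ε / (M + 1)) (by positivity)] with i hi
  rw [dist_eq_norm, convolution_def, convolution_def]
  simp only [ContinuousLinearMap.mul_apply']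
  rw [← integral_sub (hint _ (hF i)) (hint _ hφ)]
  calc ‖∫ t, (F i t * κ (x - t) - φ t * κ (x - t))‖ ≤ ∫ t, ε / (M + 1) * ‖κ (x - t)‖ := by
        refine norm_integral_le_of_norm_le (hκi.norm.const_mul _) (Eventually.of_forall fun t => ?_)
        rw [← sub_mul, norm_mul, ← dist_eq_norm, dist_comm]
        gcongr
        exact (hi t).le
    _ = ε * (M / (M + 1)) := by rw [integral_const_mul, ← hM]; ring
    _ < ε := by
        refine mul_lt_of_lt_one_right hε ?_
        rw [div_lt_one (by linarith)]
        linarith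

/-- Locally uniform limits of solutions are solutions, and their first derivatives converge. -/
theorem IsSol.of_tendsto (hd : 1 ≤ d) {lam : ℂ} {X : Set (EuclideanSpace ℝ (Fin d))}
    (hX : IsOpen X) {ι : Type*} {l : Filter ι} [l.NeBot] {F : ι → EuclideanSpace ℝ (Fin d) → ℂ}
    {f : EuclideanSpace ℝ (Fin d) → ℂ} (hF : ∀ i, IsSol lam X (F i))
    (h : ∀ K ⊆ X, IsCompact K → TendstoUniformlyOn F f l K) :
    IsSol lam X f ∧ ∀ x ∈ X, ∀ j, Tendsto (fun i => pd j (F i) x) l (𝓝 (pd j f x)) := by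
  have main : ∀ x ∈ X, ContDiffAt ℝ ∞ f x ∧ lap f x = lam * f x ∧
      ∀ j, Tendsto (fun i => pd j (F i) x) l (𝓝 (pd j f x)) := by
    intro x hx
    obtain ⟨ρ, hρ, hball⟩ := Metric.isOpen_iff.1 hX x hx
    obtain ⟨χ, hχ, hχc, hχs, hχ1, hχb⟩ := exists_smooth_cutoff
      (isCompact_closedBall x (ρ / 2)) hX
      ((Metric.closedBall_subset_ball (by linarith)).trans hball)
    have hone : ∀ y ∈ Metric.closedBall x (ρ / 2), χ =ᶠ[𝓝 y] fun _ => 1 := fun y hy =>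
      eventually_nhdsSet_iff_forall.1 hχ1 y hy
    obtain ⟨κ, hκ, hκc, hrep⟩ := exists_reproducing_kernel hd lam (by linarith : 0 < ρ / 4)
    set Φ : ι → EuclideanSpace ℝ (Fin d) → ℂ := fun i y => χ y * F i y with hΦ
    set φ : EuclideanSpace ℝ (Fin d) → ℂ := fun y => χ y * f y with hφ
    have hΦs : ∀ i, ContDiff ℝ ∞ (Φ i) := fun i => (hF i).1.cutoff_mul hX hχ hχs
    have hΦc : ∀ i, HasCompactSupport (Φ i) := fun i => hχc.mul_right
    have hunif : TendstoUniformly Φ φ l := by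
      rw [Metric.tendstoUniformly_iff]
      intro ε hε
      filter_upwards [Metric.tendstoUniformlyOn_iff.1 (h _ hχs hχc) ε hε] with i hi y
      by_cases hy : y ∈ tsupport χ
      · simp only [hφ, hΦ]
        rw [dist_eq_norm, ← mul_sub, norm_mul]
        refine lt_of_le_of_lt (mul_le_of_le_one_left (norm_nonneg _) (hχb y)) ?_
        rw [← dist_eq_norm]
        exact hi y hy
      · simp [hφ, hΦ, image_eq_zero_of_notMem_tsupport hy, hε]
    have hφcont : Continuous φ :=
      hunif.continuous (Eventually.of_forall fun i => (hΦs i).continuous).frequently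
    have hmem : ∀ y ∈ Metric.ball x (ρ / 4), ∀ z ∈ Metric.ball y (ρ / 4),
        z ∈ Metric.closedBall x (ρ / 2) := fun y hy z hz => by
      rw [Metric.mem_closedBall]
      rw [Metric.mem_ball] at hy hz
      linarith [dist_triangle z y x]
    have hΦeq : ∀ i, ∀ z ∈ Metric.closedBall x (ρ / 2), Φ i =ᶠ[𝓝 z] F i := fun i z hz => by
      filter_upwards [hone z hz] with y hy
      simp [hΦ, hy]
    have hsubX : Metric.closedBall x (ρ / 2) ⊆ X :=
      (Metric.closedBall_subset_ball (by linarith)).trans hball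
    have hΦrep : ∀ i, ∀ y ∈ Metric.ball x (ρ / 4),
        Φ i y = (Φ i ⋆[ContinuousLinearMap.mul ℝ ℂ, volume] κ) y := fun i y hy =>
      hrep y _ (hΦs i) (hΦc i) fun z hz => by
        have hz' := hmem y hy z hz
        rw [lap_congr (hΦeq i z hz'), (hΦeq i z hz').eq_of_nhds, (hF i).2 z (hsubX hz')]
    have hφrep : ∀ y ∈ Metric.ball x (ρ / 4),
        φ y = (φ ⋆[ContinuousLinearMap.mul ℝ ℂ, volume] κ) y := fun y hy => by
      have h1 := tendsto_convolution (fun i => (hΦs i).continuous) hφcont hκ.continuous hκc hunif y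
      refine tendsto_nhds_unique (hunif.tendsto_at y) (h1.congr fun i => (hΦrep i y hy).symm)
    have hxb : Metric.ball x (ρ / 4) ∈ 𝓝 x := Metric.ball_mem_nhds x (by linarith)
    have hxc : x ∈ Metric.closedBall x (ρ / 2) := Metric.mem_closedBall_self (by linarith)
    have hfφ : f =ᶠ[𝓝 x] φ ⋆[ContinuousLinearMap.mul ℝ ℂ, volume] κ := by
      filter_upwards [hxb, hone x hxc] with y hy hy1
      rw [← hφrep y hy]
      simp [hφ, hy1]
    have hFΦ : ∀ i, F i =ᶠ[𝓝 x] Φ i ⋆[ContinuousLinearMap.mul ℝ ℂ, volume] κ := fun i => by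
      filter_upwards [hxb, hΦeq i x hxc] with y hy hy1
      rw [← hΦrep i y hy, hy1]
    have hconv : ∀ (ψ : EuclideanSpace ℝ (Fin d) → ℂ), Continuous ψ → HasCompactSupport ψ →
        Tendsto (fun i => (Φ i ⋆[ContinuousLinearMap.mul ℝ ℂ, volume] ψ) x) l
        (𝓝 ((φ ⋆[ContinuousLinearMap.mul ℝ ℂ, volume] ψ) x)) := fun ψ hψ hψc =>
      tendsto_convolution (fun i => (hΦs i).continuous) hφcont hψ hψc hunif x
    have hlap : ∀ ψ : EuclideanSpace ℝ (Fin d) → ℂ, Continuous ψ →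
        lap (ψ ⋆[ContinuousLinearMap.mul ℝ ℂ, volume] κ) x =
          ∑ j, (ψ ⋆[ContinuousLinearMap.mul ℝ ℂ, volume] (pd j (pd j κ))) x := fun ψ hψ => by
      simp only [lap]
      refine Finset.sum_congr rfl fun j _ => ?_
      rw [pd_convolution hψ hκ hκc, pd_convolution hψ (hκ.pd j) (hκc.pd j)]
    refine ⟨?_, ?_, fun j => ?_⟩
    · exact ((hκc.contDiff_convolution_right (ContinuousLinearMap.mul ℝ ℂ)
        hφcont.locallyIntegrable hκ).contDiffAt).congr_of_eventuallyEq hfφ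
    · have t1 : Tendsto (fun i => lap (F i) x) l (𝓝 (lap f x)) := by
        rw [lap_congr hfφ, hlap φ hφcont]
        refine Tendsto.congr (fun i => ?_) (tendsto_finsetSum Finset.univ fun j _ =>
          hconv _ ((hκ.pd j).pd j).continuous ((hκc.pd j).pd j))
        rw [lap_congr (hFΦ i), hlap _ (hΦs i).continuous]
      have t2 : Tendsto (fun i => lap (F i) x) l (𝓝 (lam * f x)) := by
        have := ((h {x} (by simpa using hx) isCompact_singleton).tendsto_at rfl).const_mul lam
        exact this.congr fun i => ((hF i).2 x hx).symm
      exact tendsto_nhds_unique t1 t2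
    · rw [(pd_congr j hfφ).eq_of_nhds, pd_convolution hφcont hκ hκc]
      refine (hconv _ (hκ.pd j).continuous (hκc.pd j)).congr fun i => ?_
      rw [(pd_congr j (hFΦ i)).eq_of_nhds, pd_convolution (hΦs i).continuous hκ hκc]
  exact ⟨⟨fun x hx => (main x hx).1.contDiffWithinAt, fun x hx => (main x hx).2.1⟩,
    fun x hx => (main x hx).2.2⟩

end Weyl

section Families

open scoped Classical in
/-- A function on a space as a continuous map, with value `0` if it is not continuous. -/
noncomputable def mkC {L : Type*} [TopologicalSpace L] (f : L → ℂ) : C(L, ℂ) :=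
  if h : Continuous f then ⟨f, h⟩ else 0

theorem mkC_apply {L : Type*} [TopologicalSpace L] {f : L → ℂ} (h : Continuous f) (x : L) :
    mkC f x = f x := by
  simp [mkC, h]

theorem continuousOn_mkC {L : Type*} [TopologicalSpace L] {Y : Type*} [TopologicalSpace Y]
    {A : Set Y} {f : Y → L → ℂ} (hf : ContinuousOn (Function.uncurry f) (A ×ˢ univ)) :
    ContinuousOn (fun s => mkC (f s)) A := by
  have hc : Continuous fun p : A × L => f p.1 p.2 :=
    hf.comp_continuous (f := fun p : A × L => ((p.1 : Y), p.2)) (by fun_prop)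
      (fun p => ⟨p.1.2, mem_univ _⟩)
  rw [continuousOn_iff_continuous_domRestrict]
  convert (ContinuousMap.curry ⟨_, hc⟩).continuous using 1
  funext s
  ext x
  have hs : Continuous (f s) := hc.comp (f := fun x : L => (s, x)) (by fun_prop)
  simp [mkC_apply hs]

theorem continuous_of_uncurry {L : Type*} [TopologicalSpace L] {Y : Type*} [TopologicalSpace Y]
    {A : Set Y} {f : Y → L → ℂ} (hf : ContinuousOn (Function.uncurry f) (A ×ˢ univ)) {s : Y}
    (hs : s ∈ A) : Continuous (f s) :=
  hf.comp_continuous (f := fun x : L => (s, x)) (by fun_prop) (fun _ => ⟨hs, mem_univ _⟩)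

theorem hasDerivAt_mkC {L : Type*} [TopologicalSpace L] [CompactSpace L] {A : Set ℂ}
    (hA : IsOpen A) {G G' : ℂ → L → ℂ} (hG : ContinuousOn (Function.uncurry G) (A ×ˢ univ))
    (hG' : ContinuousOn (Function.uncurry G') (A ×ˢ univ))
    (hd : ∀ t ∈ A, ∀ x, HasDerivAt (fun s => G s x) (G' t x) t) {t : ℂ} (ht : t ∈ A) :
    HasDerivAt (fun s => mkC (G s)) (mkC (G' t)) t := by
  have hc := (continuousOn_mkC hG').continuousAt (hA.mem_nhds ht)
  rw [hasDerivAt_iff_isLittleO, Asymptotics.isLittleO_iff]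
  intro ε hε
  obtain ⟨δ, hδ, hball⟩ := Metric.isOpen_iff.1 hA t ht
  obtain ⟨η, hη, hη'⟩ := Metric.continuousAt_iff.1 hc ε hε
  filter_upwards [Metric.ball_mem_nhds t (lt_min hδ hη)] with s hs
  refine (ContinuousMap.norm_le _ (by positivity)).2 fun x => ?_
  have hsub : ∀ r ∈ Metric.ball t (min δ η), r ∈ A := fun r hr =>
    hball (Metric.ball_subset_ball (min_le_left _ _) hr)
  have key := Convex.norm_image_sub_le_of_norm_hasDerivWithin_le (𝕜 := ℂ)
    (f := fun r => G r x - r * G' t x) (f' := fun r => G' r x - G' t x) (C := ε)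
    (s := Metric.ball t (min δ η)) (x := t) (y := s)
    (fun r hr => ((hd r (hsub r hr) x).fun_sub
      (by simpa using (hasDerivAt_id r).mul_const (G' t x))).hasDerivWithinAt) ?_
    (convex_ball _ _) (Metric.mem_ball_self (lt_min hδ hη)) hs
  · have h1 := mkC_apply (continuous_of_uncurry hG (hsub s hs)) x
    have h2 := mkC_apply (continuous_of_uncurry hG ht) x
    have h3 := mkC_apply (continuous_of_uncurry hG' ht) x
    simp only [ContinuousMap.sub_apply, ContinuousMap.smul_apply, h1, h2, h3, smul_eq_mul]
    refine le_trans (le_of_eq ?_) key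
    congr 1
    ring
  · intro r hr
    have h := (hη' (Metric.ball_subset_ball (min_le_right _ _) hr)).le
    have h1 := mkC_apply (continuous_of_uncurry hG' (hsub r hr)) x
    have h3 := mkC_apply (continuous_of_uncurry hG' ht) x
    rw [← h1, ← h3, ← dist_eq_norm]
    exact (ContinuousMap.dist_apply_le_dist x).trans h

end Families

section Propagation

variable {d : ℕ} {L : Set (EuclideanSpace ℝ (Fin d))}

/-- The fundamental solution with pole at `y`, as a continuous function on `L`. -/
noncomputable def poleC (lam : ℂ) (L : Set (EuclideanSpace ℝ (Fin d)))
    (y : EuclideanSpace ℝ (Fin d)) : C(L, ℂ) :=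
  mkC fun x => fund d lam (y - x)

theorem continuousOn_uncurry_fund (hd : 1 ≤ d) (lam : ℂ) :
    ContinuousOn (Function.uncurry fun (y : EuclideanSpace ℝ (Fin d)) (x : L) => fund d lam (y - x))
      (Lᶜ ×ˢ univ) := by
  rintro ⟨y, x⟩ ⟨hy, -⟩
  have hne : y - (x : EuclideanSpace ℝ (Fin d)) ≠ 0 := by
    rw [sub_ne_zero]
    rintro rfl
    exact hy x.2
  exact ((contDiffAt_fund hd lam hne).continuousAt.comp
    (f := fun p : EuclideanSpace ℝ (Fin d) × L => p.1 - (p.2 : EuclideanSpace ℝ (Fin d)))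
    (x := (y, x)) (by fun_prop)).continuousWithinAt

theorem poleC_segment_eq_zero [CompactSpace L] (hd : 1 ≤ d) (lam : ℂ) (ℓ : C(L, ℂ) →L[ℂ] ℂ)
    {p v : EuclideanSpace ℝ (Fin d)} {ε : ℝ} (hp : ∀ x ∈ L, 5 * ε ≤ ‖p - x‖)
    (hv : ‖v‖ < ε) (h0 : ∀ᶠ y in 𝓝 p, ℓ (poleC lam L y) = 0) : ℓ (poleC lam L (p + v)) = 0 := by
  have hε : 0 < ε := (norm_nonneg v).trans_lt hv
  obtain ⟨g1, g2, h1, h2, -⟩ := exists_fundProfile_ode hd lam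
  set a : ℂ → L → ℂ := fun t x => ((‖p - x‖ ^ 2 : ℝ) : ℂ) + 2 * t * ((inner ℝ (p - x) v : ℝ) : ℂ)
    + t ^ 2 * ((‖v‖ ^ 2 : ℝ) : ℂ) with ha
  have hare : ∀ t ∈ Metric.ball (0 : ℂ) 2, ∀ x, 0 < (a t x).re := by
    intro t ht x
    rw [mem_ball_zero_iff] at ht
    have hD := hp x x.2
    have hi := abs_real_inner_le_norm (p - (x : EuclideanSpace ℝ (Fin d))) v
    set D := ‖p - (x : EuclideanSpace ℝ (Fin d))‖
    have e1 : ‖2 * t * ((inner ℝ (p - (x : EuclideanSpace ℝ (Fin d))) v : ℝ) : ℂ)‖ ≤ 4 * (D * ε) := by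
      rw [norm_mul, norm_mul, Complex.norm_real, Complex.norm_ofNat, Real.norm_eq_abs]
      have : D * ‖v‖ ≤ D * ε := by gcongr
      calc 2 * ‖t‖ * |inner ℝ (p - (x : EuclideanSpace ℝ (Fin d))) v| ≤ 2 * 2 * (D * ε) := by
            gcongr
            linarith
        _ = _ := by ring
    have e2 : ‖t ^ 2 * ((‖v‖ ^ 2 : ℝ) : ℂ)‖ ≤ 4 * ε ^ 2 := by
      rw [norm_mul, norm_pow, Complex.norm_real, Real.norm_of_nonneg (by positivity)]
      calc ‖t‖ ^ 2 * ‖v‖ ^ 2 ≤ 2 ^ 2 * ε ^ 2 := by gcongr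
        _ = _ := by ring
    have r1 := (abs_le.1 ((Complex.abs_re_le_norm _).trans e1)).1
    have r2 := (abs_le.1 ((Complex.abs_re_le_norm _).trans e2)).1
    have : (a t x).re = D ^ 2 + (2 * t * ((inner ℝ (p - (x : EuclideanSpace ℝ (Fin d))) v : ℝ) : ℂ)).re
        + (t ^ 2 * ((‖v‖ ^ 2 : ℝ) : ℂ)).re := by
      simp only [ha, Complex.add_re, Complex.ofReal_re, D]
    rw [this]
    nlinarith
  have hac : Continuous (Function.uncurry a) := by
    simp only [ha, Function.uncurry_def]
    fun_prop
  have had : ∀ t x, HasDerivAt (fun s => a s x)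
      (2 * ((inner ℝ (p - x) v : ℝ) : ℂ) + 2 * t * ((‖v‖ ^ 2 : ℝ) : ℂ)) t := by
    intro t x
    have e1 := ((hasDerivAt_id t).const_mul 2).mul_const
      ((inner ℝ (p - (x : EuclideanSpace ℝ (Fin d))) v : ℝ) : ℂ)
    have e2 := ((hasDerivAt_id t).fun_pow 2).mul_const ((‖v‖ ^ 2 : ℝ) : ℂ)
    have := (e1.const_add (((‖p - x‖ ^ 2 : ℝ) : ℂ))).fun_add e2
    simpa [ha] using this
  have hcomp : ∀ g : ℂ → ℂ, (∀ s : ℂ, 0 < s.re → ContinuousAt g s) →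
      ContinuousOn (Function.uncurry fun t x => g (a t x)) (Metric.ball 0 2 ×ˢ univ) := by
    rintro g hg ⟨t, x⟩ ⟨ht, -⟩
    exact ((hg _ (hare t ht x)).comp (f := Function.uncurry a) (x := (t, x))
      hac.continuousAt).continuousWithinAt
  have hdiff : DifferentiableOn ℂ (fun t => ℓ (mkC fun x => fundProfile d lam (a t x)))
      (Metric.ball 0 2) := by
    intro t ht
    have := hasDerivAt_mkC Metric.isOpen_ball (hcomp _ fun s hs => (h1 s hs).continuousAt)
      (G' := fun t x => g1 (a t x) * (2 * ((inner ℝ (p - x) v : ℝ) : ℂ) + 2 * t * ((‖v‖ ^ 2 : ℝ) : ℂ)))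
      ((hcomp _ fun s hs => (h2 s hs).continuousAt).mul (Continuous.continuousOn (by fun_prop)))
      (fun t ht x => HasDerivAt.comp (h₂ := fundProfile d lam) (h := fun s => a s x) t
        (h1 _ (hare t ht x)) (had t x)) ht
    exact (ℓ.hasFDerivAt.comp_hasDerivAt t this).differentiableAt.differentiableWithinAt
  have hreal : ∀ t : ℝ, ℓ (mkC fun x => fundProfile d lam (a t x)) = ℓ (poleC lam L (p + t • v)) := by
    intro t
    congr 2
    funext x
    have : p + t • v - (x : EuclideanSpace ℝ (Fin d)) = (p - x) + t • v := by abel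
    rw [fund, this, norm_add_sq_real, inner_smul_right, norm_smul, mul_pow, Real.norm_eq_abs, sq_abs]
    simp only [ha]
    congr 1
    push_cast
    ring
  have hzero := (hdiff.analyticOnNhd Metric.isOpen_ball).eqOn_zero_of_preconnected_of_frequently_eq_zero
    (convex_ball _ _).isPreconnected (z₀ := 0) (Metric.mem_ball_self (by norm_num)) ?_
  · have := hzero (x := ((1 : ℝ) : ℂ)) (by simp)
    simpa only [hreal, one_smul, Pi.zero_apply] using this
  · have hlim : Tendsto (fun t : ℝ => p + t • v) (𝓝 0) (𝓝 p) := by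
      have : Continuous fun t : ℝ => p + t • v := by fun_prop
      simpa using this.tendsto 0
    have hev : ∀ᶠ t : ℝ in 𝓝[≠] 0, ℓ (mkC fun x => fundProfile d lam (a t x)) = 0 := by
      filter_upwards [nhdsWithin_le_nhds (hlim.eventually h0)] with t ht
      rw [hreal, ht]
    have ht : Tendsto (fun t : ℝ => (t : ℂ)) (𝓝[≠] 0) (𝓝[≠] 0) := by
      refine tendsto_nhdsWithin_iff.2 ⟨?_, ?_⟩
      · simpa using (Complex.continuous_ofReal.tendsto 0).mono_left nhdsWithin_le_nhds
      · filter_upwards [self_mem_nhdsWithin] with t ht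
        simpa using ht
    exact ht.frequently hev.frequently

theorem poleC_eq_zero [CompactSpace L] (hd : 1 ≤ d) (lam : ℂ) (ℓ : C(L, ℂ) →L[ℂ] ℂ) (hL : IsCompact L)
    (hLc : IsPreconnected Lᶜ) {q : EuclideanSpace ℝ (Fin d)} (hq : q ∈ Lᶜ)
    (h0 : ∀ᶠ y in 𝓝 q, ℓ (poleC lam L y) = 0) : ∀ y ∈ Lᶜ, ℓ (poleC lam L y) = 0 := by
  suffices h : Lᶜ ⊆ {y | ∀ᶠ z in 𝓝 y, ℓ (poleC lam L z) = 0} from fun y hy => (h hy).self_of_nhds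
  refine hLc.subset_of_closure_inter_subset isOpen_setOfPred_eventually_nhds ⟨q, hq, h0⟩ ?_
  rintro y ⟨hy, hyL⟩
  obtain ⟨r, hr, hball⟩ := Metric.isOpen_iff.1 hL.isClosed.isOpen_compl y hyL
  obtain ⟨p, hp, hpy⟩ := Metric.mem_closure_iff.1 hy (r / 6) (by positivity)
  have hp5 : ∀ x ∈ L, 5 * (r / 6) ≤ ‖p - x‖ := by
    intro x hx
    by_contra hlt
    push Not at hlt
    refine hball ?_ hx
    rw [Metric.mem_ball, dist_comm]
    have := dist_triangle y p x
    rw [dist_eq_norm p x] at this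
    linarith
  filter_upwards [Metric.isOpen_ball.mem_nhds (Metric.mem_ball.2 hpy : y ∈ Metric.ball p (r / 6))]
    with z hz
  have := poleC_segment_eq_zero hd lam ℓ (v := z - p) hp5 (by rwa [← dist_eq_norm]) hp
  rwa [add_sub_cancel] at this

end Propagation

section Runge

variable {d : ℕ}

theorem isSol_zero (lam : ℂ) (X : Set (EuclideanSpace ℝ (Fin d))) : IsSol lam X fun _ => 0 := by
  have h : ∀ j : Fin d, pd j (fun _ : EuclideanSpace ℝ (Fin d) => (0 : ℂ)) = fun _ => 0 := fun j =>
    funext fun x => pd_const 0 x j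
  exact ⟨contDiffOn_const, fun x _ => by simp [lap, h]⟩

theorem isSol_fund_sub (hd : 1 ≤ d) (lam : ℂ) (y : EuclideanSpace ℝ (Fin d)) :
    IsSol lam {y}ᶜ fun x => fund d lam (y - x) := by
  have h : (fun x => fund d lam (y - x)) = fun x => fund d lam (x - y) := by
    funext x
    simp only [fund, norm_sub_rev]
  rw [h]
  refine ⟨fun x hx => ?_, fun x hx => ?_⟩
  · exact ((contDiffAt_fund hd lam (sub_ne_zero.2 hx)).comp (f := fun x => x - y) x
      (by fun_prop)).contDiffWithinAt
  · rw [lap_comp_sub]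
    exact lap_fund hd lam (sub_ne_zero.2 hx)

theorem integrable_smul_poleC (hd : 1 ≤ d) (lam : ℂ) {L : Set (EuclideanSpace ℝ (Fin d))}
    [CompactSpace L] (hL : IsCompact L) {h : EuclideanSpace ℝ (Fin d) → ℂ} (hh : Continuous h)
    (hc : HasCompactSupport h) (hs : tsupport h ⊆ Lᶜ) :
    Integrable fun y => h y • poleC lam L y := by
  refine Continuous.integrable_of_hasCompactSupport (continuous_iff_continuousAt.2 fun y => ?_)
    hc.smul_right
  by_cases hy : y ∈ tsupport h
  · exact hh.continuousAt.smul ((continuousOn_mkC (continuousOn_uncurry_fund hd lam)).continuousAt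
      (hL.isClosed.isOpen_compl.mem_nhds (hs hy)))
  · have : (fun y => h y • poleC lam L y) =ᶠ[𝓝 y] fun _ => 0 := by
      filter_upwards [notMem_tsupport_iff_eventuallyEq.1 hy] with z hz
      simp [hz]
    exact continuousAt_const.congr this.symm

/-- Approximation of solutions near a compact set with connected complement by solutions on a
large ball. -/
theorem runge_ball (hd : 1 ≤ d) (lam : ℂ) {L O : Set (EuclideanSpace ℝ (Fin d))}
    (hL : IsCompact L) (hLc : IsPreconnected Lᶜ) (hO : IsOpen O) (hLO : L ⊆ O)
    {F : EuclideanSpace ℝ (Fin d) → ℂ} (hF : IsSol lam O F) (R : ℝ) {ε : ℝ} (hε : 0 < ε) :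
    ∃ h, IsSol lam (Metric.ball 0 R) h ∧ ∀ x ∈ L, ‖h x - F x‖ < ε := by
  wlog hLR : L ⊆ Metric.ball 0 R generalizing R
  · obtain ⟨R', hR'⟩ := hL.isBounded.subset_ball_lt R 0
    obtain ⟨h, h1, h2⟩ := this R' hR'.2
    exact ⟨h, h1.mono (Metric.ball_subset_ball hR'.1.le), h2⟩
  have : CompactSpace L := isCompact_iff_compactSpace.1 hL
  have : Nonempty (Fin d) := ⟨⟨0, hd⟩⟩
  let S : Submodule ℂ C(L, ℂ) :=
    { carrier := {c | ∃ h : EuclideanSpace ℝ (Fin d) → ℂ, IsSol lam (Metric.ball 0 R) h ∧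
        ∀ x : L, c x = h x}
      add_mem' := by
        rintro a b ⟨h, h1, h2⟩ ⟨k, k1, k2⟩
        exact ⟨_, h1.add Metric.isOpen_ball k1, fun x => by simp [h2, k2]⟩
      zero_mem' := ⟨_, isSol_zero lam _, fun x => rfl⟩
      smul_mem' := by
        rintro c a ⟨h, h1, h2⟩
        exact ⟨_, h1.const_mul Metric.isOpen_ball c, fun x => by simp [h2]⟩ }
  have hFc : Continuous fun x : L => F x := hF.1.continuousOn.comp_continuous
    continuous_subtype_val fun x => hLO x.2
  suffices hmem : (⟨_, hFc⟩ : C(L, ℂ)) ∈ closure (S : Set C(L, ℂ)) by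
    obtain ⟨c, ⟨h, h1, h2⟩, hc⟩ := Metric.mem_closure_iff.1 hmem ε hε
    refine ⟨h, h1, fun x hx => ?_⟩
    rw [← h2 ⟨x, hx⟩, ← dist_eq_norm, dist_comm]
    exact (ContinuousMap.dist_apply_le_dist (f := (⟨_, hFc⟩ : C(L, ℂ))) (⟨x, hx⟩ : L)).trans_lt hc
  by_contra hnot
  obtain ⟨ℓ, u, hlt, hu⟩ := RCLike.geometric_hahn_banach_closed_point (𝕜 := ℂ)
    (s := closure (S : Set C(L, ℂ))) ((S.restrictScalars ℝ).convex.closure) isClosed_closure hnot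
  have hS : ∀ c ∈ S, ℓ c = 0 := by
    intro c hc
    by_contra hne
    have := hlt _ (subset_closure (S.smul_mem ((u : ℂ) / ℓ c) hc))
    rw [map_smul, smul_eq_mul, div_mul_cancel₀ _ hne] at this
    simp at this
  have hfar : ∀ y ∉ Metric.ball (0 : EuclideanSpace ℝ (Fin d)) R, ℓ (poleC lam L y) = 0 := by
    intro y hy
    have hyL : y ∈ Lᶜ := fun h => hy (hLR h)
    refine hS _ ⟨_, (isSol_fund_sub hd lam y).mono fun x hx => ?_, fun x =>
      mkC_apply (continuous_of_uncurry (continuousOn_uncurry_fund hd lam) hyL) x⟩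
    rintro rfl
    exact hy hx
  obtain ⟨q, hq⟩ := NormedSpace.exists_lt_norm ℝ (EuclideanSpace ℝ (Fin d)) R
  have hzero := poleC_eq_zero hd lam ℓ hL hLc (q := q)
    (fun h => by have := mem_ball_zero_iff.1 (hLR h); linarith) (by
      filter_upwards [(isOpen_lt continuous_const continuous_norm).mem_nhds hq] with y hy
      refine hfar y fun h => ?_
      have := mem_ball_zero_iff.1 h
      have hy : R < ‖y‖ := hy
      linarith)
  obtain ⟨χ, hχ, hχc, hχs, hχ1, -⟩ := exists_smooth_cutoff hL hO hLO
  have hφ : ContDiff ℝ ∞ fun x => χ x * F x := hF.1.cutoff_mul hO hχ hχs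
  have hφc : HasCompactSupport fun x => χ x * F x := hχc.mul_right
  set h := fun y => lap (fun x => χ x * F x) y - lam * (χ y * F y) with hh
  have hsol : ∀ x ∈ L, ∀ᶠ y in 𝓝 x, h y = 0 := by
    intro x hx
    have e1 := eventually_nhdsSet_iff_forall.1 hχ1 x hx
    filter_upwards [e1.eventually_nhds, hO.mem_nhds (hLO hx)] with y hy hyO
    have : (fun x => χ x * F x) =ᶠ[𝓝 y] F := by
      filter_upwards [hy] with z hz
      simp [hz]
    simp only [hh]
    rw [lap_congr this, hF.2 y hyO, hy.self_of_nhds]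
    ring
  have hcont : Continuous h := (hφ.lap.continuous).sub (continuous_const.mul hφ.continuous)
  have hcs : HasCompactSupport h := hφc.lap.sub hφc.mul_left
  have hts : tsupport h ⊆ Lᶜ := fun x hx hxL =>
    (notMem_tsupport_iff_eventuallyEq.2 (hsol x hxL)) hx
  have hint := integrable_smul_poleC hd lam hL hcont hcs hts
  have heq : (⟨_, hFc⟩ : C(L, ℂ)) = fundConst d • ∫ y, h y • poleC lam L y := by
    ext x
    have e1 := eventually_nhdsSet_iff_forall.1 hχ1 x x.2
    obtain ⟨δ, hδ, hball⟩ := Metric.eventually_nhds_iff_ball.1 (hsol x x.2)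
    have e2 := eq_integral_fund hd hφ hφc lam (x := x) hδ fun y hy => sub_eq_zero.1 (hball y hy)
    have e3 := (ContinuousMap.evalCLM ℂ x).integral_comp_comm hint
    simp only [ContinuousMap.evalCLM_apply] at e3
    rw [ContinuousMap.smul_apply, ← e3]
    simp only [ContinuousMap.coe_mk, e1.self_of_nhds, one_mul] at e2 ⊢
    rw [e2, smul_eq_mul]
    congr 1
    refine integral_congr_ae (Eventually.of_forall fun y => ?_)
    by_cases hy : y ∈ tsupport h
    · have := mkC_apply (continuous_of_uncurry (continuousOn_uncurry_fund hd lam) (hts hy)) x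
      simp only [ContinuousMap.smul_apply, poleC, this, smul_eq_mul]
      ring
    · have : h y = 0 := image_eq_zero_of_notMem_tsupport hy
      simp only [hh] at this
      simp [this, h]
  have hℓ : ℓ (⟨_, hFc⟩ : C(L, ℂ)) = 0 := by
    rw [heq, map_smul, ← ℓ.integral_comp_comm hint, integral_eq_zero_of_ae, smul_zero]
    refine Eventually.of_forall fun y => ?_
    by_cases hy : y ∈ tsupport h
    · simp [hzero y (hts hy)]
    · simp [image_eq_zero_of_notMem_tsupport hy]
  have h0 := hlt 0 (subset_closure S.zero_mem)
  rw [hℓ] at hu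
  simp only [map_zero] at h0 hu
  linarith

end Runge

section RungeGlobal

variable {d : ℕ}

theorem isPreconnected_norm_preimage (hd : 2 ≤ d) {J : Set ℝ} (hJ : IsPreconnected J)
    (hpos : ∀ r ∈ J, 0 < r) : IsPreconnected {x : EuclideanSpace ℝ (Fin d) | ‖x‖ ∈ J} := by
  have hrank : 1 < Module.rank ℝ (EuclideanSpace ℝ (Fin d)) := by
    rw [← Module.finrank_eq_rank, finrank_euclideanSpace_fin]
    exact_mod_cast hd
  have hs := isPreconnected_sphere hrank (0 : EuclideanSpace ℝ (Fin d)) 1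
  have := (hJ.prod hs).image (fun p => p.1 • p.2) (by fun_prop)
  convert this using 1
  ext x
  simp only [mem_ofPred_eq, mem_image, mem_prod, mem_sphere_zero_iff_norm, Prod.exists]
  constructor
  · intro hx
    have h0 := hpos _ hx
    exact ⟨‖x‖, ‖x‖⁻¹ • x, ⟨hx, by rw [norm_smul, norm_inv, norm_norm, inv_mul_cancel₀ h0.ne']⟩,
      by rw [smul_smul, mul_inv_cancel₀ h0.ne', one_smul]⟩
  · rintro ⟨r, y, ⟨hr, hy⟩, rfl⟩
    rwa [norm_smul, hy, mul_one, Real.norm_of_nonneg (hpos r hr).le]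

theorem isPreconnected_compl_closedBall_zero (hd : 2 ≤ d) {r : ℝ} (hr : 0 ≤ r) :
    IsPreconnected (Metric.closedBall (0 : EuclideanSpace ℝ (Fin d)) r)ᶜ := by
  convert isPreconnected_norm_preimage hd (isPreconnected_Ioi (a := r))
    (fun s hs => hr.trans_lt hs) using 1
  ext x
  simp

/-- Approximation of solutions near a compact set with connected complement by entire solutions. -/
theorem runge (hd : 2 ≤ d) (lam : ℂ) {L O : Set (EuclideanSpace ℝ (Fin d))}
    (hL : IsCompact L) (hLc : IsPreconnected Lᶜ) (hO : IsOpen O) (hLO : L ⊆ O)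
    {F : EuclideanSpace ℝ (Fin d) → ℂ} (hF : IsSol lam O F) {ε : ℝ} (hε : 0 < ε) :
    ∃ h, IsSol lam univ h ∧ ∀ x ∈ L, ‖h x - F x‖ < ε := by
  have hd1 : 1 ≤ d := by omega
  obtain ⟨R, hR, hLR⟩ := hL.isBounded.subset_closedBall_lt 0 0
  obtain ⟨h₀, hs₀, happ⟩ := runge_ball hd1 lam hL hLc hO hLO hF (R + (0 : ℕ) + 1)
    (by positivity : 0 < ε / 2)
  have step : ∀ (n : ℕ) (h : {h // IsSol lam (Metric.ball (0 : EuclideanSpace ℝ (Fin d))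
      (R + n + 1)) h}), ∃ h' : {h // IsSol lam (Metric.ball (0 : EuclideanSpace ℝ (Fin d))
      (R + (n + 1 : ℕ) + 1)) h}, ∀ x ∈ Metric.closedBall (0 : EuclideanSpace ℝ (Fin d)) (R + n),
      ‖h'.1 x - h.1 x‖ < ε / 2 / 2 / 2 ^ n := by
    rintro n ⟨h, hh⟩
    obtain ⟨h', h1, h2⟩ := runge_ball hd1 lam (isCompact_closedBall 0 (R + n))
      (isPreconnected_compl_closedBall_zero hd (by positivity)) Metric.isOpen_ball
      (Metric.closedBall_subset_ball (by linarith)) hh (R + (n + 1 : ℕ) + 1)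
      (by positivity : 0 < ε / 2 / 2 / 2 ^ n)
    exact ⟨⟨h', h1⟩, h2⟩
  choose next hnext using step
  let u : ∀ n : ℕ, {h // IsSol lam (Metric.ball (0 : EuclideanSpace ℝ (Fin d)) (R + n + 1)) h} :=
    fun n => Nat.rec ⟨h₀, hs₀⟩ next n
  have hu : ∀ (n : ℕ), ∀ x ∈ Metric.closedBall (0 : EuclideanSpace ℝ (Fin d)) (R + n),
      ‖(u (n + 1)).1 x - (u n).1 x‖ < ε / 2 / 2 / 2 ^ n := fun n => hnext n (u n)
  have hdist : ∀ (N : ℕ), ∀ x ∈ Metric.closedBall (0 : EuclideanSpace ℝ (Fin d)) (R + N), ∀ i : ℕ,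
      dist ((u (N + i)).1 x) ((u (N + (i + 1))).1 x) ≤ ε / 2 / 2 / 2 ^ i := by
    intro N x hx i
    rw [dist_comm, dist_eq_norm]
    refine ((hu (N + i) x (Metric.closedBall_subset_closedBall (by push_cast; linarith) hx)).le).trans
      ?_
    gcongr
    · norm_num
    · omega
  have hexN : ∀ x : EuclideanSpace ℝ (Fin d), ∃ N : ℕ, x ∈ Metric.closedBall 0 (R + N) := by
    intro x
    obtain ⟨N, hN⟩ := exists_nat_ge ‖x‖
    exact ⟨N, by rw [mem_closedBall_zero_iff]; linarith⟩
  have hlim : ∀ x, ∃ a, Tendsto (fun n => (u n).1 x) atTop (𝓝 a) := by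
    intro x
    obtain ⟨N, hN⟩ := hexN x
    obtain ⟨a, ha⟩ := cauchySeq_tendsto_of_complete (cauchySeq_of_le_geometric_two (hdist N x hN))
    refine ⟨a, (tendsto_add_atTop_iff_nat N).1 ?_⟩
    exact ha.congr fun i => by rw [add_comm N i]
  choose h hh using hlim
  have hbd : ∀ (N : ℕ), ∀ x ∈ Metric.closedBall (0 : EuclideanSpace ℝ (Fin d)) (R + N), ∀ i : ℕ,
      dist ((u (N + i)).1 x) (h x) ≤ ε / 2 / 2 ^ i := by
    intro N x hx i
    refine dist_le_of_le_geometric_two_of_tendsto (hdist N x hx) ?_ i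
    exact ((tendsto_add_atTop_iff_nat N).2 (hh x)).congr fun i => by rw [add_comm N i]
  refine ⟨h, ?_, fun x hx => ?_⟩
  · have hball : ∀ N : ℕ, IsSol lam (Metric.ball 0 (R + N)) h := by
      intro N
      refine (IsSol.of_tendsto (l := atTop) hd1 Metric.isOpen_ball (F := fun i => (u (N + i)).1)
        (fun i => (u (N + i)).2.mono (Metric.ball_subset_ball (by push_cast; linarith))) ?_).1
      intro K hK _
      rw [Metric.tendstoUniformlyOn_iff]
      intro η hη
      have ht : Tendsto (fun i : ℕ => ε / 2 / 2 ^ i) atTop (𝓝 0) :=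
        tendsto_const_nhds.div_atTop (tendsto_pow_atTop_atTop_of_one_lt (by norm_num))
      filter_upwards [ht.eventually (gt_mem_nhds hη)] with i hi x hx
      rw [dist_comm]
      exact (hbd N x (Metric.ball_subset_closedBall (hK hx)) i).trans_lt hi
    have hmem : ∀ x : EuclideanSpace ℝ (Fin d), ∃ N : ℕ, x ∈ Metric.ball 0 (R + N) := by
      intro x
      obtain ⟨N, hN⟩ := exists_nat_ge ‖x‖
      exact ⟨N, by rw [mem_ball_zero_iff]; linarith⟩
    refine ⟨fun x _ => ?_, fun x _ => ?_⟩
    · obtain ⟨N, hN⟩ := hmem x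
      exact ((hball N).1.contDiffAt (Metric.isOpen_ball.mem_nhds hN)).contDiffWithinAt
    · obtain ⟨N, hN⟩ := hmem x
      exact (hball N).2 x hN
  · have h1 := hbd 0 x (by simpa using hLR hx) 0
    have h2 := happ x hx
    rw [dist_comm, dist_eq_norm] at h1
    have h3 : (u (0 + 0)).1 = h₀ := rfl
    rw [h3] at h1
    calc ‖h x - F x‖ ≤ ‖h x - h₀ x‖ + ‖h₀ x - F x‖ := norm_sub_le_norm_sub_add_norm_sub _ _ _
      _ < ε := by
        simp only [pow_zero, div_one] at h1
        linarith

end RungeGlobal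

section Topology

theorem isPreconnected_compl_union {Y : Type*} [TopologicalSpace Y] [PreconnectedSpace Y]
    {K₁ K₂ U₁ U₂ : Set Y} (hK₁ : IsClosed K₁) (hK₂ : IsClosed K₂) (hU₁ : IsOpen U₁)
    (hU₂ : IsOpen U₂) (h₁ : K₁ ⊆ U₁) (h₂ : K₂ ⊆ U₂) (hU : Disjoint U₁ U₂)
    (hA₁ : IsPreconnected (U₁ \ K₁)) (hA₂ : IsPreconnected (U₂ \ K₂)) :
    IsPreconnected (K₁ ∪ K₂)ᶜ := by
  have hW : IsOpen (K₁ ∪ K₂)ᶜ := (hK₁.union hK₂).isOpen_compl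
  have sub₁ : U₁ \ K₁ ⊆ (K₁ ∪ K₂)ᶜ := fun x hx h => h.elim hx.2 fun h =>
    disjoint_left.1 hU hx.1 (h₂ h)
  have sub₂ : U₂ \ K₂ ⊆ (K₁ ∪ K₂)ᶜ := fun x hx h => h.elim
    (fun h => disjoint_left.1 hU (h₁ h) hx.1) hx.2
  suffices key : ∀ S T : Set Y, IsOpen S → IsOpen T → S ∪ T = (K₁ ∪ K₂)ᶜ → Disjoint S T →
      S.Nonempty → T.Nonempty → U₁ \ K₁ ⊆ S → False by
    rw [isPreconnected_iff_subset_of_disjoint]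
    intro u v hu hv huv hdis
    by_contra! hne
    set S := (K₁ ∪ K₂)ᶜ ∩ u
    set T := (K₁ ∪ K₂)ᶜ ∩ v
    have hST : S ∪ T = (K₁ ∪ K₂)ᶜ := by
      rw [← inter_union_distrib_left]
      exact inter_eq_left.2 huv
    have hdST : Disjoint S T := by
      rw [disjoint_iff_inter_eq_empty, ← hdis]
      ext x
      simp only [S, T, mem_inter_iff]
      tauto
    have hS : S.Nonempty := by
      by_contra h
      rw [not_nonempty_iff_eq_empty] at h
      rw [h, empty_union] at hST
      exact hne.2 (hST ▸ inter_subset_right)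
    have hT : T.Nonempty := by
      by_contra h
      rw [not_nonempty_iff_eq_empty] at h
      rw [h, union_empty] at hST
      exact hne.1 (hST ▸ inter_subset_right)
    rcases isPreconnected_iff_subset_of_disjoint.1 hA₁ S T (hW.inter hu) (hW.inter hv)
      (hST ▸ sub₁) (by rw [disjoint_iff_inter_eq_empty.1 hdST, inter_empty]) with h | h
    · exact key S T (hW.inter hu) (hW.inter hv) hST hdST hS hT h
    · exact key T S (hW.inter hv) (hW.inter hu) (by rw [union_comm, hST]) hdST.symm hT hS h
  intro S T hSo hTo hST hdis hS hT hA
  have hSW : S ⊆ (K₁ ∪ K₂)ᶜ := hST ▸ subset_union_left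
  have hTW : T ⊆ (K₁ ∪ K₂)ᶜ := hST ▸ subset_union_right
  have open₁ : ∀ Q : Set Y, IsOpen Q → U₁ \ K₁ ⊆ Q → IsOpen (Q ∪ K₁) := by
    intro Q hQ h
    have : Q ∪ K₁ = Q ∪ U₁ := by
      ext x
      have := @h x
      have := @h₁ x
      simp only [Set.mem_sdiff, mem_union] at *
      tauto
    rw [this]
    exact hQ.union hU₁
  have open₂ : ∀ Q : Set Y, IsOpen Q → U₂ \ K₂ ⊆ Q → IsOpen (Q ∪ K₂) := by
    intro Q hQ h
    have : Q ∪ K₂ = Q ∪ U₂ := by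
      ext x
      have := @h x
      have := @h₂ x
      simp only [Set.mem_sdiff, mem_union] at *
      tauto
    rw [this]
    exact hQ.union hU₂
  have fin : ∀ P Q : Set Y, IsOpen P → IsOpen Q → S ⊆ P → T ⊆ Q → P ∪ Q = univ →
      P ∩ Q = ∅ → False := by
    intro P Q hP hQ hSP hTQ hc hd
    obtain ⟨x, -, hx⟩ := isPreconnected_univ P Q hP hQ hc.ge
      (by simpa using hS.mono hSP) (by simpa using hT.mono hTQ)
    rw [hd] at hx
    exact hx
  have hcov : ∀ x, x ∈ S ∨ x ∈ T ∨ x ∈ K₁ ∨ x ∈ K₂ := by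
    intro x
    have : x ∈ S ∪ T ↔ x ∈ (K₁ ∪ K₂)ᶜ := by rw [hST]
    simp only [mem_union, mem_compl_iff] at this
    tauto
  have hd' : ∀ x, x ∈ S → x ∉ T := fun x h => disjoint_left.1 hdis h
  have hk : ∀ x, x ∈ K₁ → x ∉ K₂ := fun x h h' => disjoint_left.1 hU (h₁ h) (h₂ h')
  rcases isPreconnected_iff_subset_of_disjoint.1 hA₂ S T hSo hTo
      (hST ▸ sub₂) (by rw [disjoint_iff_inter_eq_empty.1 hdis, inter_empty]) with h | h
  · refine fin _ T (open₂ _ (open₁ S hSo hA) (h.trans subset_union_left)) hTo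
      (subset_union_left.trans subset_union_left) Subset.rfl ?_ ?_
    · ext x
      have := hcov x
      simp only [mem_union, mem_univ, iff_true]
      tauto
    · ext x
      have := @hTW x
      have := hd' x
      simp only [mem_union, mem_inter_iff, mem_compl_iff, mem_empty_iff_false, iff_false] at *
      tauto
  · refine fin _ _ (open₁ S hSo hA) (open₂ T hTo h) subset_union_left subset_union_left ?_ ?_
    · ext x
      have := hcov x
      simp only [mem_union, mem_univ, iff_true]
      tauto
    · ext x
      have := @hTW x
      have := @hSW x
      have := hd' x
      have := hk x
      simp only [mem_union, mem_inter_iff, mem_compl_iff, mem_empty_iff_false, iff_false] at *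
      tauto

theorem exists_runAway_compact {d : ℕ} (hd : 2 ≤ d) {X : Set (EuclideanSpace ℝ (Fin d))}
    (hX : IsOpen X) (h₀ : X ≃ₜ EuclideanSpace ℝ (Fin d))
    {ψ : EuclideanSpace ℝ (Fin d) → EuclideanSpace ℝ (Fin d)} (hψ : ContinuousOn ψ X)
    (hm : MapsTo ψ X X) (hinj : InjOn ψ X) (hopen : ∀ U ⊆ X, IsOpen U → IsOpen (ψ '' U))
    (hrun : RunAway (MapsTo.restrict ψ X X hm)) {K : Set (EuclideanSpace ℝ (Fin d))}
    (hK : IsCompact K) (hKX : K ⊆ X) :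
    ∃ K₁ ⊆ X, K ⊆ K₁ ∧ IsCompact K₁ ∧ ∃ m, 1 ≤ m ∧ Disjoint K₁ (ψ^[m] '' K₁) ∧
      IsPreconnected (K₁ ∪ ψ^[m] '' K₁)ᶜ := by
  have hcont : ∀ m, ContinuousOn ψ^[m] X := fun m => hψ.iterate hm m
  have hinjm : ∀ m, InjOn ψ^[m] X := fun m => hinj.iterate hm m
  have hopenm : ∀ m, ∀ U ⊆ X, IsOpen U → IsOpen (ψ^[m] '' U) := by
    intro m
    induction m with
    | zero => simp
    | succ n ih =>
      intro U hU hUo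
      rw [Function.iterate_succ, image_comp]
      exact ih _ (image_subset_iff.2 fun x hx => hm (hU hx)) (hopen U hU hUo)
  set g : EuclideanSpace ℝ (Fin d) → EuclideanSpace ℝ (Fin d) := fun y => (h₀.symm y : _) with hg
  have hgc : Continuous g := continuous_subtype_val.comp h₀.symm.continuous
  have hgo : IsOpenMap g := hX.isOpenMap_subtype_val.comp h₀.symm.isOpenMap
  have hgi : Function.Injective g := Subtype.val_injective.comp h₀.symm.injective
  have hgX : ∀ A, g '' A ⊆ X := fun A => image_subset_iff.2 fun y _ => (h₀.symm y).2
  have hKc : IsCompact (h₀ '' ((↑) ⁻¹' K)) :=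
    (Topology.IsInducing.subtypeVal.isCompact_preimage' hK (by simpa using hKX)).image h₀.continuous
  obtain ⟨R, hR, hKR⟩ := hKc.isBounded.subset_closedBall_lt 0 0
  obtain ⟨m, hm1, hmd⟩ := hrun (h₀.symm '' Metric.closedBall 0 (R + 1))
    ((isCompact_closedBall 0 (R + 1)).image h₀.symm.continuous)
  have hdis : Disjoint (g '' Metric.closedBall 0 (R + 1)) (ψ^[m] '' (g '' Metric.closedBall 0 (R + 1))) := by
    rw [disjoint_left]
    rintro _ ⟨y, hy, rfl⟩ ⟨_, ⟨z, hz, rfl⟩, h⟩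
    have hmem : (MapsTo.restrict ψ X X hm)^[m] (h₀.symm z) = h₀.symm y := by
      rw [MapsTo.iterate_restrict]
      exact Subtype.ext h
    refine (hmd.subset ⟨⟨_, mem_image_of_mem _ hz, hmem⟩, mem_image_of_mem _ hy⟩ :
      h₀.symm y ∈ (∅ : Set X))
  have hsub := Metric.closedBall_subset_closedBall (x := (0 : EuclideanSpace ℝ (Fin d)))
    (by linarith : R ≤ R + 1)
  have hann : IsPreconnected (Metric.ball (0 : EuclideanSpace ℝ (Fin d)) (R + 1) \
      Metric.closedBall 0 R) := by
    convert isPreconnected_norm_preimage hd (isPreconnected_Ioo (a := R) (b := R + 1))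
      (fun s hs => hR.trans hs.1) using 1
    ext x
    simp [and_comm]
  have hann₁ : IsPreconnected (g '' Metric.ball 0 (R + 1) \ g '' Metric.closedBall 0 R) := by
    rw [← image_sdiff hgi]
    exact hann.image _ hgc.continuousOn
  have hc := (isCompact_closedBall (0 : EuclideanSpace ℝ (Fin d)) R).image hgc
  have hcm := hc.image_of_continuousOn ((hcont m).mono (hgX _))
  refine ⟨g '' Metric.closedBall 0 R, hgX _, ?_, hc, m, hm1,
    hdis.mono (image_mono hsub) (image_mono (image_mono hsub)), ?_⟩
  · intro x hx
    exact ⟨h₀ ⟨x, hKX hx⟩, hKR ⟨⟨x, hKX hx⟩, hx, rfl⟩, by simp [hg]⟩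
  · refine isPreconnected_compl_union hc.isClosed hcm.isClosed (hgo _ Metric.isOpen_ball)
      (hopenm m _ (hgX _) (hgo _ Metric.isOpen_ball))
      (image_mono (Metric.closedBall_subset_ball (by linarith)))
      (image_mono (image_mono (Metric.closedBall_subset_ball (by linarith))))
      (hdis.mono (image_mono Metric.ball_subset_closedBall)
        (image_mono (image_mono Metric.ball_subset_closedBall))) hann₁ ?_
    have h : ψ^[m] '' (g '' Metric.ball 0 (R + 1)) \ ψ^[m] '' (g '' Metric.closedBall 0 R) =
        ψ^[m] '' (g '' Metric.ball 0 (R + 1) \ g '' Metric.closedBall 0 R) := by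
      ext x
      constructor
      · rintro ⟨⟨y, hy, rfl⟩, h2⟩
        exact ⟨y, ⟨hy, fun h => h2 ⟨y, h, rfl⟩⟩, rfl⟩
      · rintro ⟨y, ⟨hy, hy'⟩, rfl⟩
        refine ⟨⟨y, hy, rfl⟩, ?_⟩
        rintro ⟨z, hz, hzy⟩
        exact hy' (hinjm m (hgX _ hz) (hgX _ hy) hzy ▸ hz)
    rw [h]
    exact hann₁.image _ ((hcont m).mono (sdiff_subset.trans (hgX _)))

end Topology

section Exponentials

variable {d : ℕ}

/-- The complex linear form `z ↦ ∑ₖ ζₖ zₖ`. -/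
noncomputable def linForm (ζ : Fin d → ℂ) : EuclideanSpace ℝ (Fin d) →L[ℝ] ℂ :=
  ∑ k, (ζ k) • (Complex.ofRealCLM ∘L EuclideanSpace.proj k)

theorem linForm_apply (ζ : Fin d → ℂ) (z : EuclideanSpace ℝ (Fin d)) :
    linForm ζ z = ∑ k, ζ k * ((z k : ℝ) : ℂ) := by
  simp [linForm]

theorem linForm_single (ζ : Fin d → ℂ) (j : Fin d) :
    linForm ζ (EuclideanSpace.single j 1) = ζ j := by
  rw [linForm_apply, Finset.sum_eq_single j] <;> simp +contextual

/-- The exponential function `z ↦ exp(ζ · z)`. -/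
noncomputable def expFun (ζ : Fin d → ℂ) (z : EuclideanSpace ℝ (Fin d)) : ℂ :=
  Complex.exp (linForm ζ z)

theorem expFun_ne_zero (ζ : Fin d → ℂ) (z : EuclideanSpace ℝ (Fin d)) : expFun ζ z ≠ 0 :=
  Complex.exp_ne_zero _

theorem contDiff_expFun (ζ : Fin d → ℂ) : ContDiff ℝ ∞ (expFun ζ) :=
  (linForm ζ).contDiff.cexp

theorem fderiv_expFun (ζ : Fin d → ℂ) (z u : EuclideanSpace ℝ (Fin d)) :
    fderiv ℝ (expFun ζ) z u = linForm ζ u * expFun ζ z := by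
  have h := ((linForm ζ).hasFDerivAt (x := z)).cexp
  have h' : fderiv ℝ (expFun ζ) z = _ := h.fderiv
  rw [h']
  simp [expFun, mul_comm]

theorem pd_expFun (ζ : Fin d → ℂ) (j : Fin d) : pd j (expFun ζ) = fun z => ζ j * expFun ζ z := by
  funext z
  rw [pd, fderiv_expFun, linForm_single]

theorem pd_pd_expFun (ζ : Fin d → ℂ) (j k : Fin d) :
    pd k (pd j (expFun ζ)) = fun z => ζ j * ζ k * expFun ζ z := by
  funext z
  rw [pd_expFun, pd_const_mul k _ ((contDiff_expFun ζ).differentiable (by simp) z), pd_expFun,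
    mul_assoc]

theorem isSol_expFun {lam : ℂ} {ζ : Fin d → ℂ} (hζ : ∑ k, ζ k ^ 2 = lam)
    (X : Set (EuclideanSpace ℝ (Fin d))) : IsSol lam X (expFun ζ) := by
  refine ⟨(contDiff_expFun ζ).contDiffOn, fun x _ => ?_⟩
  simp only [lap, pd_pd_expFun, ← hζ, Finset.sum_mul, sq]

/-- The vector `α eᵢ + β eⱼ`. -/
def twoVec (i j : Fin d) (α β : ℂ) : Fin d → ℂ := Pi.single i α + Pi.single j β

theorem sum_mul_twoVec {i j : Fin d} (α β : ℂ) (b : Fin d → ℂ) :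
    ∑ k, b k * twoVec i j α β k = b i * α + b j * β := by
  simp [twoVec, mul_add, Finset.sum_add_distrib, Pi.single_apply]

theorem sum_sq_twoVec {i j : Fin d} (hij : i ≠ j) (α β : ℂ) :
    ∑ k, twoVec i j α β k ^ 2 = α ^ 2 + β ^ 2 := by
  simp_rw [sq]
  rw [sum_mul_twoVec]
  simp [twoVec, hij, hij.symm]

/-- A quadratic polynomial vanishing on the complex sphere `ζ · ζ = λ` is a multiple of
`ζ · ζ - λ`. -/
theorem quadratic_eq_of_vanish (hd : 2 ≤ d) (lam : ℂ) {A : Fin d → Fin d → ℂ} {b : Fin d → ℂ}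
    {e : ℂ} (hA : ∀ k l, A k l = A l k)
    (h : ∀ ζ : Fin d → ℂ, ∑ k, ζ k ^ 2 = lam →
      ∑ k, ∑ l, A k l * (ζ k * ζ l) + ∑ k, b k * ζ k + e = 0) :
    ∃ c, (∀ k l, A k l = if k = l then c else 0) ∧ (∀ k, b k = 0) ∧ e = -lam * c := by
  have key : ∀ i j : Fin d, i ≠ j → ∀ α β : ℂ, α ^ 2 + β ^ 2 = lam →
      A i i * α ^ 2 + A j j * β ^ 2 + 2 * A i j * (α * β) + b i * α + b j * β + e = 0 := by
    intro i j hij α β hαβ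
    have := h (twoVec i j α β) (by rw [sum_sq_twoVec hij, hαβ])
    simp_rw [mul_left_comm (A _ _), ← Finset.mul_sum, sum_mul_twoVec] at this
    simp_rw [mul_comm (twoVec i j α β _), sum_mul_twoVec] at this
    rw [hA j i] at this
    linear_combination this
  have split : ∀ i j : Fin d, i ≠ j → ∀ α β : ℂ, α ^ 2 + β ^ 2 = lam →
      A i i * α ^ 2 + A j j * β ^ 2 + e = 0 ∧ A i j * (α * β) = 0 ∧ b i * α = 0 := by
    intro i j hij α β hαβ
    have h1 := key i j hij α β hαβ
    have h2 := key i j hij (-α) β (by linear_combination hαβ)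
    have h3 := key i j hij α (-β) (by linear_combination hαβ)
    have h4 := key i j hij (-α) (-β) (by linear_combination hαβ)
    refine ⟨by linear_combination (h1 + h2 + h3 + h4) / 4,
      by linear_combination (h1 - h2 - h3 + h4) / 8, by linear_combination (h1 - h2 + h3 - h4) / 4⟩
  have sqrt : ∀ a : ℂ, ∃ z, z ^ 2 = a := fun a => IsAlgClosed.exists_pow_nat_eq a two_pos
  have diag : ∀ i j, i ≠ j → A i i = A j j ∧ e = -lam * A j j ∧ b i = 0 := by
    intro i j hij
    obtain ⟨β, hβ⟩ := sqrt (lam - 1)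
    obtain ⟨γ, hγ⟩ := sqrt lam
    obtain ⟨h1, -, h3⟩ := split i j hij 1 β (by rw [hβ]; ring)
    obtain ⟨h4, -, -⟩ := split i j hij 0 γ (by rw [hγ]; ring)
    rw [hβ] at h1
    rw [hγ] at h4
    exact ⟨by linear_combination h1 - h4, by linear_combination h4, by simpa using h3⟩
  have offdiag : ∀ i j, i ≠ j → A i j = 0 := by
    intro i j hij
    have : ∃ α : ℂ, α ≠ 0 ∧ lam - α ^ 2 ≠ 0 := by
      by_cases h1 : lam = 1
      · exact ⟨2, two_ne_zero, by rw [h1]; norm_num⟩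
      · exact ⟨1, one_ne_zero, by simpa using sub_ne_zero.2 h1⟩
    obtain ⟨α, hα, hα'⟩ := this
    obtain ⟨β, hβ⟩ := sqrt (lam - α ^ 2)
    have hβ0 : β ≠ 0 := by
      rintro rfl
      exact hα' (by rw [← hβ]; ring)
    have := (split i j hij α β (by rw [hβ]; ring)).2.1
    simpa [hα, hβ0] using this
  have hne : ∀ i : Fin d, ∃ j, i ≠ j := fun i =>
    have : Nontrivial (Fin d) := Fin.nontrivial_iff_two_le.2 hd
    (exists_ne i).imp fun _ h => h.symm
  refine ⟨A ⟨0, by omega⟩ ⟨0, by omega⟩, fun k l => ?_, fun k => ?_, ?_⟩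
  · split_ifs with hkl
    · subst hkl
      by_cases hk : k = ⟨0, by omega⟩
      · rw [hk]
      · exact (diag _ _ hk).1
    · exact offdiag k l hkl
  · obtain ⟨j, hj⟩ := hne k
    exact (diag k j hj).2.2
  · obtain ⟨j, hj⟩ := hne ⟨0, by omega⟩
    exact (diag _ _ hj.symm).2.1

end Exponentials

section Chain

variable {d : ℕ} {ψ : EuclideanSpace ℝ (Fin d) → EuclideanSpace ℝ (Fin d)}

/-- The `k`-th component of a map, as a complex-valued function. -/
noncomputable def coordC (ψ : EuclideanSpace ℝ (Fin d) → EuclideanSpace ℝ (Fin d)) (k : Fin d)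
    (x : EuclideanSpace ℝ (Fin d)) : ℂ := ((ψ x k : ℝ) : ℂ)

theorem ContDiffAt.coordC {x : EuclideanSpace ℝ (Fin d)} (h : ContDiffAt ℝ ∞ ψ x)
    (k : Fin d) : ContDiffAt ℝ ∞ (coordC ψ k) x :=
  (Complex.ofRealCLM ∘L (EuclideanSpace.proj (𝕜 := ℝ) k)).contDiff.contDiffAt.comp x h

theorem pd_coordC {x : EuclideanSpace ℝ (Fin d)} (h : DifferentiableAt ℝ ψ x) (j k : Fin d) :
    pd j (coordC ψ k) x = ((fderiv ℝ ψ x (EuclideanSpace.single j 1) k : ℝ) : ℂ) := by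
  have := ((Complex.ofRealCLM ∘L (EuclideanSpace.proj (𝕜 := ℝ) k)).hasFDerivAt.comp x
    h.hasFDerivAt).fderiv
  have h' : fderiv ℝ (coordC ψ k) x = _ := this
  rw [pd, h']
  simp

theorem pd_comp {v : EuclideanSpace ℝ (Fin d) → ℂ} {x : EuclideanSpace ℝ (Fin d)}
    (hv : DifferentiableAt ℝ v (ψ x)) (h : DifferentiableAt ℝ ψ x) (j : Fin d) :
    pd j (fun y => v (ψ y)) x = ∑ k, pd k v (ψ x) * pd j (coordC ψ k) x := by
  have h1 : fderiv ℝ (fun y => v (ψ y)) x = _ := (hv.hasFDerivAt.comp x h.hasFDerivAt).fderiv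
  rw [pd, h1, ContinuousLinearMap.comp_apply]
  set u := fderiv ℝ ψ x (EuclideanSpace.single j 1) with hu
  have h2 : u = ∑ k, u k • EuclideanSpace.single k (1 : ℝ) := by
    ext i
    simp [Finset.sum_apply, Pi.single_apply]
  conv_lhs => rw [h2]
  rw [map_sum]
  refine Finset.sum_congr rfl fun k _ => ?_
  rw [map_smul, pd_coordC h, ← hu, pd, Complex.real_smul, mul_comm]

theorem lap_mul {f g : EuclideanSpace ℝ (Fin d) → ℂ} {x : EuclideanSpace ℝ (Fin d)}
    (hf : ∀ᶠ y in 𝓝 x, ContDiffAt ℝ ∞ f y) (hg : ∀ᶠ y in 𝓝 x, ContDiffAt ℝ ∞ g y) :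
    lap (fun y => f y * g y) x =
      ∑ j, (pd j (pd j f) x * g x + 2 * (pd j f x * pd j g x) + f x * pd j (pd j g) x) := by
  refine Finset.sum_congr rfl fun j _ => ?_
  have h1 : pd j (fun y => f y * g y) =ᶠ[𝓝 x] fun y => pd j f y * g y + f y * pd j g y := by
    filter_upwards [hf, hg] with y hy1 hy2
    exact pd_mul j (hy1.differentiableAt (by simp)) (hy2.differentiableAt (by simp))
  have f0 := hf.self_of_nhds
  have g0 := hg.self_of_nhds
  have f1 := (f0.pd j).differentiableAt (by simp)
  have g1 := (g0.pd j).differentiableAt (by simp)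
  have f0 := f0.differentiableAt (by simp)
  have g0 := g0.differentiableAt (by simp)
  rw [(pd_congr j h1).eq_of_nhds, pd_add j (f1.fun_mul g0) (f0.fun_mul g1), pd_mul j f1 g0, pd_mul j f0 g1]
  ring

theorem pd_pd_comp {v : EuclideanSpace ℝ (Fin d) → ℂ} {x : EuclideanSpace ℝ (Fin d)}
    (hv : ∀ᶠ y in 𝓝 (ψ x), ContDiffAt ℝ ∞ v y) (hψ : ∀ᶠ y in 𝓝 x, ContDiffAt ℝ ∞ ψ y) (j : Fin d) :
    pd j (pd j (fun y => v (ψ y))) x =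
      ∑ k, ((∑ l, pd l (pd k v) (ψ x) * pd j (coordC ψ l) x) * pd j (coordC ψ k) x +
        pd k v (ψ x) * pd j (pd j (coordC ψ k)) x) := by
  have hψ0 := hψ.self_of_nhds
  have hv0 := hv.self_of_nhds
  have h1 : pd j (fun y => v (ψ y)) =ᶠ[𝓝 x] fun y => ∑ k, pd k v (ψ y) * pd j (coordC ψ k) y := by
    filter_upwards [hψ0.continuousAt.eventually hv, hψ] with y hy1 hy2
    exact pd_comp (hy1.differentiableAt (by simp)) (hy2.differentiableAt (by simp)) j
  have a1 : ∀ k, DifferentiableAt ℝ (fun y => pd k v (ψ y)) x := fun k =>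
    ((hv0.pd k).comp x hψ0).differentiableAt (by simp)
  have a2 : ∀ k, DifferentiableAt ℝ (pd j (coordC ψ k)) x := fun k =>
    ((hψ0.coordC k).pd j).differentiableAt (by simp)
  rw [(pd_congr j h1).eq_of_nhds, pd_sum j fun k _ => (a1 k).fun_mul (a2 k)]
  refine Finset.sum_congr rfl fun k _ => ?_
  rw [pd_mul j (a1 k) (a2 k), pd_comp ((hv0.pd k).differentiableAt (by simp))
    (hψ0.differentiableAt (by simp))]

theorem lap_mul_comp {w v : EuclideanSpace ℝ (Fin d) → ℂ} {x : EuclideanSpace ℝ (Fin d)}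
    (hw : ∀ᶠ y in 𝓝 x, ContDiffAt ℝ ∞ w y) (hψ : ∀ᶠ y in 𝓝 x, ContDiffAt ℝ ∞ ψ y)
    (hv : ∀ᶠ y in 𝓝 (ψ x), ContDiffAt ℝ ∞ v y) :
    lap (fun y => w y * v (ψ y)) x =
      ∑ k, ∑ l, (w x * ∑ j, pd j (coordC ψ k) x * pd j (coordC ψ l) x) * pd l (pd k v) (ψ x) +
      ∑ k, (∑ j, (2 * (pd j w x * pd j (coordC ψ k) x) + w x * pd j (pd j (coordC ψ k)) x)) *
        pd k v (ψ x) + lap w x * v (ψ x) := by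
  have hψ0 := hψ.self_of_nhds
  have hc : ∀ᶠ y in 𝓝 x, ContDiffAt ℝ ∞ (fun y => v (ψ y)) y := by
    filter_upwards [hψ0.continuousAt.eventually hv, hψ] with y hy1 hy2
    exact hy1.comp y hy2
  rw [lap_mul hw hc]
  simp only [pd_pd_comp hv hψ, pd_comp (hv.self_of_nhds.differentiableAt (by simp))
    (hψ0.differentiableAt (by simp)), lap]
  simp only [Finset.sum_mul, Finset.mul_sum, Finset.sum_add_distrib, mul_add, add_mul]
  have e1 : ∀ f : Fin d → Fin d → Fin d → ℂ, ∑ j, ∑ k, ∑ l, f j k l = ∑ k, ∑ l, ∑ j, f j k l := by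
    intro f
    rw [Finset.sum_comm]
    exact Finset.sum_congr rfl fun k _ => Finset.sum_comm
  rw [e1, Finset.sum_comm (f := fun j k => 2 * (pd j w x * (pd k v (ψ x) * pd j (coordC ψ k) x))),
    Finset.sum_comm (f := fun j k => w x * (pd k v (ψ x) * pd j (pd j (coordC ψ k)) x))]
  have e2 : ∀ a b c a' b' c' e : ℂ, a = a' → b = b' → c = c' → e + b + (a + c) = a' + (b' + c') + e := by
    rintro a b c a' b' c' e rfl rfl rfl
    ring
  refine e2 _ _ _ _ _ _ _ ?_ ?_ ?_
  · exact Finset.sum_congr rfl fun k _ => Finset.sum_congr rfl fun l _ => Finset.sum_congr rfl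
      fun j _ => by ring
  · exact Finset.sum_congr rfl fun k _ => Finset.sum_congr rfl fun l _ => by ring
  · exact Finset.sum_congr rfl fun k _ => Finset.sum_congr rfl fun l _ => by ring

/-- If `v ↦ w·(v ∘ ψ)` preserves the exponential solutions, then it intertwines the operators
`Δ - λ` up to a multiplier. -/
theorem exists_lap_mul_comp_eq (hd : 2 ≤ d) {lam : ℂ} {w : EuclideanSpace ℝ (Fin d) → ℂ}
    {x : EuclideanSpace ℝ (Fin d)}
    (hw : ∀ᶠ y in 𝓝 x, ContDiffAt ℝ ∞ w y) (hψ : ∀ᶠ y in 𝓝 x, ContDiffAt ℝ ∞ ψ y)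
    (h : ∀ ζ : Fin d → ℂ, ∑ k, ζ k ^ 2 = lam →
      lap (fun y => w y * expFun ζ (ψ y)) x = lam * (w x * expFun ζ (ψ x))) :
    ∃ c, (w x ≠ 0 → Function.Surjective (fderiv ℝ ψ x) → c ≠ 0) ∧
      ∀ v : EuclideanSpace ℝ (Fin d) → ℂ, (∀ᶠ y in 𝓝 (ψ x), ContDiffAt ℝ ∞ v y) →
        lap (fun y => w y * v (ψ y)) x - lam * (w x * v (ψ x)) =
          c * (lap v (ψ x) - lam * v (ψ x)) := by
  set A : Fin d → Fin d → ℂ := fun k l => w x * ∑ j, pd j (coordC ψ k) x * pd j (coordC ψ l) x with hA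
  obtain ⟨c, hc, hb, he⟩ := quadratic_eq_of_vanish hd lam (A := A)
    (b := fun k => ∑ j, (2 * (pd j w x * pd j (coordC ψ k) x) + w x * pd j (pd j (coordC ψ k)) x))
    (e := lap w x - lam * w x) (fun k l => by simp only [hA, mul_comm]) (fun ζ hζ => by
      have h1 := h ζ hζ
      rw [lap_mul_comp hw hψ (Eventually.of_forall fun y => (contDiff_expFun ζ).contDiffAt)] at h1
      have h0 := expFun_ne_zero ζ (ψ x)
      refine mul_right_cancel₀ h0 ?_
      simp only [pd_pd_expFun] at h1
      simp only [pd_expFun] at h1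
      simp only [add_mul, Finset.sum_mul] at h1 ⊢
      simp only [hA, mul_assoc, zero_mul, sub_mul] at h1 ⊢
      linear_combination h1)
  refine ⟨c, fun hw0 hsurj hc0 => ?_, fun v hv => ?_⟩
  · set i : Fin d := ⟨0, by omega⟩
    have h1 := hc i i
    rw [if_pos rfl, hc0, hA, mul_eq_zero, or_iff_right hw0] at h1
    have hdiff := hψ.self_of_nhds.differentiableAt (by simp)
    simp only [pd_coordC hdiff, ← Complex.ofReal_mul, ← Complex.ofReal_sum] at h1
    rw [Complex.ofReal_eq_zero, Finset.sum_eq_zero_iff_of_nonneg fun j _ => mul_self_nonneg _] at h1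
    obtain ⟨u, hu⟩ := hsurj (EuclideanSpace.single i 1)
    have h2 : u = ∑ k, u k • EuclideanSpace.single k (1 : ℝ) := by
      ext i
      simp [Finset.sum_apply, Pi.single_apply]
    have h3 : fderiv ℝ ψ x u i = 0 := by
      rw [h2, map_sum]
      simp only [map_smul, WithLp.ofLp_sum, Finset.sum_apply, PiLp.smul_apply, smul_eq_mul]
      exact Finset.sum_eq_zero fun j _ => by rw [mul_self_eq_zero.1 (h1 j (Finset.mem_univ j)), mul_zero]
    rw [hu] at h3
    simp at h3
  · rw [lap_mul_comp hw hψ hv]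
    have e1 : ∑ k, ∑ l, (w x * ∑ j, pd j (coordC ψ k) x * pd j (coordC ψ l) x) * pd l (pd k v) (ψ x) =
        c * lap v (ψ x) := by
      rw [lap, Finset.mul_sum]
      refine Finset.sum_congr rfl fun k _ => ?_
      have : ∀ l, w x * ∑ j, pd j (coordC ψ k) x * pd j (coordC ψ l) x = if k = l then c else 0 := hc k
      simp [this]
    rw [e1, Finset.sum_eq_zero fun k _ => by rw [hb k, zero_mul]]
    linear_combination v (ψ x) * he

end Chain

section LocalInverse

variable {d : ℕ} {lam : ℂ} {X : Set (EuclideanSpace ℝ (Fin d))}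
  {w : EuclideanSpace ℝ (Fin d) → ℂ} {ψ : EuclideanSpace ℝ (Fin d) → EuclideanSpace ℝ (Fin d)}

theorem exists_openPartialHomeomorph (hX : IsOpen X) (hψ : ContDiffOn ℝ ∞ ψ X)
    (hbij : ∀ x ∈ X, Function.Bijective (fderiv ℝ ψ x)) {x : EuclideanSpace ℝ (Fin d)}
    (hx : x ∈ X) : ∃ e : OpenPartialHomeomorph (EuclideanSpace ℝ (Fin d))
      (EuclideanSpace ℝ (Fin d)), ⇑e = ψ ∧ x ∈ e.source ∧ ContDiffAt ℝ ∞ e.symm (ψ x) := by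
  have hc := hψ.contDiffAt (hX.mem_nhds hx)
  set f' := ContinuousLinearEquiv.ofBijective (fderiv ℝ ψ x)
    (LinearMap.ker_eq_bot.2 (hbij x hx).1) (LinearMap.range_eq_top.2 (hbij x hx).2) with hf'
  have hd : HasFDerivAt ψ (f' : EuclideanSpace ℝ (Fin d) →L[ℝ] EuclideanSpace ℝ (Fin d)) x := by
    have := (hc.differentiableAt (by simp)).hasFDerivAt
    rwa [hf', ContinuousLinearEquiv.coe_ofBijective]
  have hmem := hc.mem_toOpenPartialHomeomorph_source hd (by simp)
  refine ⟨hc.toOpenPartialHomeomorph ψ hd (by simp), rfl, hmem, ?_⟩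
  refine OpenPartialHomeomorph.contDiffAt_symm (f₀' := f') _ ?_ ?_ ?_
  · exact (hc.toOpenPartialHomeomorph ψ hd (by simp)).map_source hmem
  · have := (hc.toOpenPartialHomeomorph ψ hd (by simp)).left_inv hmem
    rw [ContDiffAt.toOpenPartialHomeomorph_coe] at this ⊢
    rwa [this]
  · have := (hc.toOpenPartialHomeomorph ψ hd (by simp)).left_inv hmem
    rw [ContDiffAt.toOpenPartialHomeomorph_coe] at this ⊢
    rwa [this]

theorem isOpen_image_of_bijective (hX : IsOpen X) (hψ : ContDiffOn ℝ ∞ ψ X)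
    (hbij : ∀ x ∈ X, Function.Bijective (fderiv ℝ ψ x)) {U : Set (EuclideanSpace ℝ (Fin d))}
    (hUX : U ⊆ X) (hU : IsOpen U) : IsOpen (ψ '' U) := by
  rw [isOpen_iff_mem_nhds]
  rintro _ ⟨x, hx, rfl⟩
  obtain ⟨e, rfl, hxe, -⟩ := exists_openPartialHomeomorph hX hψ hbij (hUX hx)
  rw [← e.map_nhds_eq hxe]
  exact image_mem_map (hU.mem_nhds hx)

theorem exists_isSol_image (hd : 2 ≤ d) (hX : IsOpen X) (hw : ContDiffOn ℝ ∞ w X)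
    (hψ : ContDiffOn ℝ ∞ ψ X)
    (hT : ∀ v, IsSol lam X v → IsSol lam X fun x => w x * v (ψ x))
    (hw0 : ∀ x ∈ X, w x ≠ 0) (hinj : InjOn ψ X)
    (hbij : ∀ x ∈ X, Function.Bijective (fderiv ℝ ψ x)) {U : Set (EuclideanSpace ℝ (Fin d))}
    (hUX : U ⊆ X) (hU : IsOpen U) {u : EuclideanSpace ℝ (Fin d) → ℂ} (hu : IsSol lam U u) :
    ∃ v, IsSol lam (ψ '' U) v ∧ ∀ x ∈ U, w x * v (ψ x) = u x := by
  set g := Function.invFunOn ψ U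
  have hg : ∀ x ∈ U, g (ψ x) = x := fun x hx => (hinj.mono hUX).leftInvOn_invFunOn hx
  set v := fun y => u (g y) * (w (g y))⁻¹ with hv
  have hvu : ∀ x ∈ U, w x * v (ψ x) = u x := fun x hx => by
    simp only [hv, hg x hx]
    rw [mul_left_comm, mul_inv_cancel₀ (hw0 x (hUX hx)), mul_one]
  have hsmooth : ∀ x ∈ U, ContDiffAt ℝ ∞ v (ψ x) := by
    intro x hx
    obtain ⟨e, he, hxe, hes⟩ := exists_openPartialHomeomorph hX hψ hbij (hUX hx)
    have hex : e.symm (ψ x) = x := by rw [← he]; exact e.left_inv hxe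
    have hgev : g =ᶠ[𝓝 (ψ x)] e.symm := by
      have h1 : ∀ᶠ y in 𝓝 (ψ x), e.symm y ∈ U :=
        hes.continuousAt.eventually (by rw [hex]; exact hU.mem_nhds hx)
      have h2 : ∀ᶠ y in 𝓝 (ψ x), y ∈ e.target :=
        e.open_target.mem_nhds (by rw [← he]; exact e.map_source hxe)
      filter_upwards [h1, h2] with y hy1 hy2
      have := hg _ hy1
      rwa [← he, e.right_inv hy2] at this
    have hgs : ContDiffAt ℝ ∞ g (ψ x) := hes.congr_of_eventuallyEq hgev
    have hus : ContDiffAt ℝ ∞ u (g (ψ x)) := by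
      rw [hg x hx]
      exact hu.1.contDiffAt (hU.mem_nhds hx)
    have hws : ContDiffAt ℝ ∞ w (g (ψ x)) := by
      rw [hg x hx]
      exact hw.contDiffAt (hX.mem_nhds (hUX hx))
    exact (hus.comp _ hgs).mul ((hws.comp _ hgs).inv (by
      simpa only [Function.comp_apply, hg x hx] using hw0 x (hUX hx)))
  refine ⟨v, ⟨?_, ?_⟩, hvu⟩
  · rintro _ ⟨x, hx, rfl⟩
    exact (hsmooth x hx).contDiffWithinAt
  · rintro _ ⟨x, hx, rfl⟩
    have hψx := ContDiffAt.eventually_contDiffAt hX (hUX hx) hψ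
    obtain ⟨c, hc, hcv⟩ := exists_lap_mul_comp_eq hd (lam := lam)
      (ContDiffAt.eventually_contDiffAt hX (hUX hx) hw) hψx
      fun ζ hζ => (hT _ (isSol_expFun hζ X)).2 x (hUX hx)
    have hev : ∀ᶠ y in 𝓝 (ψ x), ContDiffAt ℝ ∞ v y := by
      filter_upwards [(isOpen_image_of_bijective hX hψ hbij hUX hU).mem_nhds
        (mem_image_of_mem ψ hx)]
      rintro _ ⟨y, hy, rfl⟩
      exact hsmooth y hy
    have h1 := hcv v hev
    have h2 : (fun y => w y * v (ψ y)) =ᶠ[𝓝 x] u := by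
      filter_upwards [hU.mem_nhds hx] with y hy using hvu y hy
    rw [lap_congr h2, hvu x hx, hu.2 x hx, sub_self, eq_comm, mul_eq_zero,
      or_iff_right (hc (hw0 x (hUX hx)) (hbij x (hUX hx)).2)] at h1
    exact sub_eq_zero.1 h1

/-- The weight of the `m`-th iterate of a weighted composition operator. -/
def iterWeight (w : EuclideanSpace ℝ (Fin d) → ℂ)
    (ψ : EuclideanSpace ℝ (Fin d) → EuclideanSpace ℝ (Fin d)) (m : ℕ)
    (x : EuclideanSpace ℝ (Fin d)) : ℂ :=
  ∏ j ∈ Finset.range m, w (ψ^[j] x)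

theorem iterWeight_succ (m : ℕ) (x : EuclideanSpace ℝ (Fin d)) :
    iterWeight w ψ (m + 1) x = w x * iterWeight w ψ m (ψ x) := by
  simp [iterWeight, Finset.prod_range_succ', mul_comm]

theorem exists_isSol_iterate_image (hd : 2 ≤ d) (hX : IsOpen X) (hw : ContDiffOn ℝ ∞ w X)
    (hψ : ContDiffOn ℝ ∞ ψ X) (hm : MapsTo ψ X X)
    (hT : ∀ v, IsSol lam X v → IsSol lam X fun x => w x * v (ψ x))
    (hw0 : ∀ x ∈ X, w x ≠ 0) (hinj : InjOn ψ X)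
    (hbij : ∀ x ∈ X, Function.Bijective (fderiv ℝ ψ x)) (m : ℕ) :
    ∀ {U : Set (EuclideanSpace ℝ (Fin d))}, U ⊆ X → IsOpen U →
      ∀ {u : EuclideanSpace ℝ (Fin d) → ℂ}, IsSol lam U u →
      IsOpen (ψ^[m] '' U) ∧
        ∃ v, IsSol lam (ψ^[m] '' U) v ∧ ∀ x ∈ U, iterWeight w ψ m x * v (ψ^[m] x) = u x := by
  induction m with
  | zero => exact fun hUX hU u hu => by simpa using ⟨hU, u, hu, by simp [iterWeight]⟩
  | succ n ih =>
    intro U hUX hU u hu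
    obtain ⟨v₁, hv₁, h₁⟩ := exists_isSol_image hd hX hw hψ hT hw0 hinj hbij hUX hU hu
    obtain ⟨ho, v, hv, h⟩ := ih (image_subset_iff.2 fun x hx => hm (hUX hx))
      (isOpen_image_of_bijective hX hψ hbij hUX hU) hv₁
    rw [Function.iterate_succ, image_comp]
    refine ⟨ho, v, hv, fun x hx => ?_⟩
    rw [iterWeight_succ, mul_assoc, Function.comp_apply, h _ (mem_image_of_mem ψ hx), h₁ x hx]

end LocalInverse

section Eigenspace

variable {d : ℕ} {lam : ℂ} {X : Set (EuclideanSpace ℝ (Fin d))}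
  {w : EuclideanSpace ℝ (Fin d) → ℂ} {ψ : EuclideanSpace ℝ (Fin d) → EuclideanSpace ℝ (Fin d)}

/-- The element of the eigenspace given by a solution. -/
def eigMk {g : EuclideanSpace ℝ (Fin d) → ℂ} (h : IsSol lam X g) : Eig d lam X :=
  ⟨⟨fun z => g z, h.1.continuousOn.comp_continuous continuous_subtype_val fun z => z.2⟩,
    g, h.1, h.2, fun _ => rfl⟩

theorem eigMk_apply {g : EuclideanSpace ℝ (Fin d) → ℂ} (h : IsSol lam X g) (z : X) :
    (eigMk h).1 z = g z := rfl

/-- The extension by zero of an element of the eigenspace. -/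
noncomputable def eigExt (f : C(↥X, ℂ)) : EuclideanSpace ℝ (Fin d) → ℂ :=
  Function.extend Subtype.val f 0

theorem eigExt_apply (f : C(↥X, ℂ)) (z : X) : eigExt f z = f z :=
  Subtype.val_injective.extend_apply _ _ z

theorem isSol_eigExt (hX : IsOpen X) {f : C(↥X, ℂ)} (hf : f ∈ Eig d lam X) :
    IsSol lam X (eigExt f) := by
  obtain ⟨g, hg, hl, hfg⟩ := hf
  refine IsSol.congr hX ⟨hg, hl⟩ fun x hx => ?_
  rw [eigExt_apply f ⟨x, hx⟩, hfg]

theorem mem_Eig_iff (hX : IsOpen X) {f : C(↥X, ℂ)} :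
    f ∈ Eig d lam X ↔ IsSol lam X (eigExt f) :=
  ⟨isSol_eigExt hX, fun h => ⟨_, h.1, h.2, fun z => (eigExt_apply f z).symm⟩⟩

theorem hasBasis_nhds_Eig (f : Eig d lam X) : (𝓝 f).HasBasis
    (fun p : Set X × ℝ => IsCompact p.1 ∧ 0 < p.2)
    fun p => {g | ∀ z ∈ p.1, ‖g.1 z - f.1 z‖ < p.2} := by
  have h := nhds_basis_uniformity' (x := f.1)
    (Metric.uniformity_basis_dist (α := ℂ)).compactConvergenceUniformity
  rw [nhds_subtype_eq_comap]
  refine (h.comap _).congr (fun _ => Iff.rfl) fun p _ => ?_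
  ext g
  refine forall₂_congr fun z _ => ?_
  simp [dist_eq_norm, norm_sub_rev]

theorem tendstoUniformlyOn_eigExt (f : C(↥X, ℂ)) {K : Set (EuclideanSpace ℝ (Fin d))}
    (hKX : K ⊆ X) (hK : IsCompact K) :
    TendstoUniformlyOn (fun g : C(↥X, ℂ) => eigExt g) (eigExt f) (𝓝 f) K := by
  have h := ContinuousMap.tendsto_iff_forall_isCompact_tendstoUniformlyOn.1
    (tendsto_id (x := 𝓝 f)) (Subtype.val ⁻¹' K)
    (IsInducing.subtypeVal.isCompact_preimage_iff (by simpa using hKX) |>.2 hK)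
  rw [Metric.tendstoUniformlyOn_iff] at h ⊢
  intro ε hε
  filter_upwards [h ε hε] with g hg x hx
  have := hg ⟨x, hKX hx⟩ hx
  rwa [← eigExt_apply, ← eigExt_apply] at this

theorem isClosed_Eig (hd : 1 ≤ d) (hX : IsOpen X) : IsClosed (Eig d lam X) := by
  refine isClosed_iff_clusterPt.2 fun f hf => ?_
  have : (𝓝 f ⊓ 𝓟 (Eig d lam X)).NeBot := hf
  have : (comap (Subtype.val : Eig d lam X → C(↥X, ℂ)) (𝓝 f)).NeBot := by
    rw [← Subtype.range_coe (s := Eig d lam X)] at hf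
    exact comap_neBot_iff_frequently.2 ((mem_closure_iff_frequently.1
      (mem_closure_iff_clusterPt.2 hf)).mono fun _ h => h)
  rw [mem_Eig_iff hX]
  refine (IsSol.of_tendsto hd hX (l := comap (Subtype.val : Eig d lam X → C(↥X, ℂ)) (𝓝 f))
    (F := fun g => eigExt g.1) (fun g => isSol_eigExt hX g.2) fun K hKX hK => ?_).1
  intro u hu
  exact tendsto_comap.eventually (tendstoUniformlyOn_eigExt f hKX hK u hu)

theorem continuous_pd_eigExt (hd : 1 ≤ d) (hX : IsOpen X) {x : EuclideanSpace ℝ (Fin d)}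
    (hx : x ∈ X) (j : Fin d) :
    Continuous fun f : Eig d lam X => pd j (eigExt f.1) x := by
  refine continuous_iff_continuousAt.2 fun f => ?_
  refine (IsSol.of_tendsto hd hX (l := 𝓝 f)
    (F := fun g => eigExt g.1) (fun g => isSol_eigExt hX g.2) fun K hKX hK => ?_).2 x hx j
  intro u hu
  exact continuousAt_subtype_val.eventually (tendstoUniformlyOn_eigExt f.1 hKX hK u hu)

theorem continuous_eval_Eig (z : X) : Continuous fun f : Eig d lam X => f.1 z :=
  (ContinuousEvalConst.continuous_eval_const z).comp continuous_subtype_val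

theorem continuous_wcomp (hX : IsOpen X) (hw : ContinuousOn w X) (hψ : ContinuousOn ψ X)
    (hm : MapsTo ψ X X) : Continuous (wcomp X w ψ hw hψ hm) :=
  have := hX.locallyCompactSpace
  (continuous_const (y := (⟨_, hw.domRestrict⟩ : C(↥X, ℂ)))).mul
    (ContinuousMap.continuous_precomp ⟨_, hψ.domRestrict.subtype_mk fun x => hm x.2⟩)

theorem wcomp_restrict_iterate_apply (hw : ContinuousOn w X) (hψ : ContinuousOn ψ X)
    (hm : MapsTo ψ X X) (hwd : MapsTo (wcomp X w ψ hw hψ hm) (Eig d lam X) (Eig d lam X))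
    (m : ℕ) (f : Eig d lam X) (z : X) :
    ((MapsTo.restrict _ _ _ hwd)^[m] f).1 z =
      iterWeight w ψ m z * f.1 ⟨ψ^[m] z, hm.iterate m z.2⟩ := by
  induction m generalizing z with
  | zero => simp [iterWeight]
  | succ n ih =>
    rw [Function.iterate_succ_apply', iterWeight_succ, mul_assoc]
    exact congrArg (w z * ·) (ih ⟨ψ z, hm z.2⟩)

theorem isSol_wcomp (hX : IsOpen X) (hw : ContinuousOn w X) (hψ : ContinuousOn ψ X)
    (hm : MapsTo ψ X X) (hwd : MapsTo (wcomp X w ψ hw hψ hm) (Eig d lam X) (Eig d lam X))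
    {v : EuclideanSpace ℝ (Fin d) → ℂ} (hv : IsSol lam X v) :
    IsSol lam X fun x => w x * v (ψ x) := by
  obtain ⟨g, hg, hl, h⟩ := hwd (eigMk hv).2
  exact IsSol.congr hX ⟨hg, hl⟩ fun x hx => h ⟨x, hx⟩

end Eigenspace

section Birkhoff

/-- Topological transitivity, with a positive number of iterations. -/
def TopTransitive {E : Type*} [TopologicalSpace E] (T : E → E) : Prop :=
  ∀ U V : Set E, IsOpen U → IsOpen V → U.Nonempty → V.Nonempty →
    ∃ m : ℕ, 1 ≤ m ∧ ((T^[m] '' U) ∩ V).Nonempty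

variable {E : Type*} [TopologicalSpace E] {T : E → E}

theorem TopWeaklyMixing.topTransitive (h : TopWeaklyMixing T) : TopTransitive T :=
  fun U V hU hV hUn hVn =>
    let ⟨m, hm, hm', _⟩ := h U U V V hU hU hV hV hUn hUn hVn hVn
    ⟨m, hm, hm'⟩

theorem TopTransitive.forall_mem_of_isClosed (h : TopTransitive T) {S : Set E}
    (hS : IsClosed S) (hTS : ∀ f, T f ∈ S) (f : E) : f ∈ S := by
  by_contra hf
  obtain ⟨m, hm, _, ⟨g, -, rfl⟩, hg⟩ :=
    h univ Sᶜ isOpen_univ hS.isOpen_compl ⟨f, mem_univ f⟩ ⟨f, hf⟩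
  obtain ⟨n, rfl⟩ := Nat.exists_eq_add_of_le' hm
  exact hg (by rw [Function.iterate_succ_apply']; exact hTS _)

theorem TopTransitive.hypercyclic [BaireSpace E] [SecondCountableTopology E] [Nonempty E]
    (h : TopTransitive T) (hT : Continuous T) : Hypercyclic T := by
  have hB := TopologicalSpace.isBasis_countableBasis E
  have hd : Dense (⋂ B ∈ TopologicalSpace.countableBasis E, ⋃ m : ℕ, T^[m] ⁻¹' B) := by
    refine dense_biInter_of_isOpen (fun B hBm => isOpen_iUnion fun m =>
      (hB.isOpen hBm).preimage (hT.iterate m)) (TopologicalSpace.countable_countableBasis E) ?_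
    intro B hBm
    refine dense_iff_inter_open.2 fun U hU hUn => ?_
    obtain ⟨m, -, _, ⟨g, hg, rfl⟩, hgB⟩ := h U B hU (hB.isOpen hBm) hUn
      (TopologicalSpace.nonempty_of_mem_countableBasis hBm)
    exact ⟨g, hg, mem_iUnion.2 ⟨m, hgB⟩⟩
  obtain ⟨x, hx⟩ := hd.nonempty
  refine ⟨x, dense_iff_inter_open.2 fun U hU ⟨y, hy⟩ => ?_⟩
  obtain ⟨B, hBm, -, hBU⟩ := hB.exists_subset_of_mem_open hy hU
  obtain ⟨m, hmB⟩ := mem_iUnion.1 (mem_iInter₂.1 hx B hBm)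
  exact ⟨_, hBU hmB, m, rfl⟩

theorem Hypercyclic.topTransitive [T1Space E] [∀ x : E, (𝓝[≠] x).NeBot]
    (h : Hypercyclic T) : TopTransitive T := by
  obtain ⟨x, hx⟩ := h
  intro U V hU hV hUn hVn
  obtain ⟨_, hnU, n, rfl⟩ := dense_iff_inter_open.1 hx U hU hUn
  obtain ⟨_, hkV, ⟨k, rfl⟩, hk⟩ := dense_iff_inter_open.1
    (hx.sdiff_finite ((finite_Iic n).image fun m => T^[m] x)) V hV hVn
  have hnk : n < k := lt_of_not_ge fun hkn => hk ⟨k, hkn, rfl⟩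
  refine ⟨k - n, by omega, _, ⟨_, hnU, rfl⟩, ?_⟩
  rw [← Function.iterate_add_apply, Nat.sub_add_cancel hnk.le]
  exact hkV

end Birkhoff

section Instances

variable {d : ℕ} {lam : ℂ} {X : Set (EuclideanSpace ℝ (Fin d))}

theorem linForm_twoVec (i j : Fin d) (α β : ℂ) (z : EuclideanSpace ℝ (Fin d)) :
    linForm (twoVec i j α β) z = z i * α + z j * β := by
  rw [linForm_apply, ← sum_mul_twoVec α β fun k => ((z k : ℝ) : ℂ)]
  exact Finset.sum_congr rfl fun k _ => mul_comm _ _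

theorem linForm_neg_left (ζ : Fin d → ℂ) (z : EuclideanSpace ℝ (Fin d)) :
    linForm (-ζ) z = -linForm ζ z := by
  simp [linForm_apply]

theorem sum_sq_neg {ζ : Fin d → ℂ} (hζ : ∑ k, ζ k ^ 2 = lam) : ∑ k, (-ζ) k ^ 2 = lam := by
  simpa using hζ

theorem exists_sum_sq_eq (hd : 2 ≤ d) (lam : ℂ) : ∃ ζ : Fin d → ℂ, ∑ k, ζ k ^ 2 = lam := by
  obtain ⟨β, hβ⟩ := IsAlgClosed.exists_pow_nat_eq lam two_pos
  refine ⟨twoVec ⟨0, by omega⟩ ⟨1, by omega⟩ 0 β, ?_⟩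
  rw [sum_sq_twoVec (by simp), hβ]
  ring

theorem eq_zero_of_re_linForm (hd : 2 ≤ d) {v : EuclideanSpace ℝ (Fin d)}
    (h : ∀ ζ : Fin d → ℂ, ∑ k, ζ k ^ 2 = lam → (linForm ζ v).re = 0) : v = 0 := by
  ext i
  have : Nontrivial (Fin d) := Fin.nontrivial_iff_two_le.2 hd
  obtain ⟨j, hij⟩ := exists_ne i
  obtain ⟨β, hβ⟩ := IsAlgClosed.exists_pow_nat_eq (lam - 1) two_pos
  have h1 := h (twoVec i j 1 β) (by rw [sum_sq_twoVec hij.symm, hβ]; ring)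
  have h2 := h (twoVec i j 1 (-β)) (by rw [sum_sq_twoVec hij.symm, neg_sq, hβ]; ring)
  rw [linForm_twoVec] at h1 h2
  simp only [mul_one, Complex.add_re, Complex.ofReal_re, mul_neg, Complex.neg_re] at h1 h2
  change v i = 0
  linarith

theorem norm_expFun (ζ : Fin d → ℂ) (z : EuclideanSpace ℝ (Fin d)) :
    ‖expFun ζ z‖ = Real.exp (linForm ζ z).re := Complex.norm_exp _

theorem neBot_nhdsWithin_compl_singleton_Eig (hd : 2 ≤ d) (hX : IsOpen X) (hne : X.Nonempty)
    (f : Eig d lam X) : (𝓝[≠] f).NeBot := by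
  obtain ⟨ζ, hζ⟩ := exists_sum_sq_eq hd lam
  rw [← mem_closure_iff_nhdsWithin_neBot, mem_closure_iff_nhds_basis (hasBasis_nhds_Eig f)]
  rintro ⟨K, ε⟩ ⟨hK, hε⟩
  obtain ⟨C, hC⟩ := (hK.image continuous_subtype_val).exists_bound_of_continuousOn
    (contDiff_expFun ζ).continuous.continuousOn
  set δ : ℝ := ε / (|C| + 1) with hδ
  have hδ0 : 0 < δ := by positivity
  refine ⟨eigMk ((isSol_eigExt hX f.2).add hX ((isSol_expFun hζ X).const_mul hX δ)),
    fun hg => ?_, fun z hz => ?_⟩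
  · obtain ⟨x, hx⟩ := hne
    have := congrArg (fun g : Eig d lam X => g.1 ⟨x, hx⟩) (mem_singleton_iff.1 hg)
    simp only [eigMk_apply] at this
    rw [eigExt_apply f.1 ⟨x, hx⟩, add_eq_left, mul_eq_zero, or_iff_left (expFun_ne_zero ζ x)]
      at this
    exact hδ0.ne' (by exact_mod_cast this)
  · rw [eigMk_apply, eigExt_apply, add_sub_cancel_left, norm_mul, Complex.norm_real,
      Real.norm_of_nonneg hδ0.le, hδ, div_mul_eq_mul_div, div_lt_iff₀ (by positivity)]
    have := hC z ⟨z, hz, rfl⟩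
    gcongr
    linarith [le_abs_self C]

theorem baireSpace_Eig (hd : 2 ≤ d) (hX : IsOpen X) : BaireSpace (Eig d lam X) := by
  have := hX.locallyCompactSpace
  have : CompleteSpace (Eig d lam X) :=
    (isClosed_Eig (by omega) hX).isComplete.completeSpace_coe
  infer_instance

theorem secondCountableTopology_Eig (hX : IsOpen X) :
    SecondCountableTopology (Eig d lam X) := by
  have := hX.locallyCompactSpace
  infer_instance

end Instances

section Necessity

variable {d : ℕ} {lam : ℂ} {X : Set (EuclideanSpace ℝ (Fin d))}
  {w : EuclideanSpace ℝ (Fin d) → ℂ} {ψ : EuclideanSpace ℝ (Fin d) → EuclideanSpace ℝ (Fin d)}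
  {hw : ContinuousOn w X} {hψ : ContinuousOn ψ X} {hm : MapsTo ψ X X}
  {hwd : MapsTo (wcomp X w ψ hw hψ hm) (Eig d lam X) (Eig d lam X)}

theorem weight_ne_zero_of_topTransitive (hd : 2 ≤ d)
    (hT : TopTransitive (MapsTo.restrict _ _ _ hwd)) : ∀ x ∈ X, w x ≠ 0 := by
  intro x hx hwx
  obtain ⟨ζ, hζ⟩ := exists_sum_sq_eq hd lam
  refine expFun_ne_zero ζ x (hT.forall_mem_of_isClosed
    (isClosed_singleton.preimage (continuous_eval_Eig ⟨x, hx⟩)) (fun f => ?_)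
    (eigMk (isSol_expFun hζ X)))
  change w x * f.1 _ = 0
  rw [hwx, zero_mul]

theorem injOn_of_topTransitive (hd : 2 ≤ d)
    (hT : TopTransitive (MapsTo.restrict _ _ _ hwd)) : InjOn ψ X := by
  intro x hx y hy hxy
  have hw0 := weight_ne_zero_of_topTransitive hd hT
  have hall := hT.forall_mem_of_isClosed (S := {f | w y * f.1 ⟨x, hx⟩ = w x * f.1 ⟨y, hy⟩})
    (isClosed_eq (continuous_const.mul (continuous_eval_Eig _))
      (continuous_const.mul (continuous_eval_Eig _))) fun f => by
      change w y * (w x * f.1 ⟨ψ x, _⟩) = w x * (w y * f.1 ⟨ψ y, _⟩)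
      simp only [hxy]
      ring
  refine sub_eq_zero.1 (eq_zero_of_re_linForm hd (lam := lam) fun ζ hζ => ?_)
  have h1 := congrArg norm (hall (eigMk (isSol_expFun hζ X)))
  have h2 := congrArg norm (hall (eigMk (isSol_expFun (sum_sq_neg hζ) X)))
  simp only [eigMk_apply, norm_mul, norm_expFun, linForm_neg_left, Complex.neg_re,
    Real.exp_neg] at h1 h2
  rw [map_sub, Complex.sub_re, sub_eq_zero]
  set a := Real.exp (linForm ζ x).re with ha
  set b := Real.exp (linForm ζ y).re with hb
  have ha0 : 0 < a := Real.exp_pos _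
  have hb0 : 0 < b := Real.exp_pos _
  have hp := norm_pos_iff.2 (hw0 x hx)
  have hq := norm_pos_iff.2 (hw0 y hy)
  rw [← div_eq_mul_inv, ← div_eq_mul_inv, div_eq_div_iff ha0.ne' hb0.ne'] at h2
  refine Real.exp_injective (show a = b from ?_)
  have h3 : a * (‖w x‖ * a) = b * (‖w x‖ * b) := by
    rw [← h2, ← h1]
    ring
  have h4 : a ^ 2 = b ^ 2 := mul_left_cancel₀ hp.ne' (by linarith)
  exact (sq_eq_sq₀ ha0.le hb0.le).1 h4

theorem fderiv_eq_sum_pd {g : EuclideanSpace ℝ (Fin d) → ℂ} (x v : EuclideanSpace ℝ (Fin d)) :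
    fderiv ℝ g x v = ∑ j, (v j : ℂ) * pd j g x := by
  conv_lhs => rw [← (EuclideanSpace.basisFun (Fin d) ℝ).sum_repr v]
  simp [pd, map_sum]

theorem bijective_fderiv_of_topTransitive (hd : 2 ≤ d) (hX : IsOpen X)
    (hws : ContDiffOn ℝ ∞ w X) (hψs : ContDiffOn ℝ ∞ ψ X)
    (hT : TopTransitive (MapsTo.restrict _ _ _ hwd)) :
    ∀ x ∈ X, Function.Bijective (fderiv ℝ ψ x) := by
  intro x hx
  have hw0 := weight_ne_zero_of_topTransitive hd hT
  suffices hinj : Function.Injective (fderiv ℝ ψ x) from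
    ⟨hinj, LinearMap.injective_iff_surjective.1 hinj⟩
  refine (injective_iff_map_eq_zero _).2 fun v hv => ?_
  have hwx := (hws.contDiffAt (hX.mem_nhds hx)).differentiableAt (by simp)
  have hψx := (hψs.contDiffAt (hX.mem_nhds hx)).differentiableAt (by simp)
  have hall := hT.forall_mem_of_isClosed
    (S := {f | w x * fderiv ℝ (eigExt f.1) x v = fderiv ℝ w x v * f.1 ⟨x, hx⟩})
    (isClosed_eq (continuous_const.mul (by
      simp only [fderiv_eq_sum_pd]
      exact continuous_finsetSum _ fun j _ =>
        continuous_const.mul (continuous_pd_eigExt (by omega) hX hx j)))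
      (continuous_const.mul (continuous_eval_Eig _))) fun f => by
      change w x * fderiv ℝ (eigExt (wcomp X w ψ hw hψ hm f.1)) x v =
        fderiv ℝ w x v * (w x * f.1 ⟨ψ x, hm hx⟩)
      have hfx := ((isSol_eigExt hX f.2).1.contDiffAt
        (hX.mem_nhds (hm hx))).differentiableAt (by simp)
      have hev : eigExt (wcomp X w ψ hw hψ hm f.1) =ᶠ[𝓝 x]
          fun y => w y * eigExt f.1 (ψ y) := by
        filter_upwards [hX.mem_nhds hx] with y hy
        rw [eigExt_apply _ ⟨y, hy⟩, eigExt_apply f.1 ⟨ψ y, hm hy⟩]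
        rfl
      have hder := hwx.hasFDerivAt.mul (hfx.hasFDerivAt.comp x hψx.hasFDerivAt)
      have h' : fderiv ℝ (fun y => w y * eigExt f.1 (ψ y)) x = _ := hder.fderiv
      rw [hev.fderiv_eq, h', ← eigExt_apply f.1 ⟨ψ x, hm hx⟩]
      simp [hv]
      ring
  have hlin : ∀ ζ : Fin d → ℂ, ∑ k, ζ k ^ 2 = lam → w x * linForm ζ v = fderiv ℝ w x v := by
    intro ζ hζ
    have h := hall (eigMk (isSol_expFun hζ X))
    have hev : eigExt (eigMk (isSol_expFun hζ X)).1 =ᶠ[𝓝 x] expFun ζ := by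
      filter_upwards [hX.mem_nhds hx] with y hy
      rw [eigExt_apply _ ⟨y, hy⟩, eigMk_apply]
    rw [mem_ofPred_eq, hev.fderiv_eq, fderiv_expFun, eigMk_apply, ← mul_assoc] at h
    exact mul_right_cancel₀ (expFun_ne_zero ζ x) h
  refine eq_zero_of_re_linForm hd (lam := lam) fun ζ hζ => ?_
  have h := (hlin ζ hζ).trans (hlin _ (sum_sq_neg hζ)).symm
  have h0 := congrArg Complex.re (mul_left_cancel₀ (hw0 x hx) h)
  rw [linForm_neg_left, Complex.neg_re] at h0
  linarith

theorem exists_pos_le_norm_eigMk_expFun {ζ : Fin d → ℂ} (hζ : ∑ k, ζ k ^ 2 = lam) {K : Set X}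
    (hK : IsCompact K) (hKn : K.Nonempty) :
    ∃ c > 0, ∀ z ∈ K, c ≤ ‖(eigMk (isSol_expFun hζ X)).1 z‖ := by
  obtain ⟨z, -, hz⟩ := hK.exists_isMinOn hKn (eigMk (isSol_expFun hζ X)).1.continuous.norm.continuousOn
  exact ⟨_, norm_pos_iff.2 (expFun_ne_zero ζ z), fun y hy => hz hy⟩

/-- The set of elements which are within `ε` of `f` on `K`. -/
def eigNhd (f : Eig d lam X) (K : Set X) (ε : ℝ) : Set (Eig d lam X) :=
  interior {g | ∀ z ∈ K, ‖g.1 z - f.1 z‖ < ε}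

theorem mem_eigNhd_self (f : Eig d lam X) {K : Set X} (hK : IsCompact K) {ε : ℝ} (hε : 0 < ε) :
    f ∈ eigNhd f K ε :=
  mem_interior_iff_mem_nhds.2 ((hasBasis_nhds_Eig f).mem_of_mem (i := (K, ε)) ⟨hK, hε⟩)

theorem exists_norm_iterWeight_dichotomy (hd : 2 ≤ d) {K : Set X} (hK : IsCompact K)
    (hKn : K.Nonempty) : ∃ u : Eig d lam X, ∃ c > 0, ∀ m, ∀ z ∈ K,
      (⟨ψ^[m] z, hm.iterate m z.2⟩ : X) ∈ K →
      (((MapsTo.restrict _ _ _ hwd)^[m] '' eigNhd (eigMk (isSol_zero lam X)) K c ∩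
        eigNhd u K c).Nonempty → 1 < ‖iterWeight w ψ m z‖) ∧
      (((MapsTo.restrict _ _ _ hwd)^[m] '' eigNhd u K c ∩
        eigNhd (eigMk (isSol_zero lam X)) K c).Nonempty → ‖iterWeight w ψ m z‖ < 1) := by
  obtain ⟨ζ, hζ⟩ := exists_sum_sq_eq hd lam
  obtain ⟨c, hc, hcu⟩ := exists_pos_le_norm_eigMk_expFun hζ hK hKn
  set u := eigMk (isSol_expFun hζ X)
  refine ⟨u, c / 2, half_pos hc, fun m z hz hzm => ⟨?_, ?_⟩⟩
  · rintro ⟨_, ⟨f, hf, rfl⟩, hg⟩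
    have h1 := interior_subset hf _ hzm
    have h2 := interior_subset hg z hz
    rw [eigMk_apply, sub_zero] at h1
    rw [wcomp_restrict_iterate_apply, norm_sub_rev] at h2
    have h3 := norm_sub_norm_le (u.1 z) (iterWeight w ψ m z * f.1 ⟨ψ^[m] z, hm.iterate m z.2⟩)
    rw [norm_mul] at h3
    have h4 := hcu z hz
    by_contra! h5
    nlinarith [norm_nonneg (f.1 ⟨ψ^[m] z, hm.iterate m z.2⟩)]
  · rintro ⟨_, ⟨f, hf, rfl⟩, hg⟩
    have h1 := interior_subset hf _ hzm
    have h2 := interior_subset hg z hz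
    rw [norm_sub_rev] at h1
    rw [wcomp_restrict_iterate_apply, eigMk_apply, sub_zero, norm_mul] at h2
    have h3 := norm_sub_norm_le (u.1 ⟨ψ^[m] z, hm.iterate m z.2⟩)
      (f.1 ⟨ψ^[m] z, hm.iterate m z.2⟩)
    have h4 := hcu _ hzm
    by_contra! h5
    nlinarith [norm_nonneg (f.1 ⟨ψ^[m] z, hm.iterate m z.2⟩)]

theorem exists_mem_iterate_mem_of_not_runAway (h : ¬RunAway (MapsTo.restrict ψ X X hm)) :
    ∃ K : Set X, IsCompact K ∧
      ∀ m, 1 ≤ m → ∃ z ∈ K, (⟨ψ^[m] z, hm.iterate m z.2⟩ : X) ∈ K := by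
  simp only [RunAway, not_forall, not_exists, not_and] at h
  obtain ⟨K, hK, h⟩ := h
  refine ⟨K, hK, fun m hm1 => ?_⟩
  obtain ⟨_, ⟨z, hz, rfl⟩, hzK⟩ := nonempty_iff_ne_empty.2 (h m hm1)
  rw [MapsTo.iterate_restrict] at hzK
  exact ⟨z, hz, hzK⟩

theorem TopWeaklyMixing.runAway (hd : 2 ≤ d)
    (hT : TopWeaklyMixing (MapsTo.restrict _ _ _ hwd)) :
    RunAway (MapsTo.restrict ψ X X hm) := by
  by_contra h
  obtain ⟨K, hK, hKm⟩ := exists_mem_iterate_mem_of_not_runAway h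
  obtain ⟨z₀, hz₀, -⟩ := hKm 1 le_rfl
  obtain ⟨u, c, hc, huc⟩ := exists_norm_iterWeight_dichotomy (hwd := hwd) hd hK ⟨z₀, hz₀⟩
  obtain ⟨m, hm1, h1, h2⟩ := hT _ _ _ _ isOpen_interior isOpen_interior isOpen_interior
    isOpen_interior ⟨_, mem_eigNhd_self (eigMk (isSol_zero lam X)) hK hc⟩
    ⟨u, mem_eigNhd_self u hK hc⟩ ⟨u, mem_eigNhd_self u hK hc⟩
    ⟨_, mem_eigNhd_self (eigMk (isSol_zero lam X)) hK hc⟩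
  obtain ⟨z, hz, hzm⟩ := hKm m hm1
  exact lt_asymm ((huc m z hz hzm).1 h1) ((huc m z hz hzm).2 h2)

theorem TopTransitive.runAway_of_norm_le_one (hd : 2 ≤ d) (hw1 : ∀ x ∈ X, ‖w x‖ ≤ 1)
    (hT : TopTransitive (MapsTo.restrict _ _ _ hwd)) :
    RunAway (MapsTo.restrict ψ X X hm) := by
  by_contra h
  obtain ⟨K, hK, hKm⟩ := exists_mem_iterate_mem_of_not_runAway h
  obtain ⟨z₀, hz₀, -⟩ := hKm 1 le_rfl
  obtain ⟨u, c, hc, huc⟩ := exists_norm_iterWeight_dichotomy (hwd := hwd) hd hK ⟨z₀, hz₀⟩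
  obtain ⟨m, hm1, h1⟩ := hT _ _ isOpen_interior isOpen_interior
    ⟨_, mem_eigNhd_self (eigMk (isSol_zero lam X)) hK hc⟩ ⟨u, mem_eigNhd_self u hK hc⟩
  obtain ⟨z, hz, hzm⟩ := hKm m hm1
  refine ((huc m z hz hzm).1 h1).not_ge ?_
  rw [iterWeight, norm_prod]
  exact Finset.prod_le_one (fun _ _ => norm_nonneg _) fun j _ => hw1 _ (hm.iterate j z.2)

end Necessity

section Sufficiency

variable {d : ℕ} {lam : ℂ} {X : Set (EuclideanSpace ℝ (Fin d))}
  {w : EuclideanSpace ℝ (Fin d) → ℂ} {ψ : EuclideanSpace ℝ (Fin d) → EuclideanSpace ℝ (Fin d)}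

theorem continuousOn_iterWeight (hw : ContinuousOn w X) (hψ : ContinuousOn ψ X)
    (hm : MapsTo ψ X X) (m : ℕ) : ContinuousOn (iterWeight w ψ m) X :=
  continuousOn_finsetProd _ fun j _ => hw.comp (hψ.iterate hm j) (hm.iterate j)

/-- Simultaneous approximation of a solution on a compact set and of another solution under
the action of a large iterate, given that the union of the compact set and its image does not
separate the space. -/
theorem exists_isSol_approx (hd : 2 ≤ d) (hX : IsOpen X) (hw : ContDiffOn ℝ ∞ w X)
    (hψ : ContDiffOn ℝ ∞ ψ X) (hm : MapsTo ψ X X)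
    (hT : ∀ v, IsSol lam X v → IsSol lam X fun x => w x * v (ψ x))
    (hw0 : ∀ x ∈ X, w x ≠ 0) (hinj : InjOn ψ X)
    (hbij : ∀ x ∈ X, Function.Bijective (fderiv ℝ ψ x))
    {K : Set (EuclideanSpace ℝ (Fin d))} (hKX : K ⊆ X) (hK : IsCompact K) {m : ℕ}
    (hdisj : Disjoint K (ψ^[m] '' K)) (hconn : IsPreconnected (K ∪ ψ^[m] '' K)ᶜ)
    {f g : EuclideanSpace ℝ (Fin d) → ℂ} (hf : IsSol lam X f) (hg : IsSol lam X g)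
    {ε : ℝ} (hε : 0 < ε) :
    ∃ h, IsSol lam univ h ∧ (∀ x ∈ K, ‖h x - f x‖ < ε) ∧
      ∀ x ∈ K, ‖iterWeight w ψ m x * h (ψ^[m] x) - g x‖ < ε := by
  have hcψ : ContinuousOn ψ^[m] X := hψ.continuousOn.iterate hm m
  have hK' : IsCompact (ψ^[m] '' K) := hK.image_of_continuousOn (hcψ.mono hKX)
  obtain ⟨ho, v, hv, hvg⟩ :=
    exists_isSol_iterate_image hd hX hw hψ hm hT hw0 hinj hbij m subset_rfl hX hg
  obtain ⟨O₁, O₂, hO₁, hO₂, hKO₁, hKO₂, hO⟩ := SeparatedNhds.of_isCompact_isCompact hK hK' hdisj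
  obtain ⟨C, hC⟩ := hK.exists_bound_of_continuousOn
    ((continuousOn_iterWeight hw.continuousOn hψ.continuousOn hm m).mono hKX)
  classical
  set F := O₁.piecewise f v
  have hF₁ : IsSol lam (O₁ ∩ X) F := (hf.mono inter_subset_right).congr (hO₁.inter hX)
    fun x hx => piecewise_eq_of_mem _ _ _ hx.1
  have hF₂ : IsSol lam (O₂ ∩ ψ^[m] '' X) F := (hv.mono inter_subset_right).congr (hO₂.inter ho)
    fun x hx => piecewise_eq_of_notMem _ _ _ fun h => disjoint_left.1 hO h hx.1
  have hF : IsSol lam (O₁ ∩ X ∪ O₂ ∩ ψ^[m] '' X) F :=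
    ⟨hF₁.1.union_of_isOpen hF₂.1 (hO₁.inter hX) (hO₂.inter ho),
      fun x hx => hx.elim (hF₁.2 x) (hF₂.2 x)⟩
  obtain ⟨h, hh, hhF⟩ := runge hd lam (hK.union hK') hconn
    ((hO₁.inter hX).union (hO₂.inter ho))
    (union_subset_union (subset_inter hKO₁ hKX) (subset_inter hKO₂ (image_mono hKX))) hF
    (show 0 < ε / (|C| + 1) by positivity)
  refine ⟨h, hh, fun x hx => ?_, fun x hx => ?_⟩
  · have := hhF x (Or.inl hx)
    rw [show F x = f x from piecewise_eq_of_mem _ _ _ (hKO₁ hx)] at this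
    exact this.trans_le (div_le_self hε.le (by linarith [abs_nonneg C]))
  · have := hhF (ψ^[m] x) (Or.inr (mem_image_of_mem _ hx))
    rw [show F (ψ^[m] x) = v (ψ^[m] x) from piecewise_eq_of_notMem _ _ _ fun h =>
      disjoint_left.1 hO h (hKO₂ (mem_image_of_mem _ hx)), lt_div_iff₀ (by positivity)] at this
    rw [← hvg x (hKX hx), ← mul_sub, norm_mul]
    refine lt_of_le_of_lt ?_ this
    rw [mul_comm]
    gcongr
    linarith [hC x hx, le_abs_self C]

theorem topWeaklyMixing_of_runAway (hd : 2 ≤ d) (hX : IsOpen X)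
    (h₀ : X ≃ₜ EuclideanSpace ℝ (Fin d)) (hw : ContDiffOn ℝ ∞ w X)
    (hψ : ContDiffOn ℝ ∞ ψ X) (hm : MapsTo ψ X X)
    (hwd : MapsTo (wcomp X w ψ hw.continuousOn hψ.continuousOn hm) (Eig d lam X) (Eig d lam X))
    (hw0 : ∀ x ∈ X, w x ≠ 0) (hinj : InjOn ψ X) (hrun : RunAway (MapsTo.restrict ψ X X hm))
    (hbij : ∀ x ∈ X, Function.Bijective (fderiv ℝ ψ x)) :
    TopWeaklyMixing (MapsTo.restrict _ _ _ hwd) := by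
  rintro U₁ U₂ V₁ V₂ hU₁ hU₂ hV₁ hV₂ ⟨f₁, hf₁⟩ ⟨f₂, hf₂⟩ ⟨g₁, hg₁⟩ ⟨g₂, hg₂⟩
  have key : ∀ {U : Set (Eig d lam X)} {f : Eig d lam X}, IsOpen U → f ∈ U →
      ∃ K : Set X, IsCompact K ∧ ∃ ε > 0, ∀ g : Eig d lam X,
        (∀ z ∈ K, ‖g.1 z - f.1 z‖ < ε) → g ∈ U := fun hU hf => by
    obtain ⟨⟨K, ε⟩, ⟨hK, hε⟩, h⟩ := (hasBasis_nhds_Eig _).mem_iff.1 (hU.mem_nhds hf)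
    exact ⟨K, hK, ε, hε, fun g hg => h hg⟩
  obtain ⟨K₁, hK₁, ε₁, hε₁, hU₁'⟩ := key hU₁ hf₁
  obtain ⟨K₂, hK₂, ε₂, hε₂, hU₂'⟩ := key hU₂ hf₂
  obtain ⟨L₁, hL₁, δ₁, hδ₁, hV₁'⟩ := key hV₁ hg₁
  obtain ⟨L₂, hL₂, δ₂, hδ₂, hV₂'⟩ := key hV₂ hg₂
  obtain ⟨K, hKX, hKK, hK, m, hm1, hdisj, hconn⟩ := exists_runAway_compact hd hX h₀
    hψ.continuousOn hm hinj (fun U hUX hU => isOpen_image_of_bijective hX hψ hbij hUX hU) hrun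
    (((hK₁.union hK₂).union (hL₁.union hL₂)).image continuous_subtype_val)
    (Subtype.coe_image_subset _ _)
  have main : ∀ {U V : Set (Eig d lam X)} {f g : Eig d lam X} {A B : Set X} {ε δ : ℝ},
      (∀ h : Eig d lam X, (∀ z ∈ A, ‖h.1 z - f.1 z‖ < ε) → h ∈ U) →
      (∀ h : Eig d lam X, (∀ z ∈ B, ‖h.1 z - g.1 z‖ < δ) → h ∈ V) → 0 < ε → 0 < δ →
      (∀ z ∈ A, (z : EuclideanSpace ℝ (Fin d)) ∈ K) →
      (∀ z ∈ B, (z : EuclideanSpace ℝ (Fin d)) ∈ K) →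
      ((MapsTo.restrict _ _ _ hwd)^[m] '' U ∩ V).Nonempty := by
    intro U V f g A B ε δ hU hV hε hδ hA hB
    obtain ⟨h, hh, h1, h2⟩ := exists_isSol_approx hd hX hw hψ hm
      (fun v hv => isSol_wcomp hX _ _ hm hwd hv) hw0 hinj hbij hKX hK hdisj hconn
      (isSol_eigExt hX f.2) (isSol_eigExt hX g.2) (lt_min hε hδ)
    refine ⟨_, ⟨eigMk (hh.mono (subset_univ X)), hU _ fun z hz => ?_, rfl⟩,
      hV _ fun z hz => ?_⟩
    · rw [eigMk_apply, ← eigExt_apply f.1]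
      exact (h1 z (hA z hz)).trans_le (min_le_left _ _)
    · rw [wcomp_restrict_iterate_apply, eigMk_apply, ← eigExt_apply g.1]
      exact (h2 z (hB z hz)).trans_le (min_le_right _ _)
  refine ⟨m, hm1, main hU₁' hV₁' hε₁ hδ₁ (fun z hz => hKK ⟨z, ?_, rfl⟩)
    fun z hz => hKK ⟨z, ?_, rfl⟩, main hU₂' hV₂' hε₂ hδ₂ (fun z hz => hKK ⟨z, ?_, rfl⟩)
    fun z hz => hKK ⟨z, ?_, rfl⟩⟩ <;> simp [hz]

end Sufficiency

end Helpers

/-- for `d ≥ 2`, `λ ∈ ℂ`, `X ⊆ ℝ^d` open and homeomorphic to `ℝ^d`, and smooth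
`w`, `ψ` such that `C_{w,ψ}` maps `E_λ(X)` into itself, `C_{w,ψ}` is weakly mixing on `E_λ(X)`
(compact-open topology) iff `w` has no zeros, `ψ` is injective, run-away, and has invertible
derivative everywhere; and if moreover `|w| ≤ 1`, these are equivalent to hypercyclicity. -/
theorem stmt15 (d : ℕ) (hd : 2 ≤ d) (lam : ℂ)
    (X : Set (EuclideanSpace ℝ (Fin d))) (hXopen : IsOpen X)
    (hhomeo : Nonempty (↥X ≃ₜ EuclideanSpace ℝ (Fin d)))
    (w : EuclideanSpace ℝ (Fin d) → ℂ)
    (ψ : EuclideanSpace ℝ (Fin d) → EuclideanSpace ℝ (Fin d))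
    (hw : ContDiffOn ℝ (⊤ : ℕ∞) w X) (hψ : ContDiffOn ℝ (⊤ : ℕ∞) ψ X)
    (hm : Set.MapsTo ψ X X)
    (hwd : Set.MapsTo (wcomp X w ψ hw.continuousOn hψ.continuousOn hm)
      (Eig d lam X) (Eig d lam X)) :
    (TopWeaklyMixing (Set.MapsTo.restrict _ _ _ hwd) ↔
      ((∀ x ∈ X, w x ≠ 0) ∧ Set.InjOn ψ X ∧
        RunAway (Set.MapsTo.restrict ψ X X hm) ∧
        ∀ x ∈ X, Function.Bijective (fderiv ℝ ψ x))) ∧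
    ((∀ x ∈ X, ‖w x‖ ≤ 1) →
      (TopWeaklyMixing (Set.MapsTo.restrict _ _ _ hwd) ↔
        Hypercyclic (Set.MapsTo.restrict _ _ _ hwd))) := by
  obtain ⟨h₀⟩ := hhomeo
  have hne : X.Nonempty := ⟨_, (h₀.symm 0).2⟩
  have hsuff := topWeaklyMixing_of_runAway hd hXopen h₀ hw hψ hm hwd
  refine ⟨⟨fun h => ?_, fun h => hsuff h.1 h.2.1 h.2.2.1 h.2.2.2⟩,
    fun hw1 => ⟨fun h => ?_, fun h => ?_⟩⟩
  · have ht := h.topTransitive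
    exact ⟨weight_ne_zero_of_topTransitive hd ht, injOn_of_topTransitive hd ht, h.runAway hd,
      bijective_fderiv_of_topTransitive hd hXopen hw hψ ht⟩
  · have := baireSpace_Eig (lam := lam) hd hXopen
    have := secondCountableTopology_Eig (lam := lam) hXopen
    have : Nonempty (Eig d lam X) := ⟨eigMk (isSol_zero lam X)⟩
    exact h.topTransitive.hypercyclic
      ((continuous_wcomp hXopen hw.continuousOn hψ.continuousOn hm).restrict hwd)
  · have := neBot_nhdsWithin_compl_singleton_Eig (lam := lam) hd hXopen hne
    have ht := h.topTransitive
    exact hsuff (weight_ne_zero_of_topTransitive hd ht) (injOn_of_topTransitive hd ht)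
      (ht.runAway_of_norm_le_one hd hw1) (bijective_fderiv_of_topTransitive hd hXopen hw hψ ht)
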